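/- Let n ≥ 2 and let Ω ⊂ ℝⁿ be a nonempty bounded open convex set with smooth boundary. Let F be a Minkowski norm on ℝⁿ and let d_F be the diameter of Ω with respect to the dual norm F⁰. Then for every nonconstant function u that is continuously differentiable on a neighborhood of the closure of Ω and satisfies ∫_Ω u dx = 0, the strict inequality ∫_Ω F(∇u(x))² dx > (π²/d_F²) ∫_Ω u(x)² dx holds. (Equivalently, equality λ₁ᴺ = π²/d_F² in the sharp anisotropic Poincaré inequality can hold only when Ω is a segment in ℝ, so in dimension n ≥ 2 the first nonzero Neumann eigenvalue is strictly larger than π²/d_F².) -/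

import Mathlib

open Real MeasureTheory
open scoped RealInnerProductSpace

noncomputable section

/-- A Minkowski norm on ℝⁿ: nonnegative, convex, C¹ away from the origin, even,
positively 1-homogeneous, and positive away from the origin. -/
structure IsMinkowskiNorm {n : ℕ} (F : EuclideanSpace ℝ (Fin n) → ℝ) : Prop where
  nonneg : ∀ ξ, 0 ≤ F ξ
  convexOn : ConvexOn ℝ Set.univ F
  contDiffOn : ContDiffOn ℝ 1 F {(0 : EuclideanSpace ℝ (Fin n))}ᶜ
  even : ∀ ξ, F (-ξ) = F ξ
  homog : ∀ (t : ℝ) (ξ : EuclideanSpace ℝ (Fin n)), F (t • ξ) = |t| * F ξ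
  pos : ∀ ξ, ξ ≠ 0 → 0 < F ξ

/-- The dual norm `F⁰(x) = sup_{ξ ≠ 0} ⟨x, ξ⟩ / F(ξ)`. -/
def dualNorm {n : ℕ} (F : EuclideanSpace ℝ (Fin n) → ℝ)
    (x : EuclideanSpace ℝ (Fin n)) : ℝ :=
  sSup {r : ℝ | ∃ ξ : EuclideanSpace ℝ (Fin n), ξ ≠ 0 ∧ r = ⟪x, ξ⟫ / F ξ}

/-- A set has smooth boundary: near each boundary point there is a smooth local defining
function with nonvanishing differential. -/
def HasSmoothBoundary {n : ℕ} (Ω : Set (EuclideanSpace ℝ (Fin n))) : Prop :=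
  ∀ x ∈ frontier Ω, ∃ U ∈ nhds x, ∃ f : EuclideanSpace ℝ (Fin n) → ℝ,
    ContDiff ℝ (⊤ : ℕ∞) f ∧ (∀ y ∈ U, (y ∈ Ω ↔ f y < 0)) ∧
      ∀ y ∈ U, y ∈ frontier Ω → fderiv ℝ f y ≠ 0

/-- A Dirichlet inequality with a smooth convex weight, by a Riccati (Picone) argument. -/
theorem dirichlet_of_hasDerivAt {t₀ t₁ α β : ℝ} (h₀ : t₀ < α) (hαβ : α ≤ β) (h₁ : β < t₁)
    {ρ ρ' ρ'' G G' : ℝ → ℝ}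
    (hρ : ∀ t ∈ Set.Icc α β, HasDerivAt ρ (ρ' t) t)
    (hρ' : ∀ t ∈ Set.Icc α β, HasDerivAt ρ' (ρ'' t) t)
    (hpos : ∀ t ∈ Set.Icc α β, 0 ≤ ρ t) (hconv : ∀ t ∈ Set.Icc α β, 0 ≤ ρ'' t)
    (hG : ∀ t ∈ Set.Icc α β, HasDerivAt G (G' t) t) (hG' : ContinuousOn G' (Set.Icc α β))
    (hα : G α = 0) (hβ : G β = 0) :
    (π / (t₁ - t₀)) ^ 2 * ∫ t in α..β, G t ^ 2 * ρ t ^ 2 ≤ ∫ t in α..β, G' t ^ 2 * ρ t ^ 2 := by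
  set κ := π / (t₁ - t₀) with hκ
  have hL : 0 < t₁ - t₀ := by linarith
  have hκpos : 0 < κ := by positivity
  set T : ℝ → ℝ := fun t => κ * (Real.cos (κ * (t - t₀)) / Real.sin (κ * (t - t₀))) with hT
  have hsin : ∀ t ∈ Set.Icc α β, 0 < Real.sin (κ * (t - t₀)) := by
    intro t ht
    apply Real.sin_pos_of_pos_of_lt_pi
    · have : 0 < t - t₀ := by linarith [ht.1]
      positivity
    · rw [hκ, div_mul_eq_mul_div, div_lt_iff₀ hL]
      have : t - t₀ < t₁ - t₀ := by linarith [ht.2]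
      exact mul_lt_mul_of_pos_left this pi_pos
  have hTd : ∀ t ∈ Set.Icc α β, HasDerivAt T (-κ ^ 2 - T t ^ 2) t := by
    intro t ht
    have hs := (hsin t ht).ne'
    have hlin : HasDerivAt (fun t => κ * (t - t₀)) κ t := by
      simpa using ((hasDerivAt_id t).sub_const t₀).const_mul κ
    have := ((hlin.cos.div hlin.sin hs).const_mul κ)
    refine this.congr_deriv ?_
    simp only [hT]
    field_simp
  have hρc : ContinuousOn ρ (Set.Icc α β) := fun t ht => (hρ t ht).continuousAt.continuousWithinAt
  have hGc : ContinuousOn G (Set.Icc α β) := fun t ht => (hG t ht).continuousAt.continuousWithinAt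
  have hi1 : IntervalIntegrable (fun t => G' t ^ 2 * ρ t ^ 2) volume α β :=
    ContinuousOn.intervalIntegrable_of_Icc hαβ (by fun_prop)
  have hi2 : IntervalIntegrable (fun t => κ ^ 2 * (G t ^ 2 * ρ t ^ 2)) volume α β :=
    ContinuousOn.intervalIntegrable_of_Icc hαβ (by fun_prop)
  have hder : ∀ t ∈ Set.Icc α β, HasDerivAt (fun t => G t ^ 2 * ρ t ^ 2 * T t - G t ^ 2 * (ρ t * ρ' t))
      ((2 * G t * G' t * ρ t ^ 2 + G t ^ 2 * (2 * ρ t * ρ' t)) * T t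
        + G t ^ 2 * ρ t ^ 2 * (-κ ^ 2 - T t ^ 2)
        - (2 * G t * G' t * (ρ t * ρ' t) + G t ^ 2 * (ρ' t * ρ' t + ρ t * ρ'' t))) t := by
    intro t ht
    have hg := hG t ht
    have hr := hρ t ht
    refine ((((hg.pow 2).mul (hr.pow 2)).mul (hTd t ht)).sub
      ((hg.pow 2).mul (hr.mul (hρ' t ht)))).congr_deriv ?_
    simp
  have key := intervalIntegral.sub_le_integral_of_hasDeriv_right_of_le hαβ
    (fun t ht => (hder t ht).continuousAt.continuousWithinAt)
    (fun t ht => (hder t (Set.Ioo_subset_Icc_self ht)).hasDerivWithinAt)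
    (φ := fun t => G' t ^ 2 * ρ t ^ 2 - κ ^ 2 * (G t ^ 2 * ρ t ^ 2))
    (ContinuousOn.integrableOn_Icc (by fun_prop)) (by
      intro t ht
      have ht' := Set.Ioo_subset_Icc_self ht
      have h1 := hpos t ht'
      have h2 := hconv t ht'
      have h3 : 0 ≤ G t ^ 2 * (ρ t * ρ'' t) := by positivity
      nlinarith [sq_nonneg (G' t * ρ t + G t * ρ' t - G t * ρ t * T t)])
  rw [intervalIntegral.integral_sub hi1 hi2, intervalIntegral.integral_const_mul] at key
  simp only [hα, hβ] at key
  norm_num at key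
  linarith

/-- Smooth convex approximation of a convex function by double Steklov averaging. -/
theorem ConvexOn.exists_smooth_approx {t₀ t₁ α β ε : ℝ} (h₀ : t₀ < α) (hαβ : α ≤ β) (h₁ : β < t₁)
    (hε : 0 < ε) {ρ : ℝ → ℝ} (hconv : ConvexOn ℝ (Set.Ioo t₀ t₁) ρ) :
    ∃ r r' r'' : ℝ → ℝ, (∀ t ∈ Set.Icc α β, HasDerivAt r (r' t) t) ∧
      (∀ t ∈ Set.Icc α β, HasDerivAt r' (r'' t) t) ∧ (∀ t ∈ Set.Icc α β, 0 ≤ r'' t) ∧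
      ∀ t ∈ Set.Icc α β, |r t - ρ t| ≤ ε := by
  have hc : ContinuousOn ρ (Set.Ioo t₀ t₁) := hconv.continuousOn isOpen_Ioo
  obtain ⟨γ, hγ₁, hγ₂⟩ := exists_between h₁
  have hsub : Set.Icc α γ ⊆ Set.Ioo t₀ t₁ := fun t ht => ⟨by linarith [ht.1], by linarith [ht.2]⟩
  have huc := isCompact_Icc.uniformContinuousOn_of_continuous (hc.mono hsub)
  obtain ⟨δ, hδ, hδ'⟩ := Metric.uniformContinuousOn_iff.1 huc ε hε
  obtain ⟨h, hh, hhδ, hhγ⟩ : ∃ h > 0, 2 * h < δ ∧ β + 2 * h ≤ γ := by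
    refine ⟨min (δ / 4) ((γ - β) / 2), lt_min (by linarith) (by linarith), ?_, ?_⟩
    · linarith [min_le_left (δ / 4) ((γ - β) / 2)]
    · linarith [min_le_right (δ / 4) ((γ - β) / 2)]
  set R₁ : ℝ → ℝ := fun t => ∫ s in α..t, ρ s with hR₁
  have hint : ∀ t ∈ Set.Ioo t₀ t₁, IntervalIntegrable ρ volume α t := fun t ht =>
    (hc.mono ((Set.ordConnected_Ioo).uIcc_subset ⟨h₀, by linarith⟩ ht)).intervalIntegrable
  have hR₁d : ∀ t ∈ Set.Ioo t₀ t₁, HasDerivAt R₁ (ρ t) t := fun t ht =>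
    intervalIntegral.integral_hasDerivAt_right (hint t ht)
      (hc.stronglyMeasurableAtFilter isOpen_Ioo t ht) (hc.continuousAt (isOpen_Ioo.mem_nhds ht))
  have hR₁c : ContinuousOn R₁ (Set.Ioo t₀ t₁) := fun t ht =>
    (hR₁d t ht).continuousAt.continuousWithinAt
  set R₂ : ℝ → ℝ := fun t => ∫ s in α..t, R₁ s with hR₂
  have hint₂ : ∀ t ∈ Set.Ioo t₀ t₁, IntervalIntegrable R₁ volume α t := fun t ht =>
    (hR₁c.mono ((Set.ordConnected_Ioo).uIcc_subset ⟨h₀, by linarith⟩ ht)).intervalIntegrable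
  have hR₂d : ∀ t ∈ Set.Ioo t₀ t₁, HasDerivAt R₂ (R₁ t) t := fun t ht =>
    intervalIntegral.integral_hasDerivAt_right (hint₂ t ht)
      (hR₁c.stronglyMeasurableAtFilter isOpen_Ioo t ht) (hR₁c.continuousAt (isOpen_Ioo.mem_nhds ht))
  have hmem : ∀ t ∈ Set.Icc α β, ∀ x ∈ Set.Icc 0 (2 * h), t + x ∈ Set.Icc α γ := fun t ht x hx =>
    ⟨by linarith [ht.1, hx.1], by linarith [ht.2, hx.2]⟩
  refine ⟨fun t => (R₂ (t + 2 * h) - 2 * R₂ (t + h) + R₂ t) / h ^ 2,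
    fun t => (R₁ (t + 2 * h) - 2 * R₁ (t + h) + R₁ t) / h ^ 2,
    fun t => (ρ (t + 2 * h) - 2 * ρ (t + h) + ρ t) / h ^ 2, ?_, ?_, ?_, ?_⟩
  · intro t ht
    have m0 := hsub (hmem t ht 0 ⟨le_rfl, by linarith⟩)
    have m1 := hsub (hmem t ht h ⟨hh.le, by linarith⟩)
    have m2 := hsub (hmem t ht (2 * h) ⟨by linarith, le_rfl⟩)
    rw [add_zero] at m0
    exact ((((hR₂d _ m2).comp_add_const t (2 * h)).sub
      (((hR₂d _ m1).comp_add_const t h).const_mul 2)).add (hR₂d t m0)).div_const _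
  · intro t ht
    have m0 := hsub (hmem t ht 0 ⟨le_rfl, by linarith⟩)
    have m1 := hsub (hmem t ht h ⟨hh.le, by linarith⟩)
    have m2 := hsub (hmem t ht (2 * h) ⟨by linarith, le_rfl⟩)
    rw [add_zero] at m0
    exact ((((hR₁d _ m2).comp_add_const t (2 * h)).sub
      (((hR₁d _ m1).comp_add_const t h).const_mul 2)).add (hR₁d t m0)).div_const _
  · intro t ht
    have m0 := hsub (hmem t ht 0 ⟨le_rfl, by linarith⟩)
    have m2 := hsub (hmem t ht (2 * h) ⟨by linarith, le_rfl⟩)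
    rw [add_zero] at m0
    have := hconv.2 m0 m2 (by norm_num : (0 : ℝ) ≤ 1 / 2)
      (by norm_num : (0 : ℝ) ≤ 1 / 2) (by norm_num)
    simp only [smul_eq_mul] at this
    rw [show 1 / 2 * t + 1 / 2 * (t + 2 * h) = t + h by ring] at this
    apply div_nonneg _ (by positivity)
    linarith
  · intro t ht
    have hclose : ∀ x ∈ Set.Icc 0 (2 * h), |ρ (t + x) - ρ t| ≤ ε := by
      intro x hx
      have m0 := hmem t ht 0 ⟨le_rfl, by linarith⟩
      rw [add_zero] at m0
      refine (hδ' _ (hmem t ht x hx) _ m0 ?_).le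
      rw [Real.dist_eq, add_sub_cancel_left, abs_of_nonneg hx.1]
      linarith [hx.2]
    have step1 : ∀ x ∈ Set.Icc 0 h, |R₁ (t + x + h) - R₁ (t + x) - h * ρ t| ≤ ε * h := by
      intro x hx
      have := (convex_Icc (0 : ℝ) h).norm_image_sub_le_of_norm_hasDerivWithin_le
        (f := fun y => R₁ (t + x + y) - y * ρ t) (f' := fun y => ρ (t + x + y) - ρ t) (C := ε)
        (x := 0) (y := h) (by
          intro y hy
          have m : t + x + y ∈ Set.Ioo t₀ t₁ := by
            rw [add_assoc]
            exact hsub (hmem t ht (x + y) ⟨by linarith [hx.1, hy.1], by linarith [hx.2, hy.2]⟩)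
          have := ((hR₁d _ m).comp_const_add (t + x) y).sub ((hasDerivAt_id y).mul_const (ρ t))
          exact (this.congr_deriv (by simp)).hasDerivWithinAt) (by
          intro y hy
          rw [Real.norm_eq_abs, add_assoc]
          exact hclose _ ⟨by linarith [hx.1, hy.1], by linarith [hx.2, hy.2]⟩)
        ⟨le_rfl, hh.le⟩ ⟨hh.le, le_rfl⟩
      simp only [Real.norm_eq_abs, sub_zero, add_zero, zero_mul, abs_of_pos hh] at this
      convert this using 2
      ring
    have step2 := (convex_Icc (0 : ℝ) h).norm_image_sub_le_of_norm_hasDerivWithin_le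
        (f := fun x => R₂ (t + h + x) - R₂ (t + x) - x * (h * ρ t))
        (f' := fun x => R₁ (t + x + h) - R₁ (t + x) - h * ρ t) (C := ε * h)
        (x := 0) (y := h) (by
          intro x hx
          have m : t + h + x ∈ Set.Ioo t₀ t₁ := by
            rw [add_assoc]
            exact hsub (hmem t ht (h + x) ⟨by linarith [hx.1], by linarith [hx.2]⟩)
          have m' : t + x ∈ Set.Ioo t₀ t₁ :=
            hsub (hmem t ht x ⟨by linarith [hx.1], by linarith [hx.2]⟩)
          have := (((hR₂d _ m).comp_const_add (t + h) x).sub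
            ((hR₂d _ m').comp_const_add t x)).sub ((hasDerivAt_id x).mul_const (h * ρ t))
          rw [add_right_comm t x h]
          exact (this.congr_deriv (by simp)).hasDerivWithinAt) (by
          intro x hx
          exact step1 x hx)
        ⟨le_rfl, hh.le⟩ ⟨hh.le, le_rfl⟩
    simp only [Real.norm_eq_abs, sub_zero, add_zero, zero_mul, abs_of_pos hh] at step2
    have e : (R₂ (t + 2 * h) - 2 * R₂ (t + h) + R₂ t) / h ^ 2 - ρ t
        = (R₂ (t + h + h) - R₂ (t + h) - h * (h * ρ t) - (R₂ (t + h) - R₂ t)) / h ^ 2 := by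
      rw [show t + h + h = t + 2 * h by ring]
      field_simp
      ring
    rw [e, abs_div, abs_of_pos (by positivity : 0 < h ^ 2), div_le_iff₀ (by positivity)]
    linarith [step2]

theorem dirichlet_of_convexOn {t₀ t₁ α β : ℝ} (h₀ : t₀ < α) (hαβ : α ≤ β) (h₁ : β < t₁)
    {ρ G G' : ℝ → ℝ} (hconv : ConvexOn ℝ (Set.Ioo t₀ t₁) ρ) (hpos : ∀ t ∈ Set.Ioo t₀ t₁, 0 < ρ t)
    (hG : ∀ t ∈ Set.Icc α β, HasDerivAt G (G' t) t) (hG' : ContinuousOn G' (Set.Icc α β))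
    (hα : G α = 0) (hβ : G β = 0) :
    (π / (t₁ - t₀)) ^ 2 * ∫ t in α..β, G t ^ 2 * ρ t ^ 2 ≤ ∫ t in α..β, G' t ^ 2 * ρ t ^ 2 := by
  set κ := π / (t₁ - t₀) with hκ
  have hsub : Set.Icc α β ⊆ Set.Ioo t₀ t₁ := fun t ht => ⟨by linarith [ht.1], by linarith [ht.2]⟩
  have hρc : ContinuousOn ρ (Set.Icc α β) := (hconv.continuousOn isOpen_Ioo).mono hsub
  have hGc : ContinuousOn G (Set.Icc α β) := fun t ht => (hG t ht).continuousAt.continuousWithinAt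
  obtain ⟨t₂, ht₂, hmin⟩ := isCompact_Icc.exists_isMinOn (Set.nonempty_Icc.2 hαβ) hρc
  obtain ⟨t₃, ht₃, hmax⟩ := isCompact_Icc.exists_isMaxOn (Set.nonempty_Icc.2 hαβ) hρc
  have hm := hpos t₂ (hsub ht₂)
  set m := ρ t₂
  set M := ρ t₃
  have hint : ∀ f : ℝ → ℝ, ContinuousOn f (Set.Icc α β) → IntervalIntegrable f volume α β :=
    fun f hf => hf.intervalIntegrable_of_Icc hαβ
  have key : ∀ ε : ℝ, 0 < ε → ε < min m 1 →
      κ ^ 2 * (∫ t in α..β, G t ^ 2 * ρ t ^ 2) - ∫ t in α..β, G' t ^ 2 * ρ t ^ 2 ≤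
        ε * ((2 * M + 1) * (∫ t in α..β, G' t ^ 2) + κ ^ 2 * (2 * M) * ∫ t in α..β, G t ^ 2) := by
    intro ε hε hε'
    have hεm : ε < m := hε'.trans_le (min_le_left _ _)
    have hε1 : ε < 1 := hε'.trans_le (min_le_right _ _)
    obtain ⟨r, r', r'', hr, hr', hr'', hclose⟩ := hconv.exists_smooth_approx h₀ hαβ h₁ hε
    have hrc : ContinuousOn r (Set.Icc α β) := fun t ht => (hr t ht).continuousAt.continuousWithinAt
    have hr0 : ∀ t ∈ Set.Icc α β, 0 ≤ r t := fun t ht => by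
      have h1 : m ≤ ρ t := hmin ht
      have h2 := abs_le.1 (hclose t ht)
      linarith [h2.1]
    have main := dirichlet_of_hasDerivAt h₀ hαβ h₁ hr hr' hr0 hr'' hG hG' hα hβ
    rw [← hκ] at main
    have u1 : ∫ t in α..β, G' t ^ 2 * r t ^ 2 ≤
        ∫ t in α..β, (G' t ^ 2 * ρ t ^ 2 + ε * (2 * M + 1) * G' t ^ 2) := by
      apply intervalIntegral.integral_mono_on hαβ (hint _ (by fun_prop)) (hint _ (by fun_prop))
      intro t ht
      have h1 : m ≤ ρ t := hmin ht
      have h3 : ρ t ≤ M := hmax ht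
      have h2 := abs_le.1 (hclose t ht)
      have h4 : r t ^ 2 ≤ ρ t ^ 2 + ε * (2 * M + 1) := by nlinarith [hr0 t ht]
      nlinarith [sq_nonneg (G' t)]
    have u2 : ∫ t in α..β, (G t ^ 2 * ρ t ^ 2 - ε * (2 * M) * G t ^ 2) ≤
        ∫ t in α..β, G t ^ 2 * r t ^ 2 := by
      apply intervalIntegral.integral_mono_on hαβ (hint _ (by fun_prop)) (hint _ (by fun_prop))
      intro t ht
      have h1 : m ≤ ρ t := hmin ht
      have h3 : ρ t ≤ M := hmax ht
      have h2 := abs_le.1 (hclose t ht)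
      have h4 : ρ t ^ 2 - ε * (2 * M) ≤ r t ^ 2 := by nlinarith [hr0 t ht]
      nlinarith [sq_nonneg (G t)]
    rw [intervalIntegral.integral_add (hint _ (by fun_prop)) (hint _ (by fun_prop)),
      intervalIntegral.integral_const_mul] at u1
    rw [intervalIntegral.integral_sub (hint _ (by fun_prop)) (hint _ (by fun_prop)),
      intervalIntegral.integral_const_mul] at u2
    nlinarith [mul_le_mul_of_nonneg_left u2 (sq_nonneg κ)]
  set C := (2 * M + 1) * (∫ t in α..β, G' t ^ 2) + κ ^ 2 * (2 * M) * ∫ t in α..β, G t ^ 2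
  by_contra! hlt
  have h2 : Filter.Tendsto (fun ε : ℝ => ε * C) (nhdsWithin 0 (Set.Ioi 0)) (nhds 0) := by
    have : Filter.Tendsto (fun ε : ℝ => ε * C) (nhds 0) (nhds (0 * C)) :=
      (continuous_id.mul continuous_const).tendsto 0
    rw [zero_mul] at this
    exact this.mono_left nhdsWithin_le_nhds
  have h3 := ge_of_tendsto h2 (b := κ ^ 2 * (∫ t in α..β, G t ^ 2 * ρ t ^ 2) -
      ∫ t in α..β, G' t ^ 2 * ρ t ^ 2) (by
    filter_upwards [Ioo_mem_nhdsGT (lt_min hm one_pos)] with ε hε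
    exact key ε hε.1 hε.2)
  linarith

theorem neumann_of_convexOn_Icc {t₀ t₁ α β : ℝ} (h₀ : t₀ < α) (hαβ : α < β) (h₁ : β < t₁)
    {A v v' : ℝ → ℝ} (hA : ∀ t ∈ Set.Ioo t₀ t₁, 0 < A t)
    (hconv : ConvexOn ℝ (Set.Ioo t₀ t₁) fun t => (√(A t))⁻¹)
    (hv : ∀ t, HasDerivAt v (v' t) t) (hv' : Continuous v') :
    (π / (t₁ - t₀)) ^ 2 * ((∫ t in α..β, v t ^ 2 * A t) * (∫ t in α..β, A t)
      - (∫ t in α..β, v t * A t) ^ 2) ≤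
      (∫ t in α..β, v' t ^ 2 * A t) * ∫ t in α..β, A t := by
  set κ := π / (t₁ - t₀) with hκ
  have hκpos : 0 < κ := div_pos pi_pos (by linarith)
  have hsub : Set.Icc α β ⊆ Set.Ioo t₀ t₁ := fun t ht => ⟨by linarith [ht.1], by linarith [ht.2]⟩
  have hAc' : ContinuousOn A (Set.Ioo t₀ t₁) := by
    have h := (hconv.continuousOn isOpen_Ioo)
    have h2 : ContinuousOn (fun t => ((√(A t))⁻¹ ^ 2)⁻¹) (Set.Ioo t₀ t₁) :=
      (h.pow 2).inv₀ fun t ht => by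
        have := Real.sqrt_pos.2 (hA t ht)
        exact pow_ne_zero 2 (inv_ne_zero this.ne')
    refine h2.congr fun t ht => ?_
    simp only [inv_pow, inv_inv, Real.sq_sqrt (hA t ht).le]
  have hAc : ContinuousOn A (Set.Icc α β) := hAc'.mono hsub
  have hvc : Continuous v := continuous_iff_continuousAt.2 fun t => (hv t).continuousAt
  have hint : ∀ f : ℝ → ℝ, ContinuousOn f (Set.Icc α β) → IntervalIntegrable f volume α β :=
    fun f hf => hf.intervalIntegrable_of_Icc hαβ.le
  have hIA : 0 < ∫ t in α..β, A t :=
    intervalIntegral.intervalIntegral_pos_of_pos_on (hint _ hAc)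
      (fun t ht => hA t (hsub (Set.Ioo_subset_Icc_self ht))) hαβ
  set m := (∫ t in α..β, v t * A t) / ∫ t in α..β, A t with hm
  have hfc : ContinuousOn (fun t => (v t - m) * A t) (Set.Ioo t₀ t₁) := by fun_prop
  set G : ℝ → ℝ := fun t => ∫ s in α..t, (v s - m) * A s with hG
  have hGd : ∀ t ∈ Set.Icc α β, HasDerivAt G ((v t - m) * A t) t := fun t ht =>
    intervalIntegral.integral_hasDerivAt_right
      ((hfc.mono ((Set.ordConnected_Ioo).uIcc_subset ⟨h₀, by linarith⟩ (hsub ht))).intervalIntegrable)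
      (hfc.stronglyMeasurableAtFilter isOpen_Ioo t (hsub ht))
      (hfc.continuousAt (isOpen_Ioo.mem_nhds (hsub ht)))
  have hGα : G α = 0 := by simp [hG]
  have hGβ : G β = 0 := by
    have : ∀ s, (v s - m) * A s = v s * A s - m * A s := fun s => by ring
    simp only [hG, this]
    rw [intervalIntegral.integral_sub (hint _ (by fun_prop)) (hint _ (by fun_prop)),
      intervalIntegral.integral_const_mul, hm]
    field_simp
    ring
  have hGc : ContinuousOn G (Set.Icc α β) := fun t ht => (hGd t ht).continuousAt.continuousWithinAt
  have hsq : ∀ t ∈ Set.Icc α β, (√(A t))⁻¹ ^ 2 = (A t)⁻¹ := fun t ht => by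
    rw [inv_pow, Real.sq_sqrt (hA t (hsub ht)).le]
  have hAi : ContinuousOn (fun t => (A t)⁻¹) (Set.Icc α β) :=
    hAc.inv₀ fun t ht => (hA t (hsub ht)).ne'
  have key := dirichlet_of_convexOn h₀ hαβ.le h₁ hconv
    (fun t ht => inv_pos.2 (Real.sqrt_pos.2 (hA t ht))) hGd (hfc.mono hsub) hGα hGβ
  have e1 : ∫ t in α..β, G t ^ 2 * (√(A t))⁻¹ ^ 2 = ∫ t in α..β, G t ^ 2 * (A t)⁻¹ :=
    intervalIntegral.integral_congr fun t ht => by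
      rw [Set.uIcc_of_le hαβ.le] at ht
      simp only [hsq t ht]
  have e2 : ∫ t in α..β, ((v t - m) * A t) ^ 2 * (√(A t))⁻¹ ^ 2 =
      ∫ t in α..β, (v t - m) ^ 2 * A t :=
    intervalIntegral.integral_congr fun t ht => by
      rw [Set.uIcc_of_le hαβ.le] at ht
      have := (hA t (hsub ht)).ne'
      simp only [hsq t ht]
      field_simp
  rw [e1, e2, ← hκ] at key
  have parts : ∫ t in α..β, (v t - m) * ((v t - m) * A t) = - ∫ t in α..β, v' t * G t := by
    rw [intervalIntegral.integral_mul_deriv_eq_deriv_mul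
      (u := fun t => v t - m) (v := G) (u' := v') (v' := fun t => (v t - m) * A t)
      (fun t _ => (hv t).sub_const m)
      (fun t ht => hGd t (by rwa [Set.uIcc_of_le hαβ.le] at ht))
      (hv'.intervalIntegrable _ _) (hint _ (by fun_prop)), hGα, hGβ]
    ring
  have amgm : - ∫ t in α..β, v' t * G t ≤
      ∫ t in α..β, ((2 * κ ^ 2)⁻¹ * (v' t ^ 2 * A t) + κ ^ 2 / 2 * (G t ^ 2 * (A t)⁻¹)) := by
    rw [← intervalIntegral.integral_neg]
    apply intervalIntegral.integral_mono_on hαβ.le (hint _ (by fun_prop)) (hint _ (by fun_prop))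
    intro t ht
    have hAt := hA t (hsub ht)
    have : (2 * κ ^ 2)⁻¹ * (v' t ^ 2 * A t) + κ ^ 2 / 2 * (G t ^ 2 * (A t)⁻¹) - -(v' t * G t)
        = (2 * κ ^ 2 * A t)⁻¹ * (v' t * A t + κ ^ 2 * G t) ^ 2 := by
      field_simp
      ring
    have h2 : 0 ≤ (2 * κ ^ 2 * A t)⁻¹ * (v' t * A t + κ ^ 2 * G t) ^ 2 := by positivity
    linarith
  rw [intervalIntegral.integral_add (hint _ (by fun_prop)) (hint _ (by fun_prop)),
    intervalIntegral.integral_const_mul, intervalIntegral.integral_const_mul] at amgm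
  have e3 : ∫ t in α..β, (v t - m) * ((v t - m) * A t) = ∫ t in α..β, (v t - m) ^ 2 * A t := by
    congr 1; ext t; ring
  have e4 : ∫ t in α..β, (v t - m) ^ 2 * A t = (∫ t in α..β, v t ^ 2 * A t)
      - 2 * m * (∫ t in α..β, v t * A t) + m ^ 2 * ∫ t in α..β, A t := by
    have : ∀ t, (v t - m) ^ 2 * A t = v t ^ 2 * A t - 2 * m * (v t * A t) + m ^ 2 * A t :=
      fun t => by ring
    simp only [this]
    rw [intervalIntegral.integral_add (hint _ (by fun_prop)) (hint _ (by fun_prop)),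
      intervalIntegral.integral_sub (hint _ (by fun_prop)) (hint _ (by fun_prop)),
      intervalIntegral.integral_const_mul, intervalIntegral.integral_const_mul]
  have main : κ ^ 2 * ∫ t in α..β, (v t - m) ^ 2 * A t ≤ ∫ t in α..β, v' t ^ 2 * A t := by
    have h1 : ∫ t in α..β, (v t - m) ^ 2 * A t ≤
        (2 * κ ^ 2)⁻¹ * (∫ t in α..β, v' t ^ 2 * A t) +
          1 / 2 * ∫ t in α..β, (v t - m) ^ 2 * A t := by
      linarith [e3, parts]
    have h2 : (2 * κ ^ 2)⁻¹ * (∫ t in α..β, v' t ^ 2 * A t) * (2 * κ ^ 2)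
        = ∫ t in α..β, v' t ^ 2 * A t := by field_simp
    nlinarith [mul_le_mul_of_nonneg_right h1 (by positivity : 0 ≤ 2 * κ ^ 2)]
  have e5 : (∫ t in α..β, v t * A t) = m * ∫ t in α..β, A t := by
    rw [hm]; field_simp
  rw [e4] at main
  have := mul_le_mul_of_nonneg_right main hIA.le
  rw [e5] at this ⊢
  nlinarith

/-- The one-dimensional weighted Poincaré inequality on an interval, for a weight `A` with
`A ^ (-1/2)` convex. -/
theorem neumann_of_convexOn_Ioo {t₀ t₁ : ℝ} (h : t₀ < t₁)
    {A v v' : ℝ → ℝ} (hA : ∀ t ∈ Set.Ioo t₀ t₁, 0 < A t)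
    (hAi : IntervalIntegrable A volume t₀ t₁)
    (hconv : ConvexOn ℝ (Set.Ioo t₀ t₁) fun t => (√(A t))⁻¹)
    (hv : ∀ t, HasDerivAt v (v' t) t) (hv' : Continuous v') :
    (π / (t₁ - t₀)) ^ 2 * ((∫ t in t₀..t₁, v t ^ 2 * A t) * (∫ t in t₀..t₁, A t)
      - (∫ t in t₀..t₁, v t * A t) ^ 2) ≤
      (∫ t in t₀..t₁, v' t ^ 2 * A t) * ∫ t in t₀..t₁, A t := by
  have hvc : Continuous v := continuous_iff_continuousAt.2 fun t => (hv t).continuousAt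
  have hlim : ∀ f : ℝ → ℝ, Continuous f → Filter.Tendsto
      (fun ε => ∫ t in (t₀ + ε)..(t₁ - ε), f t * A t) (nhdsWithin 0 (Set.Ioi 0))
      (nhds (∫ t in t₀..t₁, f t * A t)) := by
    intro f hf
    have hi : IntervalIntegrable (fun t => f t * A t) volume t₀ t₁ :=
      hAi.continuousOn_mul hf.continuousOn
    have hc := intervalIntegral.continuousOn_primitive_interval'
      hi (Set.left_mem_uIcc : t₀ ∈ Set.uIcc t₀ t₁)
    rw [Set.uIcc_of_le h.le] at hc
    have ev : ∀ᶠ ε : ℝ in nhdsWithin 0 (Set.Ioi 0), 0 < ε ∧ ε < t₁ - t₀ :=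
      Ioo_mem_nhdsGT (by linarith)
    have l1 : Filter.Tendsto (fun ε : ℝ => ∫ t in t₀..(t₁ - ε), f t * A t)
        (nhdsWithin 0 (Set.Ioi 0)) (nhds (∫ t in t₀..t₁, f t * A t)) := by
      refine (hc t₁ ⟨h.le, le_rfl⟩).tendsto.comp (tendsto_nhdsWithin_iff.2 ⟨?_, ?_⟩)
      · have : Filter.Tendsto (fun ε : ℝ => t₁ - ε) (nhds 0) (nhds (t₁ - 0)) :=
          (continuous_const.sub continuous_id).tendsto 0
        rw [sub_zero] at this
        exact this.mono_left nhdsWithin_le_nhds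
      · filter_upwards [ev] with ε hε
        exact ⟨by linarith [hε.2], by linarith [hε.1]⟩
    have l2 : Filter.Tendsto (fun ε : ℝ => ∫ t in t₀..(t₀ + ε), f t * A t)
        (nhdsWithin 0 (Set.Ioi 0)) (nhds (∫ t in t₀..t₀, f t * A t)) := by
      refine (hc t₀ ⟨le_rfl, h.le⟩).tendsto.comp (tendsto_nhdsWithin_iff.2 ⟨?_, ?_⟩)
      · have : Filter.Tendsto (fun ε : ℝ => t₀ + ε) (nhds 0) (nhds (t₀ + 0)) :=
          (continuous_const.add continuous_id).tendsto 0
        rw [add_zero] at this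
        exact this.mono_left nhdsWithin_le_nhds
      · filter_upwards [ev] with ε hε
        exact ⟨by linarith [hε.1], by linarith [hε.2]⟩
    have l3 := l1.sub l2
    rw [intervalIntegral.integral_same, sub_zero] at l3
    refine l3.congr' ?_
    filter_upwards [ev] with ε hε
    have hsub : ∀ x ∈ Set.Icc t₀ t₁, IntervalIntegrable (fun t => f t * A t) volume t₀ x :=
      fun x hx => hi.mono_set (by
        rw [Set.uIcc_of_le h.le, Set.uIcc_of_le hx.1]
        exact Set.Icc_subset_Icc le_rfl hx.2)
    exact intervalIntegral.integral_interval_sub_left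
      (hsub _ ⟨by linarith [hε.2], by linarith [hε.1]⟩)
      (hsub _ ⟨by linarith [hε.1], by linarith [hε.2]⟩)
  have l1 := hlim (fun t => v t ^ 2) (by fun_prop)
  have l2 := hlim (fun _ => 1) (by fun_prop)
  have l3 := hlim v hvc
  have l4 := hlim (fun t => v' t ^ 2) (by fun_prop)
  simp only [one_mul] at l2
  refine le_of_tendsto_of_tendsto (((l1.mul l2).sub (l3.pow 2)).const_mul _) (l4.mul l2) ?_
  filter_upwards [Ioo_mem_nhdsGT (by linarith : (0 : ℝ) < (t₁ - t₀) / 2)] with ε hε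
  exact neumann_of_convexOn_Icc (by linarith [hε.1]) (by linarith [hε.2]) (by linarith [hε.1])
    hA hconv hv hv'

open Pointwise in
theorem volume_image_affine_real {s : ℝ} (hs : 0 < s) (c : ℝ) (K : Set ℝ) :
    volume ((fun x => s * x + c) '' K) = ENNReal.ofReal s * volume K := by
  have : (fun x => s * x + c) '' K = (fun x => x + c) '' (s • K) := by
    rw [← Set.image_smul, Set.image_image]
    simp
  rw [this, Set.image_add_right, measure_preimage_add_right, Measure.addHaar_smul]
  simp [abs_of_pos hs]

theorem brunn_minkowski_real_of_isCompact {A B C : Set ℝ} (hA : IsCompact A) (hB : IsCompact B)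
    (hA' : A.Nonempty) (hB' : B.Nonempty) {s t : ℝ} (hs : 0 < s) (ht : 0 < t)
    (h : ∀ x ∈ A, ∀ y ∈ B, s * x + t * y ∈ C) :
    ENNReal.ofReal s * volume A + ENNReal.ofReal t * volume B ≤ volume C := by
  obtain ⟨a, ha, hamax⟩ := hA.exists_isGreatest hA'
  obtain ⟨b, hb, hbmin⟩ := hB.exists_isLeast hB'
  have e1 := volume_image_affine_real hs (t * b) A
  have e2 := volume_image_affine_real ht (s * a) B
  have hnull : volume ({s * a + t * b} : Set ℝ) = 0 := by simp
  have hcomp : IsCompact ((fun x => t * x + s * a) '' B) := hB.image (by fun_prop)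
  rw [← e1, ← e2, ← measure_sdiff_null hnull (s := (fun x => t * x + s * a) '' B),
    ← measure_union _ (hcomp.measurableSet.diff (measurableSet_singleton _))]
  · apply measure_mono
    rintro _ (⟨x, hx, rfl⟩ | ⟨⟨y, hy, rfl⟩, -⟩)
    · exact h x hx b hb
    · simp only
      rw [add_comm]
      exact h a ha y hy
  · rw [Set.disjoint_left]
    rintro _ ⟨x, hx, rfl⟩ ⟨⟨y, hy, hxy⟩, hne⟩
    apply hne
    have h1 := hamax hx
    have h2 := hbmin hy
    simp only [Set.mem_singleton_iff] at hxy ⊢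
    nlinarith

theorem brunn_minkowski_real {A B C : Set ℝ} (hA : MeasurableSet A) (hB : MeasurableSet B)
    (hA' : A.Nonempty) (hB' : B.Nonempty) {s t : ℝ} (hs : 0 < s) (ht : 0 < t)
    (h : ∀ x ∈ A, ∀ y ∈ B, s * x + t * y ∈ C) :
    ENNReal.ofReal s * volume A + ENNReal.ofReal t * volume B ≤ volume C := by
  obtain ⟨a, ha⟩ := hA'
  obtain ⟨b, hb⟩ := hB'
  rw [hA.measure_eq_iSup_isCompact, hB.measure_eq_iSup_isCompact]
  simp only [iSup_and', ENNReal.mul_iSup]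
  refine ENNReal.biSup_add_biSup_le' ⟨∅, Set.empty_subset _, isCompact_empty⟩
    ⟨∅, Set.empty_subset _, isCompact_empty⟩ ?_
  rintro K₁ ⟨h1, c1⟩ K₂ ⟨h2, c2⟩
  refine le_trans ?_ (brunn_minkowski_real_of_isCompact (c1.insert a) (c2.insert b)
    (Set.insert_nonempty _ _) (Set.insert_nonempty _ _) hs ht
    fun x hx y hy => h x (Set.insert_subset ha h1 hx) y (Set.insert_subset hb h2 hy))
  gcongr
  · exact Set.subset_insert _ _
  · exact Set.subset_insert _ _

theorem prekopa_leindler_real_of_le_one {f g : ℝ → ℝ} {h : ℝ → ENNReal} (hf : Measurable f)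
    (hg : Measurable g) (hh : Measurable h) (hf0 : ∀ x, 0 ≤ f x) (hg0 : ∀ x, 0 ≤ g x)
    (hf1 : ∀ x, f x ≤ 1) (hg1 : ∀ x, g x ≤ 1) (hfs : ∀ τ < 1, ∃ x, τ < f x)
    (hgs : ∀ τ < 1, ∃ x, τ < g x) {s t : ℝ} (hs : 0 < s) (ht : 0 < t) (hst : s + t = 1)
    (H : ∀ x y, ENNReal.ofReal (f x ^ s * g y ^ t) ≤ h (s * x + t * y)) :
    ENNReal.ofReal s * (∫⁻ x, ENNReal.ofReal (f x)) + ENNReal.ofReal t * (∫⁻ x, ENNReal.ofReal (g x))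
      ≤ ∫⁻ x, h x := by
  have hmin : ∀ x, min (h x) 1 ≠ ⊤ := fun x => by simp
  have hk : Measurable fun x => (min (h x) 1).toReal := (hh.min measurable_const).ennreal_toReal
  have e3 : ∫⁻ x, ENNReal.ofReal ((min (h x) 1).toReal) ≤ ∫⁻ x, h x := by
    refine lintegral_mono fun x => ?_
    rw [ENNReal.ofReal_toReal (hmin x)]
    exact min_le_left _ _
  refine le_trans ?_ e3
  rw [lintegral_eq_lintegral_meas_lt volume (ae_of_all _ hf0) hf.aemeasurable,
    lintegral_eq_lintegral_meas_lt volume (ae_of_all _ hg0) hg.aemeasurable,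
    lintegral_eq_lintegral_meas_lt volume (ae_of_all _ fun x => ENNReal.toReal_nonneg)
      hk.aemeasurable]
  have mf : Measurable fun τ : ℝ => volume {a | τ < f a} :=
    Antitone.measurable fun a b hab => measure_mono fun x hx => lt_of_le_of_lt hab hx
  have mg : Measurable fun τ : ℝ => volume {a | τ < g a} :=
    Antitone.measurable fun a b hab => measure_mono fun x hx => lt_of_le_of_lt hab hx
  rw [← lintegral_const_mul _ mf, ← lintegral_const_mul _ mg, ← lintegral_add_left (mf.const_mul _)]
  refine setLIntegral_mono' measurableSet_Ioi fun τ hτ => ?_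
  have hτ' : 0 < τ := hτ
  rcases lt_or_ge τ 1 with h1 | h1
  · refine brunn_minkowski_real (hf measurableSet_Ioi) (hg measurableSet_Ioi) (hfs τ h1) (hgs τ h1)
      hs ht fun x hx y hy => ?_
    have hx' : τ < f x := hx
    have hy' : τ < g y := hy
    have h2 : τ < f x ^ s * g y ^ t := by
      calc τ = τ ^ s * τ ^ t := by rw [← rpow_add hτ', hst, rpow_one]
        _ < f x ^ s * g y ^ t := by gcongr
    have h3 : f x ^ s * g y ^ t ≤ 1 :=
      mul_le_one₀ (rpow_le_one (hf0 x) (hf1 x) hs.le) (rpow_nonneg (hg0 y) _)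
        (rpow_le_one (hg0 y) (hg1 y) ht.le)
    simp only [Set.mem_ofPred_eq]
    refine lt_of_lt_of_le h2 ?_
    rw [← ENNReal.ofReal_le_iff_le_toReal (hmin _)]
    exact le_min (H x y) (by simpa using h3)
  · have h2 : {a | τ < f a} = ∅ := by
      ext x; simp only [Set.mem_ofPred_eq, Set.mem_empty_iff_false, iff_false, not_lt]
      exact (hf1 x).trans h1
    have h3 : {a | τ < g a} = ∅ := by
      ext x; simp only [Set.mem_ofPred_eq, Set.mem_empty_iff_false, iff_false, not_lt]
      exact (hg1 x).trans h1
    simp [h2, h3]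

theorem ENNReal.rpow_mul_rpow_le_add {s t : ℝ} (hs : 0 < s) (ht : 0 < t) (hst : s + t = 1)
    (a b : ENNReal) : a ^ s * b ^ t ≤ ENNReal.ofReal s * a + ENNReal.ofReal t * b := by
  have hs' : ENNReal.ofReal s ≠ 0 := by simpa using hs
  have ht' : ENNReal.ofReal t ≠ 0 := by simpa using ht
  rcases eq_or_ne a ⊤ with rfl | ha
  · simp [ENNReal.mul_top hs']
  rcases eq_or_ne b ⊤ with rfl | hb
  · simp [ENNReal.mul_top ht']
  lift a to NNReal using ha
  lift b to NNReal using hb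
  have := NNReal.geom_mean_le_arith_mean2_weighted ⟨s, hs.le⟩ ⟨t, ht.le⟩ a b
    (by apply NNReal.eq; exact hst)
  rw [← ENNReal.coe_rpow_of_nonneg _ hs.le, ← ENNReal.coe_rpow_of_nonneg _ ht.le,
    ENNReal.ofReal_eq_coe_nnreal hs.le, ENNReal.ofReal_eq_coe_nnreal ht.le]
  exact_mod_cast this

theorem prekopa_leindler_real_of_bounded {f g h : ℝ → ENNReal} (hf : Measurable f)
    (hg : Measurable g) (hh : Measurable h) {M : ENNReal} (hM : M ≠ ⊤) (hfM : ∀ x, f x ≤ M)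
    (hgM : ∀ x, g x ≤ M) {s t : ℝ} (hs : 0 < s) (ht : 0 < t) (hst : s + t = 1)
    (H : ∀ x y, f x ^ s * g y ^ t ≤ h (s * x + t * y)) :
    (∫⁻ x, f x) ^ s * (∫⁻ x, g x) ^ t ≤ ∫⁻ x, h x := by
  set a := ⨆ x, f x with ha
  set b := ⨆ x, g x with hb
  have haM : a ≠ ⊤ := ne_top_of_le_ne_top hM (iSup_le hfM)
  have hbM : b ≠ ⊤ := ne_top_of_le_ne_top hM (iSup_le hgM)
  have hfa : ∀ x, f x ≤ a := le_iSup f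
  have hgb : ∀ x, g x ≤ b := le_iSup g
  rcases eq_or_ne a 0 with ha0 | ha0
  · have : ∀ x, f x = 0 := fun x => le_antisymm (ha0 ▸ hfa x) bot_le
    simp [this, hs]
  rcases eq_or_ne b 0 with hb0 | hb0
  · have : ∀ x, g x = 0 := fun x => le_antisymm (hb0 ▸ hgb x) bot_le
    simp [this, ht]
  have fin_div : ∀ {p q : ENNReal}, p ≤ q → q ≠ 0 → q ≠ ⊤ → p / q ≠ ⊤ := fun h h0 hq =>
    ENNReal.div_ne_top (ne_top_of_le_ne_top hq h) h0
  have key : ∀ {p : ℝ → ENNReal} {q : ENNReal}, q = ⨆ x, p x → q ≠ 0 → q ≠ ⊤ →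
      (∀ x, (p x / q).toReal ≤ 1) ∧ ∀ τ < 1, ∃ x, τ < (p x / q).toReal := by
    intro p q hq h0 ht
    have hpq : ∀ x, p x ≤ q := fun x => hq ▸ le_iSup p x
    constructor
    · intro x
      refine ENNReal.toReal_le_of_le_ofReal zero_le_one ?_
      rw [ENNReal.ofReal_one]
      exact ENNReal.div_le_of_le_mul (by simpa using hpq x)
    · intro τ hτ
      have : ENNReal.ofReal τ * q < q := by
        conv_rhs => rw [← one_mul q]
        exact ENNReal.mul_lt_mul_left h0 ht (by simpa using hτ)
      conv_rhs at this => rw [hq]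
      obtain ⟨x, hx⟩ := lt_iSup_iff.1 this
      refine ⟨x, ?_⟩
      by_contra! hcon
      have h1 := ENNReal.ofReal_le_ofReal hcon
      rw [ENNReal.ofReal_toReal (fin_div (hpq x) h0 ht)] at h1
      exact absurd hx (not_lt.2 ((ENNReal.div_le_iff h0 ht).1 h1))
  set c := a ^ s * b ^ t with hc
  have has0 : a ^ s ≠ 0 := (ENNReal.rpow_pos (pos_iff_ne_zero.2 ha0) haM).ne'
  have hbt0 : b ^ t ≠ 0 := (ENNReal.rpow_pos (pos_iff_ne_zero.2 hb0) hbM).ne'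
  have hast : a ^ s ≠ ⊤ := ENNReal.rpow_ne_top_of_nonneg hs.le haM
  have hbtt : b ^ t ≠ ⊤ := ENNReal.rpow_ne_top_of_nonneg ht.le hbM
  have hc0 : c ≠ 0 := mul_ne_zero has0 hbt0
  have hct : c ≠ ⊤ := ENNReal.mul_ne_top hast hbtt
  have e : ∀ X Y : ENNReal, (X / a) ^ s * (Y / b) ^ t = X ^ s * Y ^ t / c := by
    intro X Y
    rw [ENNReal.div_rpow_of_nonneg _ _ hs.le, ENNReal.div_rpow_of_nonneg _ _ ht.le, hc,
      div_eq_mul_inv, div_eq_mul_inv, div_eq_mul_inv,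
      ENNReal.mul_inv (Or.inl has0) (Or.inl hast)]
    ring
  have main := prekopa_leindler_real_of_le_one (f := fun x => (f x / a).toReal)
    (g := fun x => (g x / b).toReal) (h := fun x => h x / c) (hf.div_const a).ennreal_toReal
    (hg.div_const b).ennreal_toReal (hh.div_const c) (fun _ => ENNReal.toReal_nonneg)
    (fun _ => ENNReal.toReal_nonneg) (key ha ha0 haM).1 (key hb hb0 hbM).1 (key ha ha0 haM).2
    (key hb hb0 hbM).2 hs ht hst (fun x y => by
      rw [ENNReal.toReal_rpow, ENNReal.toReal_rpow, ← ENNReal.toReal_mul]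
      refine ENNReal.ofReal_toReal_le.trans ?_
      rw [e]
      exact ENNReal.div_le_div_right (H x y) c)
  simp only [ENNReal.ofReal_toReal (fin_div (hfa _) ha0 haM),
    ENNReal.ofReal_toReal (fin_div (hgb _) hb0 hbM)] at main
  have l := (ENNReal.rpow_mul_rpow_le_add hs ht hst _ _).trans main
  simp only [div_eq_mul_inv] at l
  rw [lintegral_mul_const _ hf, lintegral_mul_const _ hg, lintegral_mul_const _ hh,
    ← div_eq_mul_inv, ← div_eq_mul_inv, e, ← div_eq_mul_inv] at l
  rwa [ENNReal.div_le_iff hc0 hct, ENNReal.div_mul_cancel hc0 hct] at l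

theorem prekopa_leindler_real {f g h : ℝ → ENNReal} (hf : Measurable f)
    (hg : Measurable g) (hh : Measurable h) {s t : ℝ} (hs : 0 < s) (ht : 0 < t) (hst : s + t = 1)
    (H : ∀ x y, f x ^ s * g y ^ t ≤ h (s * x + t * y)) :
    (∫⁻ x, f x) ^ s * (∫⁻ x, g x) ^ t ≤ ∫⁻ x, h x := by
  have hsup : ∀ p : ENNReal, p = ⨆ k : ℕ, min p k := by
    intro p
    rw [← inf_iSup_eq, ENNReal.iSup_natCast, inf_top_eq]
  have hint : ∀ {p : ℝ → ENNReal}, Measurable p → ∫⁻ x, p x = ⨆ k : ℕ, ∫⁻ x, min (p x) k := by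
    intro p hp
    rw [← lintegral_iSup (fun k => hp.min measurable_const)]
    · exact lintegral_congr fun x => hsup _
    · intro i j hij x
      exact min_le_min_left _ (by exact_mod_cast hij)
  have hpow : ∀ (r : ℝ), 0 < r → ∀ q : ℕ → ENNReal, (⨆ k, q k) ^ r = ⨆ k, q k ^ r := fun r hr q =>
    (ENNReal.orderIsoRpow r hr).map_iSup q
  rw [hint hf, hint hg, hpow s hs, hpow t ht, ENNReal.iSup_mul]
  refine iSup_le fun i => ?_
  rw [ENNReal.mul_iSup]
  refine iSup_le fun j => ?_
  refine prekopa_leindler_real_of_bounded (hf.min measurable_const) (hg.min measurable_const) hh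
    (M := ((max i j : ℕ) : ENNReal)) (by simp) (fun x => ?_) (fun x => ?_) hs ht hst fun x y => ?_
  · exact (min_le_right _ _).trans (by exact_mod_cast le_max_left i j)
  · exact (min_le_right _ _).trans (by exact_mod_cast le_max_right i j)
  · refine le_trans ?_ (H x y)
    gcongr <;> exact min_le_left _ _

theorem prekopa_leindler_pi {s t : ℝ} (hs : 0 < s) (ht : 0 < t) (hst : s + t = 1) :
    ∀ (m : ℕ) {f g h : (Fin m → ℝ) → ENNReal}, Measurable f → Measurable g → Measurable h →
    (∀ x y, f x ^ s * g y ^ t ≤ h (s • x + t • y)) →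
    (∫⁻ x, f x) ^ s * (∫⁻ x, g x) ^ t ≤ ∫⁻ x, h x := by
  intro m
  induction m with
  | zero =>
    intro f g h hf hg hh H
    have := H 0 0
    rw [volume_pi, Measure.pi_of_empty (fun _ => volume) 0]
    simpa [lintegral_dirac' _ hf, lintegral_dirac' _ hg, lintegral_dirac' _ hh, -smul_zero,
      Subsingleton.elim (s • (0 : Fin 0 → ℝ) + t • (0 : Fin 0 → ℝ)) 0] using this
  | succ m ih =>
    intro f g h hf hg hh H
    have hmp := (volume_preserving_piFinSuccAbove (fun _ : Fin (m + 1) => ℝ) 0).symm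
    have hcalc : ∀ {p : (Fin (m + 1) → ℝ) → ENNReal}, Measurable p →
        ∫⁻ x, p x = ∫⁻ x : ℝ, ∫⁻ y : Fin m → ℝ, p (Fin.insertNth 0 x y) := by
      intro p hp
      rw [← hmp.lintegral_comp hp, Measure.volume_eq_prod, lintegral_prod]
      · rfl
      · exact (hp.comp hmp.measurable).aemeasurable
    have hmeas : ∀ {p : (Fin (m + 1) → ℝ) → ENNReal}, Measurable p →
        Measurable fun z : ℝ × (Fin m → ℝ) => p (Fin.insertNth 0 z.1 z.2) := fun hp =>
      hp.comp hmp.measurable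
    rw [hcalc hf, hcalc hg, hcalc hh]
    refine prekopa_leindler_real (hmeas hf).lintegral_prod_right' (hmeas hg).lintegral_prod_right'
      (hmeas hh).lintegral_prod_right' hs ht hst fun x y => ?_
    refine ih ((hmeas hf).comp measurable_prodMk_left) ((hmeas hg).comp measurable_prodMk_left)
      ((hmeas hh).comp measurable_prodMk_left) fun v w => ?_
    refine (H _ _).trans (le_of_eq ?_)
    congr 1
    ext i
    refine Fin.cases ?_ (fun j => ?_) i <;> simp

/-- The point of `ℝᵐ⁺¹` with `i`-th coordinate `t` and the other coordinates given by `y`. -/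
def slicePoint {m : ℕ} (i : Fin (m + 1)) (z : ℝ × (Fin m → ℝ)) : EuclideanSpace ℝ (Fin (m + 1)) :=
  WithLp.toLp 2 (Fin.insertNth (α := fun _ => ℝ) i z.1 z.2)

theorem slicePoint_apply_same {m : ℕ} (i : Fin (m + 1)) (z : ℝ × (Fin m → ℝ)) :
    slicePoint i z i = z.1 := by
  simp [slicePoint]

theorem measurePreserving_slicePoint {m : ℕ} (i : Fin (m + 1)) :
    MeasurePreserving (slicePoint i) := by
  have h1 := (volume_preserving_piFinSuccAbove (fun _ : Fin (m + 1) => ℝ) i).symm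
  have h2 := PiLp.volume_preserving_toLp (Fin (m + 1))
  exact h2.comp h1

theorem continuous_slicePoint {m : ℕ} (i : Fin (m + 1)) : Continuous (slicePoint i) := by
  unfold slicePoint
  refine (PiLp.continuous_toLp 2 _).comp ?_
  exact Continuous.finInsertNth (A := fun _ : Fin (m + 1) => ℝ) i continuous_fst continuous_snd

theorem slicePoint_combo {m : ℕ} (i : Fin (m + 1)) (s t x y : ℝ) (v w : Fin m → ℝ) :
    slicePoint i (s * x + t * y, s • v + t • w) =
      s • slicePoint i (x, v) + t • slicePoint i (y, w) := by
  ext j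
  refine Fin.succAboveCases i ?_ (fun k => ?_) j <;> simp [slicePoint]

theorem exists_slicePoint_eq {m : ℕ} (i : Fin (m + 1)) (x : EuclideanSpace ℝ (Fin (m + 1))) :
    ∃ v, slicePoint i (x i, v) = x := by
  refine ⟨fun j => x (i.succAbove j), ?_⟩
  ext j
  refine Fin.succAboveCases i ?_ (fun k => ?_) j <;> simp [slicePoint]

/-- The measure of the slice of `K` at height `t` in the direction of the `i`-th coordinate. -/
def sliceVolume {m : ℕ} (i : Fin (m + 1)) (K : Set (EuclideanSpace ℝ (Fin (m + 1)))) (t : ℝ) :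
    ENNReal :=
  volume {v : Fin m → ℝ | slicePoint i (t, v) ∈ K}

theorem measurable_sliceVolume {m : ℕ} (i : Fin (m + 1))
    {K : Set (EuclideanSpace ℝ (Fin (m + 1)))} (hK : MeasurableSet K) :
    Measurable (sliceVolume i K) :=
  measurable_measure_prodMk_left ((continuous_slicePoint i).measurable hK)

theorem map_coord_restrict {m : ℕ} (i : Fin (m + 1))
    {K : Set (EuclideanSpace ℝ (Fin (m + 1)))} (hK : MeasurableSet K) :
    (volume.restrict K).map (fun y => y i) = volume.withDensity (sliceVolume i K) := by
  have hc : Measurable fun y : EuclideanSpace ℝ (Fin (m + 1)) => y i := by fun_prop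
  ext S hS
  have hT : MeasurableSet ((fun y : EuclideanSpace ℝ (Fin (m + 1)) => y i) ⁻¹' S) := hc hS
  rw [Measure.map_apply hc hS, Measure.restrict_apply hT, withDensity_apply _ hS,
    ← (measurePreserving_slicePoint i).measure_preimage (hT.inter hK).nullMeasurableSet,
    Measure.volume_eq_prod,
    Measure.prod_apply ((continuous_slicePoint i).measurable (hT.inter hK)),
    ← lintegral_indicator hS]
  refine lintegral_congr fun t => ?_
  by_cases ht : t ∈ S
  · simp only [Set.indicator_of_mem ht, sliceVolume]
    congr 1
    ext v
    simp [slicePoint_apply_same, ht]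
  · simp only [Set.indicator_of_notMem ht]
    convert measure_empty (μ := (volume : Measure (Fin m → ℝ)))
    ext v
    simp [slicePoint_apply_same, ht]

theorem sliceVolume_mul_rpow_le {m : ℕ} (i : Fin (m + 1))
    {K : Set (EuclideanSpace ℝ (Fin (m + 1)))} (hK : MeasurableSet K) (hc : Convex ℝ K)
    {s t : ℝ} (hs : 0 < s) (ht : 0 < t) (hst : s + t = 1) (x y : ℝ) :
    sliceVolume i K x ^ s * sliceVolume i K y ^ t ≤ sliceVolume i K (s * x + t * y) := by
  have hm : ∀ r : ℝ, MeasurableSet {v : Fin m → ℝ | slicePoint i (r, v) ∈ K} := fun r =>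
    ((continuous_slicePoint i).comp (Continuous.prodMk_right r)).measurable hK
  have := prekopa_leindler_pi hs ht hst m
    (f := Set.indicator {v | slicePoint i (x, v) ∈ K} 1)
    (g := Set.indicator {v | slicePoint i (y, v) ∈ K} 1)
    (h := Set.indicator {v | slicePoint i (s * x + t * y, v) ∈ K} 1)
    (measurable_one.indicator (hm _)) (measurable_one.indicator (hm _))
    (measurable_one.indicator (hm _)) (fun v w => by
      by_cases hv : slicePoint i (x, v) ∈ K
      · by_cases hw : slicePoint i (y, w) ∈ K
        · have h3 : slicePoint i (s * x + t * y, s • v + t • w) ∈ K := by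
            rw [slicePoint_combo]
            exact hc hv hw hs.le ht.le hst
          simp [Set.indicator, hv, hw, h3]
        · simp [Set.indicator, hw, ht]
      · simp [Set.indicator, hv, hs])
  rwa [lintegral_indicator_one (hm _), lintegral_indicator_one (hm _),
    lintegral_indicator_one (hm _)] at this

theorem sliceVolume_ne_top {m : ℕ} (i : Fin (m + 1))
    {K : Set (EuclideanSpace ℝ (Fin (m + 1)))} (hK : Bornology.IsBounded K) (t : ℝ) :
    sliceVolume i K t ≠ ⊤ := by
  obtain ⟨R, hR⟩ := hK.subset_closedBall 0
  refine ne_top_of_le_ne_top (b := volume (Metric.closedBall (0 : Fin m → ℝ) (max R 0)))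
    measure_closedBall_lt_top.ne (measure_mono fun v hv => ?_)
  have h1 := hR hv
  rw [mem_closedBall_zero_iff] at h1 ⊢
  rw [pi_norm_le_iff_of_nonneg (le_max_right _ _)]
  intro j
  have h2 := PiLp.norm_apply_le (slicePoint i (t, v)) (i.succAbove j)
  simp only [slicePoint, Fin.insertNth_apply_succAbove] at h2
  exact h2.trans (h1.trans (le_max_left _ _))

theorem sliceVolume_pos {m : ℕ} (i : Fin (m + 1))
    {K : Set (EuclideanSpace ℝ (Fin (m + 1)))} (hK : IsOpen K)
    {x : EuclideanSpace ℝ (Fin (m + 1))} (hx : x ∈ K) : 0 < sliceVolume i K (x i) := by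
  have ho : IsOpen {v : Fin m → ℝ | slicePoint i (x i, v) ∈ K} :=
    hK.preimage ((continuous_slicePoint i).comp (Continuous.prodMk_right _))
  obtain ⟨v, hv⟩ := exists_slicePoint_eq i x
  exact ho.measure_pos _ ⟨v, by simpa [hv] using hx⟩

theorem sliceVolume_eq_zero {m : ℕ} (i : Fin (m + 1))
    {K : Set (EuclideanSpace ℝ (Fin (m + 1)))} {t : ℝ} (ht : ∀ x ∈ K, x i ≠ t) :
    sliceVolume i K t = 0 := by
  rw [sliceVolume]
  convert measure_empty (μ := (volume : Measure (Fin m → ℝ)))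
  ext v
  simp only [Set.mem_ofPred_eq, Set.mem_empty_iff_false, iff_false]
  exact fun hv => ht _ hv (slicePoint_apply_same i _)

theorem setIntegral_coord_eq {m : ℕ} (i : Fin (m + 1))
    {K : Set (EuclideanSpace ℝ (Fin (m + 1)))} (hK : MeasurableSet K)
    (hb : Bornology.IsBounded K) {f : ℝ → ℝ} (hf : Continuous f) :
    ∫ y in K, f (y i) = ∫ t, f t * (sliceVolume i K t).toReal := by
  have hc : Measurable fun y : EuclideanSpace ℝ (Fin (m + 1)) => y i := by fun_prop
  have h1 : ∫ y in K, f (y i) = ∫ t, f t ∂((volume.restrict K).map (fun y => y i)) :=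
    (integral_map hc.aemeasurable hf.aestronglyMeasurable).symm
  rw [h1, map_coord_restrict i hK, integral_withDensity_eq_integral_toReal_smul
    (measurable_sliceVolume i hK)
    (ae_of_all _ fun t => (sliceVolume_ne_top i hb t).lt_top)]
  simp [mul_comm]

theorem poincare_coord_succ {m : ℕ} (i : Fin (m + 1))
    {K : Set (EuclideanSpace ℝ (Fin (m + 1)))} (hK : IsOpen K) (hc : Convex ℝ K)
    (hb : Bornology.IsBounded K) (hne : K.Nonempty) {α β : ℝ} (hα : ∀ y ∈ K, α < y i)
    (hβ : ∀ y ∈ K, y i < β) {v v' : ℝ → ℝ} (hv : ∀ t, HasDerivAt v (v' t) t)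
    (hv' : Continuous v') :
    (π / (β - α)) ^ 2 * ((∫ y in K, v (y i) ^ 2) * volume.real K - (∫ y in K, v (y i)) ^ 2) ≤
      (∫ y in K, v' (y i) ^ 2) * volume.real K := by
  have hvc : Continuous v := continuous_iff_continuousAt.2 fun t => (hv t).continuousAt
  set A : ℝ → ℝ := fun t => (sliceVolume i K t).toReal with hA
  set J : Set ℝ := (fun y : EuclideanSpace ℝ (Fin (m + 1)) => y i) '' K with hJ
  have hJne : J.Nonempty := hne.image _
  have hJo : IsOpen J := by
    refine (EuclideanSpace.proj (𝕜 := ℝ) i).isOpenMap (fun t => ?_) K hK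
    exact ⟨EuclideanSpace.single i t, by simp⟩
  have hJc : IsConnected J := (hc.isConnected hne).image _ (by fun_prop)
  have hbb : BddBelow J := ⟨α, by rintro _ ⟨y, hy, rfl⟩; exact (hα y hy).le⟩
  have hba : BddAbove J := ⟨β, by rintro _ ⟨y, hy, rfl⟩; exact (hβ y hy).le⟩
  set t₀ := sInf J
  set t₁ := sSup J
  have hJeq : J = Set.Ioo t₀ t₁ := by
    apply Set.Subset.antisymm
    · have : J ⊆ Set.Icc t₀ t₁ := fun x hx => ⟨csInf_le hbb hx, le_csSup hba hx⟩
      simpa [hJo.interior_eq] using interior_mono this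
    · exact hJc.Ioo_csInf_csSup_subset hbb hba
  have h01 : t₀ < t₁ := by
    obtain ⟨x, hx⟩ := hJne
    rw [hJeq] at hx
    exact hx.1.trans hx.2
  have hαt : α ≤ t₀ := le_csInf hJne (by rintro _ ⟨y, hy, rfl⟩; exact (hα y hy).le)
  have htβ : t₁ ≤ β := csSup_le hJne (by rintro _ ⟨y, hy, rfl⟩; exact (hβ y hy).le)
  have hApos : ∀ t ∈ Set.Ioo t₀ t₁, 0 < A t := by
    intro t ht
    rw [← hJeq] at ht
    obtain ⟨y, hy, rfl⟩ := ht
    exact ENNReal.toReal_pos (sliceVolume_pos i hK hy).ne' (sliceVolume_ne_top i hb _)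
  have hAzero : ∀ t ∉ Set.Ioo t₀ t₁, A t = 0 := by
    intro t ht
    rw [← hJeq] at ht
    have := sliceVolume_eq_zero i (K := K) (t := t) fun x hx h => ht ⟨x, hx, h⟩
    simp [hA, this]
  have hint : ∀ f : ℝ → ℝ, Continuous f → ∫ y in K, f (y i) = ∫ t in t₀..t₁, f t * A t := by
    intro f hf
    rw [setIntegral_coord_eq i hK.measurableSet hb hf, intervalIntegral.integral_of_le h01.le,
      integral_Ioc_eq_integral_Ioo, setIntegral_eq_integral_of_forall_compl_eq_zero]
    intro t ht
    simp [hAzero t ht]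
  have hvol : volume.real K = ∫ t in t₀..t₁, A t := by
    have := hint (fun _ => 1) continuous_const
    simpa using this
  have hAi : IntervalIntegrable A volume t₀ t₁ := by
    by_contra hcon
    have := intervalIntegral.integral_undef hcon
    rw [← hvol, measureReal_eq_zero_iff hb.measure_lt_top.ne] at this
    exact (hK.measure_pos volume hne).ne' this
  have hconv : ConvexOn ℝ (Set.Ioo t₀ t₁) fun t => (√(A t))⁻¹ := by
    rw [convexOn_iff_forall_pos]
    refine ⟨convex_Ioo _ _, fun x hx y hy s t hs ht hst => ?_⟩
    have h1 := ENNReal.toReal_mono (sliceVolume_ne_top i hb _)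
      (sliceVolume_mul_rpow_le i hK.measurableSet hc hs ht hst x y)
    rw [ENNReal.toReal_mul, ← ENNReal.toReal_rpow, ← ENNReal.toReal_rpow] at h1
    have h1' : A x ^ s * A y ^ t ≤ A (s * x + t * y) := h1
    have px := hApos x hx
    have py := hApos y hy
    have h2 : √(A x) ^ s * √(A y) ^ t ≤ √(A (s * x + t * y)) := by
      refine Real.le_sqrt_of_sq_le (le_trans (le_of_eq ?_) h1')
      rw [mul_pow, ← rpow_natCast, ← rpow_natCast, ← rpow_mul (sqrt_nonneg _),
        ← rpow_mul (sqrt_nonneg _), mul_comm s, mul_comm t, rpow_mul (sqrt_nonneg _),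
        rpow_mul (sqrt_nonneg _)]
      simp [sq_sqrt, px.le, py.le]
    have qx := sqrt_pos.2 px
    have qy := sqrt_pos.2 py
    simp only [smul_eq_mul]
    calc (√(A (s * x + t * y)))⁻¹ ≤ (√(A x) ^ s * √(A y) ^ t)⁻¹ := by
          gcongr
      _ = ((√(A x))⁻¹) ^ s * ((√(A y))⁻¹) ^ t := by
          rw [mul_inv, inv_rpow qx.le, inv_rpow qy.le]
      _ ≤ s * (√(A x))⁻¹ + t * (√(A y))⁻¹ :=
          geom_mean_le_arith_mean2_weighted hs.le ht.le (by positivity) (by positivity) hst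
  have main := neumann_of_convexOn_Ioo h01 hApos hAi hconv hv hv'
  rw [← hvol, ← hint (fun t => v t ^ 2) (hvc.pow 2), ← hint _ hvc,
    ← hint (fun t => v' t ^ 2) (hv'.pow 2)] at main
  rcases le_or_gt ((∫ y in K, v (y i) ^ 2) * volume.real K - (∫ y in K, v (y i)) ^ 2) 0 with h | h
  · refine (mul_nonpos_of_nonneg_of_nonpos (by positivity) h).trans ?_
    exact mul_nonneg (integral_nonneg fun _ => by positivity) measureReal_nonneg
  · refine le_trans ?_ main
    have h2 : 0 ≤ π / (β - α) := div_nonneg pi_pos.le (by linarith)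
    gcongr

theorem poincare_coord {n : ℕ} (i : Fin n)
    {K : Set (EuclideanSpace ℝ (Fin n))} (hK : IsOpen K) (hc : Convex ℝ K)
    (hb : Bornology.IsBounded K) (hne : K.Nonempty) {α β : ℝ} (hα : ∀ y ∈ K, α < y i)
    (hβ : ∀ y ∈ K, y i < β) {v v' : ℝ → ℝ} (hv : ∀ t, HasDerivAt v (v' t) t)
    (hv' : Continuous v') :
    (π / (β - α)) ^ 2 * ((∫ y in K, v (y i) ^ 2) * volume.real K - (∫ y in K, v (y i)) ^ 2) ≤
      (∫ y in K, v' (y i) ^ 2) * volume.real K := by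
  cases n with
  | zero => exact i.elim0
  | succ m => exact poincare_coord_succ i hK hc hb hne hα hβ hv hv'

/-- A decreasing sequence of nonempty open convex subsets of `S` shrinking to the segment
`[a, b]`. -/
structure IsNeedleSeq {n : ℕ} (S : Set (EuclideanSpace ℝ (Fin n)))
    (K : ℕ → Set (EuclideanSpace ℝ (Fin n))) (a b : EuclideanSpace ℝ (Fin n)) : Prop where
  antitone : Antitone K
  isOpen : ∀ k, IsOpen (K k)
  convex : ∀ k, Convex ℝ (K k)
  nonempty : ∀ k, (K k).Nonempty
  subset : ∀ k, K k ⊆ S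
  iInter_closure : ⋂ k, closure (K k) = segment ℝ a b

namespace IsNeedleSeq

variable {n : ℕ} {S : Set (EuclideanSpace ℝ (Fin n))} {K : ℕ → Set (EuclideanSpace ℝ (Fin n))}
  {a b : EuclideanSpace ℝ (Fin n)}

theorem symm (h : IsNeedleSeq S K a b) : IsNeedleSeq S K b a :=
  { h with iInter_closure := by rw [h.iInter_closure, segment_symm] }

theorem segment_subset (h : IsNeedleSeq S K a b) (k : ℕ) : segment ℝ a b ⊆ closure (K k) :=
  h.iInter_closure ▸ Set.iInter_subset _ k

theorem segment_subset_closure (h : IsNeedleSeq S K a b) : segment ℝ a b ⊆ closure S :=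
  (h.segment_subset 0).trans (closure_mono (h.subset 0))

theorem eventually_lt (h : IsNeedleSeq S K a b) (hS : Bornology.IsBounded S)
    {f : EuclideanSpace ℝ (Fin n) → ℝ} (hf : ContinuousOn f (closure S)) {ε : ℝ}
    (hε : ∀ y ∈ segment ℝ a b, f y < ε) : ∀ᶠ k in Filter.atTop, ∀ y ∈ closure (K k), f y < ε := by
  have hcl : ∀ k, IsClosed (closure (K k) ∩ f ⁻¹' Set.Ici ε) := fun k =>
    (hf.mono (closure_mono (h.subset k))).preimage_isClosed_of_isClosed isClosed_closure
      isClosed_Ici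
  by_contra hcon
  rw [Filter.eventually_atTop] at hcon
  push Not at hcon
  have hanti : ∀ k l, k ≤ l → closure (K l) ∩ f ⁻¹' Set.Ici ε ⊆ closure (K k) ∩ f ⁻¹' Set.Ici ε :=
    fun k l hkl => Set.inter_subset_inter_left _ (closure_mono (h.antitone hkl))
  obtain ⟨y, hy⟩ := IsCompact.nonempty_iInter_of_sequence_nonempty_isCompact_isClosed
    (fun k => closure (K k) ∩ f ⁻¹' Set.Ici ε) (fun k => hanti k (k + 1) k.le_succ)
    (fun k => by
      obtain ⟨l, hl, y, hy, hfy⟩ := hcon k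
      exact ⟨y, hanti k l hl ⟨hy, hfy⟩⟩)
    ((hS.subset (h.subset 0)).isCompact_closure.of_isClosed_subset (hcl 0)
      Set.inter_subset_left) hcl
  rw [Set.mem_iInter] at hy
  have h1 : y ∈ segment ℝ a b := by
    rw [← h.iInter_closure, Set.mem_iInter]
    exact fun k => (hy k).1
  exact absurd (hε y h1) (not_lt.2 (hy 0).2)

theorem eventually_abs_lt (h : IsNeedleSeq S K a b) (hS : Bornology.IsBounded S)
    {f : EuclideanSpace ℝ (Fin n) → ℝ} (hf : ContinuousOn f (closure S)) {ε : ℝ}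
    (hε : 0 < ε) (hf0 : ∀ y ∈ segment ℝ a b, f y = 0) :
    ∀ᶠ k in Filter.atTop, ∀ y ∈ closure (K k), |f y| < ε :=
  h.eventually_lt hS hf.abs fun y hy => by simpa [hf0 y hy] using hε

theorem volume_pos (h : IsNeedleSeq S K a b) (hS : Bornology.IsBounded S) (k : ℕ) :
    0 < volume.real (K k) :=
  ENNReal.toReal_pos ((h.isOpen k).measure_pos volume (h.nonempty k)).ne'
    (hS.subset (h.subset k)).measure_lt_top.ne

theorem integrableOn (h : IsNeedleSeq S K a b) (hS : Bornology.IsBounded S)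
    {f : EuclideanSpace ℝ (Fin n) → ℝ} (hf : ContinuousOn f (closure S)) (k : ℕ) :
    IntegrableOn f (K k) :=
  (hf.integrableOn_compact hS.isCompact_closure).mono_set ((h.subset k).trans subset_closure)

end IsNeedleSeq

/-- A primitive, along the segment `[a, b]` parametrized by its `i`-th coordinate, of a function
with gradient `G`. -/
theorem exists_coord_primitive {n : ℕ} {a b : EuclideanSpace ℝ (Fin n)} {i : Fin n}
    (hi : a i < b i) {u : EuclideanSpace ℝ (Fin n) → ℝ}
    {G : EuclideanSpace ℝ (Fin n) → EuclideanSpace ℝ (Fin n)}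
    (hG : ContinuousOn G (segment ℝ a b)) (hu : ∀ y ∈ segment ℝ a b, HasGradientAt u (G y) y) :
    ∃ v v' : ℝ → ℝ, (∀ t, HasDerivAt v (v' t) t) ∧ Continuous v' ∧
      ∀ y ∈ segment ℝ a b, v (y i) = u y ∧ (b i - a i) * v' (y i) = ⟪G y, b - a⟫ := by
  have hL : 0 < b i - a i := sub_pos.2 hi
  set L := b i - a i with hLdef
  set c : ℝ → ℝ := fun τ => max 0 (min 1 τ) with hc
  have hcc : Continuous c := by fun_prop
  have hc01 : ∀ τ, c τ ∈ Set.Icc (0 : ℝ) 1 := fun τ => ⟨le_max_left _ _, by simp [hc]⟩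
  have hcid : ∀ τ ∈ Set.Icc (0 : ℝ) 1, c τ = τ := fun τ hτ => by simp [hc, hτ.1, hτ.2]
  set γ : ℝ → EuclideanSpace ℝ (Fin n) := fun τ => a + τ • (b - a) with hγ
  have hγc : Continuous γ := by fun_prop
  have hγs : ∀ τ ∈ Set.Icc (0 : ℝ) 1, γ τ ∈ segment ℝ a b := fun τ hτ => by
    rw [segment_eq_image']
    exact ⟨τ, hτ, rfl⟩
  set f : ℝ → ℝ := fun τ => ⟪G (γ (c τ)), b - a⟫ with hf
  have hfc : Continuous f := by
    have : Continuous fun τ => G (γ (c τ)) :=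
      hG.comp_continuous (hγc.comp hcc) fun τ => hγs _ (hc01 τ)
    exact this.inner continuous_const
  have hder : ∀ τ ∈ Set.Icc (0 : ℝ) 1, HasDerivAt (fun τ => u (γ τ)) (f τ) τ := by
    intro τ hτ
    have h1 : HasDerivAt γ (b - a) τ := by
      exact (((hasDerivAt_id τ).smul_const (b - a)).const_add a).congr_deriv (by simp)
    have h2 := (hu _ (hγs τ hτ)).hasFDerivAt.comp_hasDerivAt τ h1
    refine h2.congr_deriv ?_
    simp [hf, hcid τ hτ]
  set W : ℝ → ℝ := fun τ => u a + ∫ x in (0 : ℝ)..τ, f x with hW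
  have hWd : ∀ τ, HasDerivAt W (f τ) τ := fun τ =>
    (intervalIntegral.integral_hasDerivAt_right (hfc.intervalIntegrable _ _)
      hfc.stronglyMeasurable.stronglyMeasurableAtFilter hfc.continuousAt).const_add _
  have hWu : ∀ τ ∈ Set.Icc (0 : ℝ) 1, W τ = u (γ τ) := by
    intro τ hτ
    have := intervalIntegral.integral_eq_sub_of_hasDerivAt (f := fun τ => u (γ τ)) (f' := f)
      (a := 0) (b := τ) (fun x hx => by
        rw [Set.uIcc_of_le hτ.1] at hx
        exact hder x ⟨hx.1, hx.2.trans hτ.2⟩) (hfc.intervalIntegrable _ _)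
    simp only [hW, this]
    simp [hγ]
  refine ⟨fun t => W ((t - a i) / L), fun t => f ((t - a i) / L) / L, fun t => ?_, by fun_prop,
    fun y hy => ?_⟩
  · have h1 : HasDerivAt (fun t : ℝ => (t - a i) / L) (1 / L) t :=
      ((hasDerivAt_id t).sub_const _).div_const L
    have h2 := (hWd ((t - a i) / L)).comp t h1
    exact h2.congr_deriv (by ring)
  · rw [segment_eq_image'] at hy
    obtain ⟨τ, hτ, rfl⟩ := hy
    have h2 : ((a + τ • (b - a)) i - a i) / L = τ := by
      simp only [PiLp.add_apply, PiLp.smul_apply, PiLp.sub_apply, smul_eq_mul, add_sub_cancel_left]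
      rw [← hLdef]
      field_simp
    simp only [h2]
    refine ⟨hWu τ hτ, ?_⟩
    simp only [hf, hcid τ hτ]
    field_simp
    rfl

theorem setIntegral_le_of_abs_sub_le {n : ℕ} {K : Set (EuclideanSpace ℝ (Fin n))}
    (hv : volume K ≠ ⊤) {f g : EuclideanSpace ℝ (Fin n) → ℝ} {η : ℝ}
    (hf : IntegrableOn f K) (hg : IntegrableOn g K) (h : ∀ y ∈ K, |f y - g y| ≤ η) :
    |(∫ y in K, f y) - ∫ y in K, g y| ≤ η * volume.real K := by
  rw [← integral_sub hf hg]
  have := norm_setIntegral_le_of_norm_le_const hv.lt_top (f := fun y => f y - g y) (C := η)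
    (fun y hy => by simpa using h y hy)
  simpa using this

namespace IsNeedleSeq

variable {n : ℕ} {S : Set (EuclideanSpace ℝ (Fin n))} {K : ℕ → Set (EuclideanSpace ℝ (Fin n))}
  {a b : EuclideanSpace ℝ (Fin n)}

theorem poincare_estimate_aux (h : IsNeedleSeq S K a b) (hS : Bornology.IsBounded S)
    {u : EuclideanSpace ℝ (Fin n) → ℝ} {G : EuclideanSpace ℝ (Fin n) → EuclideanSpace ℝ (Fin n)}
    (hG : ContinuousOn G (closure S)) (hu : ∀ y ∈ closure S, HasGradientAt u (G y) y)
    (hmean : ∀ k, ∫ y in K k, u y = 0) {i : Fin n} (hi : a i < b i) {ε : ℝ} (hε : 0 < ε) :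
    ∀ᶠ k in Filter.atTop, -(ε * volume.real (K k)) ≤
      (∫ y in K k, ⟪G y, b - a⟫ ^ 2) - π ^ 2 * ∫ y in K k, u y ^ 2 := by
  have hL : 0 < b i - a i := sub_pos.2 hi
  obtain ⟨v, v', hv, hv', hvu⟩ := exists_coord_primitive hi
    (hG.mono h.segment_subset_closure) fun y hy => hu y (h.segment_subset_closure hy)
  set L := b i - a i with hLdef
  have hvc : Continuous v := continuous_iff_continuousAt.2 fun t => (hv t).continuousAt
  have huc : ContinuousOn u (closure S) := fun y hy =>
    (hu y hy).continuousAt.continuousWithinAt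
  have hGc : ContinuousOn (fun y => ⟪G y, b - a⟫) (closure S) := hG.inner continuousOn_const
  have hvy : ContinuousOn (fun y : EuclideanSpace ℝ (Fin n) => v (y i)) (closure S) := by fun_prop
  have hvy' : ContinuousOn (fun y : EuclideanSpace ℝ (Fin n) => L * v' (y i)) (closure S) := by
    fun_prop
  have hcomp := hS.isCompact_closure
  obtain ⟨M, hM⟩ : ∃ M : ℝ, 0 ≤ M ∧ ∀ y ∈ closure S, |u y| ≤ M ∧ |v (y i)| ≤ M ∧
      |⟪G y, b - a⟫| ≤ M ∧ |L * v' (y i)| ≤ M := by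
    obtain ⟨M1, h1⟩ := hcomp.exists_bound_of_continuousOn huc
    obtain ⟨M2, h2⟩ := hcomp.exists_bound_of_continuousOn hvy
    obtain ⟨M3, h3⟩ := hcomp.exists_bound_of_continuousOn hGc
    obtain ⟨M4, h4⟩ := hcomp.exists_bound_of_continuousOn hvy'
    refine ⟨|M1| + |M2| + |M3| + |M4|, by positivity, fun y hy => ?_⟩
    have e1 := (h1 y hy).trans (le_abs_self M1)
    have e2 := (h2 y hy).trans (le_abs_self M2)
    have e3 := (h3 y hy).trans (le_abs_self M3)
    have e4 := (h4 y hy).trans (le_abs_self M4)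
    simp only [Real.norm_eq_abs] at e1 e2 e3 e4
    have := abs_nonneg M1
    have := abs_nonneg M2
    have := abs_nonneg M3
    have := abs_nonneg M4
    refine ⟨?_, ?_, ?_, ?_⟩ <;> linarith
  obtain ⟨hM0, hM⟩ := hM
  obtain ⟨η, hη, hEη⟩ : ∃ η : ℝ, 0 < η ∧ 2 * M * η + π ^ 2 * (2 * M * η + η ^ 2) +
      π ^ 2 * M ^ 2 * (1 - (L / (L + 2 * η)) ^ 2) < ε := by
    have hcont : Filter.Tendsto (fun η : ℝ => 2 * M * η + π ^ 2 * (2 * M * η + η ^ 2) +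
      π ^ 2 * M ^ 2 * (1 - (L / (L + 2 * η)) ^ 2)) (nhds 0) (nhds 0) := by
      have : ContinuousAt (fun η : ℝ => 2 * M * η + π ^ 2 * (2 * M * η + η ^ 2) +
        π ^ 2 * M ^ 2 * (1 - (L / (L + 2 * η)) ^ 2)) 0 := by
        have : L + 2 * 0 ≠ 0 := by simpa using hL.ne'
        fun_prop (disch := assumption)
      simpa [ContinuousAt, hL.ne'] using this
    obtain ⟨η, h1, h2⟩ := (((hcont.mono_left nhdsWithin_le_nhds).eventually_lt_const hε).and
      (self_mem_nhdsWithin : Set.Ioi (0 : ℝ) ∈ nhdsWithin 0 (Set.Ioi 0))).exists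
    exact ⟨η, h2, h1⟩
  have hci : ContinuousOn (fun y : EuclideanSpace ℝ (Fin n) => y i) (closure S) := by fun_prop
  have hseg : ∀ y ∈ segment ℝ a b, a i ≤ y i ∧ y i ≤ b i := by
    intro y hy
    rw [segment_eq_image'] at hy
    obtain ⟨τ, hτ, rfl⟩ := hy
    simp only [PiLp.add_apply, PiLp.smul_apply, PiLp.sub_apply, smul_eq_mul]
    constructor <;> nlinarith [hτ.1, hτ.2]
  filter_upwards [h.eventually_abs_lt hS (hvy.sub huc) hη fun y hy => by simp [(hvu y hy).1],
    h.eventually_abs_lt hS (hvy'.sub hGc) hη fun y hy => by simp [(hvu y hy).2],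
    h.eventually_lt hS hci (ε := b i + η) fun y hy => by linarith [(hseg y hy).2],
    h.eventually_lt hS (f := fun y => -(y i)) hci.neg (ε := -(a i) + η) fun y hy => by linarith [(hseg y hy).1]]
    with k k1 k2 k3 k4
  have hsub : K k ⊆ closure (K k) := subset_closure
  have hsubS : K k ⊆ closure S := (h.subset k).trans subset_closure
  have hfin : volume (K k) ≠ ⊤ := (hS.subset (h.subset k)).measure_lt_top.ne
  have hm := h.volume_pos hS k
  have main := poincare_coord i (h.isOpen k) (h.convex k) (hS.subset (h.subset k)) (h.nonempty k)
    (α := a i - η) (β := b i + η) (fun y hy => by have := k4 y (hsub hy); linarith)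
    (fun y hy => k3 y (hsub hy)) hv hv'
  set m := volume.real (K k)
  have d1 := setIntegral_le_of_abs_sub_le hfin (h.integrableOn hS hvy k)
    (h.integrableOn hS huc k) (η := η) fun y hy => (k1 y (hsub hy)).le
  have sqd : ∀ p q : ℝ, |p - q| < η → |p| ≤ M → |q| ≤ M → |p ^ 2 - q ^ 2| ≤ 2 * M * η := by
    intro p q h1 h2 h3
    rw [sq_sub_sq, abs_mul]
    have : |p + q| ≤ 2 * M := (abs_add_le _ _).trans (by linarith)
    gcongr
  have d2 := setIntegral_le_of_abs_sub_le hfin (h.integrableOn hS (hvy.pow 2) k)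
    (h.integrableOn hS (huc.pow 2) k) (η := 2 * M * η) fun y hy =>
      sqd _ _ (k1 y (hsub hy)) (hM y (hsubS hy)).2.1 (hM y (hsubS hy)).1
  have d3 := setIntegral_le_of_abs_sub_le hfin (h.integrableOn hS (hvy'.pow 2) k)
    (h.integrableOn hS (hGc.pow 2) k) (η := 2 * M * η) fun y hy =>
      sqd _ _ (k2 y (hsub hy)) (hM y (hsubS hy)).2.2.2 (hM y (hsubS hy)).2.2.1
  have d4 : ∫ y in K k, u y ^ 2 ≤ M ^ 2 * m := by
    have := norm_setIntegral_le_of_norm_le_const hfin.lt_top (f := fun y => u y ^ 2) (C := M ^ 2)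
      (fun y hy => by
        rw [Real.norm_eq_abs, abs_pow]
        gcongr
        exact (hM y (hsubS hy)).1)
    exact (le_abs_self _).trans this
  simp only [Pi.pow_apply] at d2 d3
  rw [hmean k, sub_zero] at d1
  have e3 : ∫ y in K k, (L * v' (y i)) ^ 2 = L ^ 2 * ∫ y in K k, v' (y i) ^ 2 := by
    rw [← integral_const_mul]
    simp only [mul_pow]
  rw [e3] at d3
  set I1 := ∫ y in K k, v (y i)
  set I2 := ∫ y in K k, v (y i) ^ 2
  set I3 := ∫ y in K k, v' (y i) ^ 2
  set U := ∫ y in K k, u y ^ 2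
  set Q := ∫ y in K k, ⟪G y, b - a⟫ ^ 2
  set q := (L / (L + 2 * η)) ^ 2 with hq
  have hL2 : 0 < L + 2 * η := by linarith
  have hq0 : 0 ≤ q := by positivity
  have hq1 : q ≤ 1 := by
    rw [hq]
    apply pow_le_one₀ (by positivity)
    rw [div_le_one hL2]
    linarith
  have hI1 : I1 ^ 2 ≤ (η * m) ^ 2 := by
    rw [← sq_abs I1]
    gcongr
  have hI2 : U - 2 * M * η * m ≤ I2 := by linarith [(abs_le.1 d2).1]
  have hI3 : L ^ 2 * I3 ≤ Q + 2 * M * η * m := by linarith [(abs_le.1 d3).2]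
  have main2 : π ^ 2 * q * (I2 * m - I1 ^ 2) ≤ (L ^ 2 * I3) * m := by
    have e : b i + η - (a i - η) = L + 2 * η := by rw [hLdef]; ring
    rw [e] at main
    have := mul_le_mul_of_nonneg_left main (sq_nonneg L)
    calc π ^ 2 * q * (I2 * m - I1 ^ 2)
        = L ^ 2 * ((π / (L + 2 * η)) ^ 2 * (I2 * m - I1 ^ 2)) := by rw [hq]; field_simp
      _ ≤ _ := this
      _ = _ := by ring
  have hpi : 0 ≤ π ^ 2 := by positivity
  have main3 : π ^ 2 * q * ((U - 2 * M * η * m) - η ^ 2 * m) * m ≤ (Q + 2 * M * η * m) * m := by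
    calc π ^ 2 * q * ((U - 2 * M * η * m) - η ^ 2 * m) * m
        = π ^ 2 * q * ((U - 2 * M * η * m) * m - (η * m) ^ 2) := by ring
      _ ≤ π ^ 2 * q * (I2 * m - I1 ^ 2) := by gcongr
      _ ≤ _ := main2
      _ ≤ _ := by gcongr
  have main4 := le_of_mul_le_mul_right main3 hm
  have e5 : π ^ 2 * q * (2 * M * η * m + η ^ 2 * m) ≤ π ^ 2 * (2 * M * η * m + η ^ 2 * m) := by
    have : 0 ≤ 2 * M * η * m + η ^ 2 * m := by positivity
    nlinarith [mul_nonneg hpi this]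
  have e6 : π ^ 2 * (1 - q) * U ≤ π ^ 2 * (1 - q) * (M ^ 2 * m) := by
    have : 0 ≤ 1 - q := by linarith
    gcongr
  nlinarith

theorem poincare_estimate (h : IsNeedleSeq S K a b) (hS : Bornology.IsBounded S)
    {u : EuclideanSpace ℝ (Fin n) → ℝ} {G : EuclideanSpace ℝ (Fin n) → EuclideanSpace ℝ (Fin n)}
    (hG : ContinuousOn G (closure S)) (hu : ∀ y ∈ closure S, HasGradientAt u (G y) y)
    (hmean : ∀ k, ∫ y in K k, u y = 0) {ε : ℝ} (hε : 0 < ε) :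
    ∀ᶠ k in Filter.atTop, -(ε * volume.real (K k)) ≤
      (∫ y in K k, ⟪G y, b - a⟫ ^ 2) - π ^ 2 * ∫ y in K k, u y ^ 2 := by
  have huc : ContinuousOn u (closure S) := fun y hy =>
    (hu y hy).continuousAt.continuousWithinAt
  by_cases hab : ∃ i, a i ≠ b i
  · obtain ⟨i, hi⟩ := hab
    rcases lt_or_gt_of_ne hi with hi | hi
    · exact h.poincare_estimate_aux hS hG hu hmean hi hε
    · have := h.symm.poincare_estimate_aux hS hG hu hmean hi hε
      rw [← neg_sub b a] at this
      simpa only [inner_neg_right, neg_sq] using this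
  · push Not at hab
    obtain rfl : a = b := by ext i; exact hab i
    have hua : u a = 0 := by
      by_contra hne
      have hc2 : ContinuousOn (fun y => |u y - u a|) (closure S) :=
        (huc.sub continuousOn_const).abs
      obtain ⟨k, hk⟩ := (h.eventually_lt hS hc2 (ε := |u a| / 2) fun y hy => by
        rw [segment_same] at hy
        rw [Set.mem_singleton_iff.1 hy]
        simpa using hne).exists
      have d := setIntegral_le_of_abs_sub_le (hS.subset (h.subset k)).measure_lt_top.ne (h.integrableOn hS huc k)
        (h.integrableOn hS (continuousOn_const (c := u a)) k) fun y hy =>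
          (hk y (subset_closure hy)).le
      rw [hmean k] at d
      have hm := h.volume_pos hS k
      have ha := abs_pos.2 hne
      simp only [setIntegral_const, smul_eq_mul, zero_sub, abs_neg, abs_mul, abs_of_pos hm] at d
      nlinarith [mul_pos hm ha]
    filter_upwards [h.eventually_lt hS (huc.pow 2) (ε := ε / π ^ 2) fun y hy => by
      rw [segment_same] at hy
      rw [Set.mem_singleton_iff.1 hy]
      simp only [Pi.pow_apply, hua, ne_eq, OfNat.ofNat_ne_zero, not_false_eq_true, zero_pow]
      positivity] with k hk
    have hb := norm_setIntegral_le_of_norm_le_const (μ := volume) (s := K k)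
      (hS.subset (h.subset k)).measure_lt_top (f := fun y => u y ^ 2) (C := ε / π ^ 2)
      (fun y hy => by
        rw [Real.norm_eq_abs, abs_of_nonneg (sq_nonneg _)]
        exact (hk y (subset_closure hy)).le)
    have hb' := (le_abs_self _).trans hb
    have : π ^ 2 * ∫ y in K k, u y ^ 2 ≤ ε * volume.real (K k) := by
      calc π ^ 2 * ∫ y in K k, u y ^ 2 ≤ π ^ 2 * (ε / π ^ 2 * volume.real (K k)) := by gcongr
        _ = _ := by field_simp
    simp only [sub_self, inner_zero_right]
    simpa using this

end IsNeedleSeq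

theorem volume_hyperplane_eq_zero {n : ℕ} {θ : EuclideanSpace ℝ (Fin n)} (hθ : θ ≠ 0)
    (z : EuclideanSpace ℝ (Fin n)) : volume {y | ⟪θ, y - z⟫ = 0} = 0 := by
  have h1 : {y | ⟪θ, y - z⟫ = 0} =
      (fun y => y + -z) ⁻¹' ((ℝ ∙ θ)ᗮ : Submodule ℝ (EuclideanSpace ℝ (Fin n))) := by
    ext y
    simp [Submodule.mem_orthogonal_singleton_iff_inner_right, sub_eq_add_neg]
  rw [h1, measure_preimage_add_right]
  refine Measure.addHaar_submodule _ _ fun h => hθ ?_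
  have : θ ∈ ((ℝ ∙ θ)ᗮ : Submodule ℝ (EuclideanSpace ℝ (Fin n))) := h ▸ Submodule.mem_top
  rwa [Submodule.mem_orthogonal_singleton_iff_inner_right, inner_self_eq_zero] at this

theorem setIntegral_halfspace_add {n : ℕ} {θ : EuclideanSpace ℝ (Fin n)} (hθ : θ ≠ 0)
    (z : EuclideanSpace ℝ (Fin n)) {K : Set (EuclideanSpace ℝ (Fin n))} (hK : MeasurableSet K)
    {f : EuclideanSpace ℝ (Fin n) → ℝ} (hf : IntegrableOn f K) :
    (∫ y in K ∩ {y | 0 < ⟪θ, y - z⟫}, f y) + ∫ y in K ∩ {y | ⟪θ, y - z⟫ < 0}, f y =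
      ∫ y in K, f y := by
  have hc : Continuous fun y => ⟪θ, y - z⟫ := by fun_prop
  have m1 : MeasurableSet (K ∩ {y | 0 < ⟪θ, y - z⟫}) :=
    hK.inter (measurableSet_lt measurable_const hc.measurable)
  have m2 : MeasurableSet (K ∩ {y | ⟪θ, y - z⟫ < 0}) :=
    hK.inter (measurableSet_lt hc.measurable measurable_const)
  rw [← setIntegral_union _ m2 (hf.mono_set Set.inter_subset_left)
    (hf.mono_set Set.inter_subset_left)]
  · apply setIntegral_congr_set
    rw [ae_eq_set]
    constructor
    · convert measure_empty (μ := (volume : Measure (EuclideanSpace ℝ (Fin n))))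
      ext y
      simp only [Set.mem_sdiff, Set.mem_union, Set.mem_inter_iff, Set.mem_empty_iff_false]
      tauto
    · refine measure_mono_null (fun y hy => ?_) (volume_hyperplane_eq_zero hθ z)
      obtain ⟨h1, h2⟩ := hy
      by_contra h3
      rcases lt_or_gt_of_ne (h3 : ⟪θ, y - z⟫ ≠ 0) with h | h
      · exact h2 (Or.inr ⟨h1, h⟩)
      · exact h2 (Or.inl ⟨h1, h⟩)
  · rw [Set.disjoint_left]
    rintro y ⟨-, h1⟩ ⟨-, h2⟩
    exact lt_asymm (a := (0 : ℝ)) h1 h2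

/-- The vector of the `(i, j)`-coordinate plane at angle `α`. -/
def planeDir {n : ℕ} (i j : Fin n) (α : ℝ) : EuclideanSpace ℝ (Fin n) :=
  cos α • EuclideanSpace.single i 1 + sin α • EuclideanSpace.single j 1

theorem inner_planeDir {n : ℕ} (i j : Fin n) (α : ℝ) (y : EuclideanSpace ℝ (Fin n)) :
    ⟪planeDir i j α, y⟫ = cos α * y i + sin α * y j := by
  simp [planeDir, inner_add_left, inner_smul_left, EuclideanSpace.inner_single_left]

theorem planeDir_ne_zero {n : ℕ} {i j : Fin n} (hij : i ≠ j) (α : ℝ) : planeDir i j α ≠ 0 := by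
  intro h
  have h1 : ⟪planeDir i j α, planeDir i j α⟫ = 0 := by simp [h]
  rw [inner_planeDir] at h1
  simp only [planeDir, PiLp.add_apply, PiLp.smul_apply, PiLp.single_apply, smul_eq_mul, hij,
    hij.symm, if_true, if_false] at h1
  nlinarith [sin_sq_add_cos_sq α]

theorem planeDir_add_pi {n : ℕ} (i j : Fin n) (α : ℝ) :
    planeDir i j (α + π) = -planeDir i j α := by
  simp [planeDir]
  abel

theorem exists_bisecting_halfspace {n : ℕ} {i j : Fin n} (hij : i ≠ j)
    (z : EuclideanSpace ℝ (Fin n)) {K : Set (EuclideanSpace ℝ (Fin n))} (hK : MeasurableSet K)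
    {f : EuclideanSpace ℝ (Fin n) → ℝ} (hf : IntegrableOn f K) (hf0 : ∫ y in K, f y = 0) :
    ∃ α, (∫ y in K ∩ {y | 0 < ⟪planeDir i j α, y - z⟫}, f y) = 0 ∧
      ∫ y in K ∩ {y | ⟪planeDir i j α, y - z⟫ < 0}, f y = 0 := by
  set φ : ℝ → ℝ := fun α => ∫ y in K ∩ {y | 0 < ⟪planeDir i j α, y - z⟫}, f y with hφ
  have hadd : ∀ α, φ α + ∫ y in K ∩ {y | ⟪planeDir i j α, y - z⟫ < 0}, f y = 0 := fun α =>
    (setIntegral_halfspace_add (planeDir_ne_zero hij α) z hK hf).trans hf0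
  have hpi : φ π = -φ 0 := by
    have h1 := hadd 0
    have h2 : φ π = ∫ y in K ∩ {y | ⟪planeDir i j 0, y - z⟫ < 0}, f y := by
      have : planeDir i j π = -planeDir i j 0 := by rw [← planeDir_add_pi, zero_add]
      simp only [hφ, this, inner_neg_left, Left.neg_pos_iff]
    linarith
  have hm : ∀ α, MeasurableSet {y : EuclideanSpace ℝ (Fin n) | 0 < ⟪planeDir i j α, y - z⟫} :=
    fun α => measurableSet_lt measurable_const (by fun_prop)
  have hcont : Continuous φ := by
    have e : φ = fun α => ∫ y in K, Set.indicator {y | 0 < ⟪planeDir i j α, y - z⟫} f y := by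
      ext α
      rw [setIntegral_indicator (hm α)]
    rw [e, continuous_iff_continuousAt]
    intro α₀
    refine continuousAt_of_dominated (bound := fun y => ‖f y‖) ?_ ?_ hf.norm ?_
    · exact Filter.Eventually.of_forall fun α => (hf.indicator (hm α)).aestronglyMeasurable
    · exact Filter.Eventually.of_forall fun α => ae_of_all _ fun y => norm_indicator_le_norm_self _ _
    · have hnull : ∀ᵐ y ∂(volume.restrict K), ⟪planeDir i j α₀, y - z⟫ ≠ 0 := by
        refine ae_restrict_of_ae ?_
        rw [ae_iff]
        simpa using volume_hyperplane_eq_zero (planeDir_ne_zero hij α₀) z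
      filter_upwards [hnull] with y hy
      have hc : Continuous fun α => ⟪planeDir i j α, y - z⟫ := by
        simp only [inner_planeDir]
        fun_prop
      rcases lt_or_gt_of_ne hy with h | h
      · refine continuousAt_const.congr (f := fun _ => (0 : ℝ)) ?_
        filter_upwards [hc.continuousAt.eventually_lt_const h] with α hα
        rw [Set.indicator_of_notMem]
        exact not_lt.2 hα.le
      · refine continuousAt_const.congr (f := fun _ => f y) ?_
        filter_upwards [hc.continuousAt.eventually_const_lt h] with α hα
        rw [Set.indicator_of_mem]
        exact hα
  have h0 : (0 : ℝ) ∈ Set.uIcc (φ 0) (φ π) := by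
    rw [hpi, Set.mem_uIcc]
    rcases le_total (φ 0) 0 with h | h
    · exact Or.inl ⟨h, by linarith⟩
    · exact Or.inr ⟨by linarith, h⟩
  obtain ⟨α, -, hα⟩ := intermediate_value_uIcc (f := φ) (a := 0) (b := π) hcont.continuousOn h0
  exact ⟨α, hα, by linarith [hadd α]⟩

theorem eq_segment_of_halfplanes {n : ℕ} {N : Set (EuclideanSpace ℝ (Fin n))} (hN : IsCompact N)
    (hc : Convex ℝ N) (hne : N.Nonempty) {D : Set (EuclideanSpace ℝ (Fin n))} (hD : Dense D)
    (h : ∀ z ∈ D, ∀ i j : Fin n, i ≠ j → ∃ α, ∀ y ∈ N, 0 ≤ ⟪planeDir i j α, y - z⟫) :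
    ∃ a b, N = segment ℝ a b := by
  have hall : ∀ z, ∀ i j : Fin n, i ≠ j → ∃ w : Circle, ∀ y ∈ N,
      0 ≤ (w : ℂ).re * (y - z) i + (w : ℂ).im * (y - z) j := by
    intro z i j hij
    set T : Set (Circle × EuclideanSpace ℝ (Fin n)) :=
      {p | ∀ y ∈ N, 0 ≤ (p.1 : ℂ).re * (y - p.2) i + (p.1 : ℂ).im * (y - p.2) j} with hT
    have hTc : IsClosed T := by
      simp only [hT, Set.ofPred_forall]
      refine isClosed_biInter fun y _ => isClosed_le continuous_const ?_
      have h1 : Continuous fun p : Circle × EuclideanSpace ℝ (Fin n) => (p.1 : ℂ) :=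
        continuous_subtype_val.comp continuous_fst
      have h2 := Complex.continuous_re.comp h1
      have h3 := Complex.continuous_im.comp h1
      simp only [Function.comp_def] at h2 h3
      fun_prop
    have hTi : IsClosed (Prod.snd '' T) := isClosedMap_snd_of_compactSpace _ hTc
    have hsub : D ⊆ Prod.snd '' T := by
      intro z hz
      obtain ⟨α, hα⟩ := h z hz i j hij
      refine ⟨(Circle.exp α, z), fun y hy => ?_, rfl⟩
      have := hα y hy
      rw [inner_planeDir] at this
      simpa [Circle.coe_exp, Complex.exp_ofReal_mul_I_re, Complex.exp_ofReal_mul_I_im] using this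
    have hz : z ∈ Prod.snd '' T := by
      have := hTi.closure_subset_iff.2 hsub
      exact this (hD z)
    obtain ⟨⟨w, z'⟩, hw, rfl⟩ := hz
    exact ⟨w, hw⟩
  have hdet : ∀ x ∈ N, ∀ y ∈ N, ∀ w ∈ N, ∀ i j,
      (y i - x i) * (w j - x j) = (y j - x j) * (w i - x i) := by
    intro x hx y hy w hw i j
    rcases eq_or_ne i j with rfl | hij
    · rfl
    obtain ⟨c, hc⟩ := hall ((1 / 3 : ℝ) • (x + y + w)) i j hij
    have hx' := hc x hx
    have hy' := hc y hy
    have hw' := hc w hw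
    have hcs : (c : ℂ).re ^ 2 + (c : ℂ).im ^ 2 = 1 := by
      have := Circle.normSq_coe c
      rw [Complex.normSq_apply] at this
      linarith
    simp only [PiLp.sub_apply, PiLp.smul_apply, PiLp.add_apply, smul_eq_mul] at hx' hy' hw'
    generalize (c : ℂ).re = p at *
    generalize (c : ℂ).im = q at *
    have e1 : p * (y i - x i) + q * (y j - x j) = 0 := by linarith
    have e2 : p * (w i - x i) + q * (w j - x j) = 0 := by linarith
    have e3 : p * ((y i - x i) * (w j - x j) - (y j - x j) * (w i - x i)) = 0 := by
      linear_combination (w j - x j) * e1 - (y j - x j) * e2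
    have e4 : q * ((y i - x i) * (w j - x j) - (y j - x j) * (w i - x i)) = 0 := by
      linear_combination (y i - x i) * e2 - (w i - x i) * e1
    have : (p ^ 2 + q ^ 2) * ((y i - x i) * (w j - x j) - (y j - x j) * (w i - x i)) = 0 := by
      linear_combination p * e3 + q * e4
    rw [hcs, one_mul] at this
    linarith
  by_cases hconst : ∃ x ∈ N, ∃ y ∈ N, ∃ i, x i ≠ y i
  · obtain ⟨x, hx, y, hy, i, hi⟩ := hconst
    have hco : ContinuousOn (fun y : EuclideanSpace ℝ (Fin n) => y i) N := by fun_prop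
    obtain ⟨a, ha, hamin⟩ := hN.exists_isMinOn hne hco
    obtain ⟨b, hb, hbmax⟩ := hN.exists_isMaxOn hne hco
    have hmin : ∀ w ∈ N, a i ≤ w i := fun w hw => hamin hw
    have hmax : ∀ w ∈ N, w i ≤ b i := fun w hw => hbmax hw
    have hab : a i < b i := by
      rcases lt_or_gt_of_ne hi with h | h
      · exact (hmin x hx).trans_lt (h.trans_le (hmax y hy))
      · exact (hmin y hy).trans_lt (h.trans_le (hmax x hx))
    have hpos : 0 < b i - a i := sub_pos.2 hab
    refine ⟨a, b, Set.Subset.antisymm (fun w hw => ?_) (hc.segment_subset ha hb)⟩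
    rw [segment_eq_image']
    refine ⟨(w i - a i) / (b i - a i), ⟨div_nonneg (by linarith [hmin w hw]) hpos.le,
      (div_le_one hpos).2 (by linarith [hmax w hw])⟩, ?_⟩
    ext j
    have := hdet a ha b hb w hw i j
    simp only [PiLp.add_apply, PiLp.smul_apply, PiLp.sub_apply, smul_eq_mul]
    field_simp
    linarith
  · push Not at hconst
    obtain ⟨x, hx⟩ := hne
    refine ⟨x, x, ?_⟩
    rw [segment_same]
    refine Set.eq_singleton_iff_unique_mem.2 ⟨hx, fun y hy => ?_⟩
    ext i
    exact hconst y hy x hx i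

/-- The localization principle: a property inherited by at least one half of every bisection of
`u` persists along a sequence of zero-mean convex sets shrinking to a segment. -/
theorem exists_isNeedleSeq {n : ℕ} {S : Set (EuclideanSpace ℝ (Fin n))} (hSo : IsOpen S)
    (hSc : Convex ℝ S) (hSb : Bornology.IsBounded S) (hSn : S.Nonempty)
    {u : EuclideanSpace ℝ (Fin n) → ℝ} (hu : IntegrableOn u S) (hu0 : ∫ y in S, u y = 0)
    (P : Set (EuclideanSpace ℝ (Fin n)) → Prop) (hPS : P S)
    (step : ∀ K ⊆ S, IsOpen K → Convex ℝ K → K.Nonempty → ∫ y in K, u y = 0 → P K →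
      ∀ θ : EuclideanSpace ℝ (Fin n), θ ≠ 0 → ∀ z,
      ∫ y in K ∩ {y | 0 < ⟪θ, y - z⟫}, u y = 0 → ∫ y in K ∩ {y | ⟪θ, y - z⟫ < 0}, u y = 0 →
      ((K ∩ {y | 0 < ⟪θ, y - z⟫}).Nonempty ∧ P (K ∩ {y | 0 < ⟪θ, y - z⟫})) ∨
      ((K ∩ {y | ⟪θ, y - z⟫ < 0}).Nonempty ∧ P (K ∩ {y | ⟪θ, y - z⟫ < 0}))) :
    ∃ K a b, IsNeedleSeq S K a b ∧ (∀ k, ∫ y in K k, u y = 0) ∧ ∀ k, P (K k) := by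
  let Good : Type := {K : Set (EuclideanSpace ℝ (Fin n)) // K ⊆ S ∧ IsOpen K ∧ Convex ℝ K ∧ K.Nonempty ∧
    ∫ y in K, u y = 0 ∧ P K}
  have hnext : ∀ (k : ℕ) (K : Good), ∃ K' : Good, K'.1 ⊆ K.1 ∧
      ∀ (m : ℕ) (i j : Fin n), Encodable.decode k = some (m, i, j) → i ≠ j →
        ∃ α, ∀ y ∈ K'.1, 0 < ⟪planeDir i j α, y - TopologicalSpace.denseSeq (EuclideanSpace ℝ (Fin n)) m⟫ := by
    rintro k ⟨K, hKS, hKo, hKc, hKn, hK0, hKP⟩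
    by_cases hk : ∃ (m : ℕ) (i j : Fin n), Encodable.decode k = some (m, i, j) ∧ i ≠ j
    · obtain ⟨m, i, j, hk, hij⟩ := hk
      set z := TopologicalSpace.denseSeq (EuclideanSpace ℝ (Fin n)) m with hz
      obtain ⟨α, hα1, hα2⟩ := exists_bisecting_halfspace hij z hKo.measurableSet
        (hu.mono_set hKS) hK0
      have hlin : IsLinearMap ℝ fun y => ⟪planeDir i j α, y⟫ :=
        { map_add := fun x y => inner_add_right _ _ _, map_smul := fun c x => inner_smul_right _ _ _ }
      have hcont : Continuous fun y => ⟪planeDir i j α, y - z⟫ := by fun_prop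
      rcases step K hKS hKo hKc hKn hK0 hKP _ (planeDir_ne_zero hij α) z hα1 hα2 with
        ⟨h1, h2⟩ | ⟨h1, h2⟩
      · refine ⟨⟨K ∩ {y | 0 < ⟪planeDir i j α, y - z⟫}, Set.inter_subset_left.trans hKS,
          hKo.inter (isOpen_lt continuous_const hcont), hKc.inter ?_, h1, hα1, h2⟩,
          Set.inter_subset_left, ?_⟩
        · have := convex_halfSpace_gt hlin ⟪planeDir i j α, z⟫
          simpa only [inner_sub_right, sub_pos] using this
        · intro m' i' j' h' _
          rw [hk] at h'
          simp only [Option.some.injEq, Prod.mk.injEq] at h'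
          obtain ⟨rfl, rfl, rfl⟩ := h'
          exact ⟨α, fun y hy => hy.2⟩
      · refine ⟨⟨K ∩ {y | ⟪planeDir i j α, y - z⟫ < 0}, Set.inter_subset_left.trans hKS,
          hKo.inter (isOpen_lt hcont continuous_const), hKc.inter ?_, h1, hα2, h2⟩,
          Set.inter_subset_left, ?_⟩
        · have := convex_halfSpace_lt hlin ⟪planeDir i j α, z⟫
          simpa only [inner_sub_right, sub_neg] using this
        · intro m' i' j' h' _
          rw [hk] at h'
          simp only [Option.some.injEq, Prod.mk.injEq] at h'
          obtain ⟨rfl, rfl, rfl⟩ := h'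
          refine ⟨α + π, fun y hy => ?_⟩
          rw [planeDir_add_pi, inner_neg_left]
          exact neg_pos.2 hy.2
    · refine ⟨⟨K, hKS, hKo, hKc, hKn, hK0, hKP⟩, subset_rfl, fun m i j h1 h2 => ?_⟩
      exact (hk ⟨m, i, j, h1, h2⟩).elim
  choose next hnext1 hnext2 using hnext
  let Q : ℕ → Good := fun k => Nat.rec ⟨S, subset_rfl, hSo, hSc, hSn, hu0, hPS⟩ next k
  have hQ : ∀ k, Q (k + 1) = next k (Q k) := fun k => rfl
  have hanti : Antitone fun k => (Q k).1 := antitone_nat_of_succ_le fun k => by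
    rw [hQ]
    exact hnext1 k (Q k)
  have hcomp : ∀ k, IsCompact (closure (Q k).1) := fun k =>
    (hSb.subset (Q k).2.1).isCompact_closure
  have hNne : (⋂ k, closure (Q k).1).Nonempty :=
    IsCompact.nonempty_iInter_of_sequence_nonempty_isCompact_isClosed _
      (fun k => closure_mono (hanti k.le_succ)) (fun k => (Q k).2.2.2.2.1.closure) (hcomp 0)
      fun k => isClosed_closure
  have hNc : IsCompact (⋂ k, closure (Q k).1) :=
    (hcomp 0).of_isClosed_subset (isClosed_iInter fun k => isClosed_closure)
      (Set.iInter_subset _ 0)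
  obtain ⟨a, b, hab⟩ := eq_segment_of_halfplanes hNc
    (convex_iInter fun k => (Q k).2.2.2.1.closure) hNne
    (TopologicalSpace.denseRange_denseSeq _) (by
      rintro _ ⟨m, rfl⟩ i j hij
      obtain ⟨α, hα⟩ := hnext2 (Encodable.encode (m, i, j)) (Q (Encodable.encode (m, i, j))) m i j
        (Encodable.encodek _) hij
      refine ⟨α, fun y hy => ?_⟩
      have hy' : y ∈ closure (Q (Encodable.encode (m, i, j) + 1)).1 := 
        Set.mem_iInter.1 hy (Encodable.encode (m, i, j) + 1)
      have hclosed : IsClosed {y | 0 ≤ ⟪planeDir i j α, y - TopologicalSpace.denseSeq (EuclideanSpace ℝ (Fin n)) m⟫} :=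
        isClosed_le continuous_const (by fun_prop)
      rw [hQ] at hy'
      exact closure_minimal (fun y hy => (hα y hy).le) hclosed hy')
  exact ⟨fun k => (Q k).1, a, b,
    { antitone := hanti
      isOpen := fun k => (Q k).2.2.1
      convex := fun k => (Q k).2.2.2.1
      nonempty := fun k => (Q k).2.2.2.2.1
      subset := fun k => (Q k).2.1
      iInter_closure := hab },
    fun k => (Q k).2.2.2.2.2.1, fun k => (Q k).2.2.2.2.2.2⟩

namespace IsMinkowskiNorm

variable {n : ℕ} {F : EuclideanSpace ℝ (Fin n) → ℝ}

theorem map_zero (hF : IsMinkowskiNorm F) : F 0 = 0 := by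
  simpa using hF.homog 0 0

theorem continuous (hF : IsMinkowskiNorm F) : Continuous F :=
  continuousOn_univ.1 (hF.convexOn.continuousOn isOpen_univ)

theorem add_le (hF : IsMinkowskiNorm F) (x y : EuclideanSpace ℝ (Fin n)) :
    F (x + y) ≤ F x + F y := by
  have h := hF.convexOn.2 (Set.mem_univ ((2 : ℝ) • x)) (Set.mem_univ ((2 : ℝ) • y))
    (by norm_num : (0 : ℝ) ≤ 1 / 2) (by norm_num : (0 : ℝ) ≤ 1 / 2) (by norm_num)
  simp only [hF.homog, smul_smul, smul_eq_mul] at h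
  norm_num at h
  linarith

theorem exists_pos_mul_norm_le (hF : IsMinkowskiNorm F) : ∃ c > 0, ∀ ξ, c * ‖ξ‖ ≤ F ξ := by
  rcases (Metric.sphere (0 : EuclideanSpace ℝ (Fin n)) 1).eq_empty_or_nonempty with he | hne
  · refine ⟨1, one_pos, fun ξ => ?_⟩
    have : ξ = 0 := by
      by_contra h
      have : (‖ξ‖⁻¹ • ξ) ∈ Metric.sphere (0 : EuclideanSpace ℝ (Fin n)) 1 := by
        simp [norm_smul, h]
      rw [he] at this
      exact this
    simp [this, hF.map_zero]
  · obtain ⟨x, hx, hmin⟩ := (isCompact_sphere (0 : EuclideanSpace ℝ (Fin n)) 1).exists_isMinOn hne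
      hF.continuous.continuousOn
    have hx0 : x ≠ 0 := by
      rintro rfl
      simp at hx
    refine ⟨F x, hF.pos x hx0, fun ξ => ?_⟩
    rcases eq_or_ne ξ 0 with rfl | h
    · simp [hF.map_zero]
    have h1 : (‖ξ‖⁻¹ • ξ) ∈ Metric.sphere (0 : EuclideanSpace ℝ (Fin n)) 1 := by
      simp [norm_smul, h]
    have h2 : F x ≤ F (‖ξ‖⁻¹ • ξ) := hmin h1
    have hpos := norm_pos_iff.2 h
    rw [hF.homog, abs_of_pos (inv_pos.2 hpos), inv_mul_eq_div, le_div_iff₀ hpos] at h2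
    exact h2

end IsMinkowskiNorm

/-- The sharp (non-strict) anisotropic Poincaré inequality on convex sets. -/
theorem anisotropic_poincare_le {n : ℕ} {S : Set (EuclideanSpace ℝ (Fin n))} (hSo : IsOpen S)
    (hSc : Convex ℝ S) (hSb : Bornology.IsBounded S) (hSn : S.Nonempty)
    {F : EuclideanSpace ℝ (Fin n) → ℝ} (hF : IsMinkowskiNorm F)
    {u : EuclideanSpace ℝ (Fin n) → ℝ} {G : EuclideanSpace ℝ (Fin n) → EuclideanSpace ℝ (Fin n)}
    (hG : ContinuousOn G (closure S)) (hu : ∀ y ∈ closure S, HasGradientAt u (G y) y)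
    (hu0 : ∫ y in S, u y = 0) {D : ℝ} (hD : 0 < D)
    (hdiam : ∀ x ∈ closure S, ∀ y ∈ closure S, ∀ ξ, ⟪ξ, y - x⟫ ≤ D * F ξ) :
    π ^ 2 / D ^ 2 * ∫ y in S, u y ^ 2 ≤ ∫ y in S, F (G y) ^ 2 := by
  by_contra! hcon
  have huc : ContinuousOn u (closure S) := fun y hy =>
    (hu y hy).continuousAt.continuousWithinAt
  have hint : ∀ {f : EuclideanSpace ℝ (Fin n) → ℝ}, ContinuousOn f (closure S) →
      IntegrableOn f S := fun hf =>
    (hf.integrableOn_compact hSb.isCompact_closure).mono_set subset_closure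
  have hFG : ContinuousOn (fun y => F (G y) ^ 2) (closure S) :=
    (hF.continuous.comp_continuousOn hG).pow 2
  have hm : 0 < volume.real S :=
    ENNReal.toReal_pos (hSo.measure_pos volume hSn).ne' hSb.measure_lt_top.ne
  set c := π ^ 2 / D ^ 2 with hc
  obtain ⟨δ, hδ, hδ'⟩ : ∃ δ > 0, (∫ y in S, F (G y) ^ 2) + δ * volume.real S <
      c * ∫ y in S, u y ^ 2 := by
    refine ⟨(c * (∫ y in S, u y ^ 2) - ∫ y in S, F (G y) ^ 2) / (2 * volume.real S),
      div_pos (by linarith) (by linarith), ?_⟩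
    field_simp
    linarith
  set q : EuclideanSpace ℝ (Fin n) → ℝ := fun y => F (G y) ^ 2 - c * u y ^ 2 + δ with hq
  have hqc : ContinuousOn q (closure S) :=
    (hFG.sub (continuousOn_const.mul (huc.pow 2))).add continuousOn_const
  have hqint : ∀ K ⊆ S, ∫ y in K, q y =
      (∫ y in K, F (G y) ^ 2) - c * (∫ y in K, u y ^ 2) + δ * volume.real K := by
    intro K hK
    have hKfin : volume K ≠ ⊤ := (hSb.subset hK).measure_lt_top.ne
    have i1 := (hint hFG).mono_set hK
    have i2 : IntegrableOn (fun y => c * u y ^ 2) K := by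
      have := ((hint (huc.pow 2)).mono_set hK).const_mul c
      exact this
    have i3 : IntegrableOn (fun _ : EuclideanSpace ℝ (Fin n) => δ) K :=
      integrableOn_const hKfin
    have i12 : IntegrableOn (fun y => F (G y) ^ 2 - c * u y ^ 2) K := i1.sub i2
    simp only [hq]
    rw [integral_add i12 i3, integral_sub i1 i2, integral_const_mul, setIntegral_const,
      smul_eq_mul, mul_comm δ]
  obtain ⟨K, a, b, hK, hK0, hP⟩ := exists_isNeedleSeq hSo hSc hSb hSn (hint huc) hu0
    (fun K => ∫ y in K, q y < 0) (by rw [hqint S subset_rfl]; linarith) (by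
      intro K hKS hKo _ _ _ hPK θ hθ z _ _
      have := setIntegral_halfspace_add hθ z hKo.measurableSet ((hint hqc).mono_set hKS)
      have hne : ∀ T : Set (EuclideanSpace ℝ (Fin n)), ∫ y in T, q y < 0 → T.Nonempty := by
        intro T hT
        by_contra h
        rw [Set.not_nonempty_iff_eq_empty.1 h] at hT
        simp at hT
      by_cases h1 : ∫ y in K ∩ {y | 0 < ⟪θ, y - z⟫}, q y < 0
      · exact Or.inl ⟨hne _ h1, h1⟩
      · have h2 : ∫ y in K ∩ {y | ⟪θ, y - z⟫ < 0}, q y < 0 := by linarith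
        exact Or.inr ⟨hne _ h2, h2⟩)
  obtain ⟨k, hk⟩ := (hK.poincare_estimate hSb hG hu hK0 (ε := D ^ 2 * δ) (by positivity)).exists
  have hab : a ∈ closure S ∧ b ∈ closure S :=
    ⟨hK.segment_subset_closure (left_mem_segment ℝ a b),
      hK.segment_subset_closure (right_mem_segment ℝ a b)⟩
  have h1 : ∫ y in K k, ⟪G y, b - a⟫ ^ 2 ≤ D ^ 2 * ∫ y in K k, F (G y) ^ 2 := by
    rw [← integral_const_mul]
    refine setIntegral_mono ((hint ((hG.inner continuousOn_const).pow 2)).mono_set (hK.subset k))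
      (((hint hFG).mono_set (hK.subset k)).const_mul _) fun y => ?_
    rw [← mul_pow]
    refine sq_le_sq' ?_ (hdiam a hab.1 b hab.2 (G y))
    have := hdiam b hab.2 a hab.1 (G y)
    rw [← neg_sub b a, inner_neg_right] at this
    linarith
  have h2 := hP k
  rw [hqint _ (hK.subset k)] at h2
  have h3 : π ^ 2 = D ^ 2 * c := by rw [hc]; field_simp
  rw [h3] at hk
  have hD2 : 0 < D ^ 2 := by positivity
  nlinarith

theorem mem_closure_halfspace_or {n : ℕ} {θ : EuclideanSpace ℝ (Fin n)} (hθ : θ ≠ 0)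
    (z : EuclideanSpace ℝ (Fin n)) {K : Set (EuclideanSpace ℝ (Fin n))} (hK : IsOpen K)
    {p : EuclideanSpace ℝ (Fin n)} (hp : p ∈ closure K) :
    p ∈ closure (K ∩ {y | 0 < ⟪θ, y - z⟫}) ∨ p ∈ closure (K ∩ {y | ⟪θ, y - z⟫ < 0}) := by
  rw [← Set.mem_union, ← closure_union, _root_.mem_closure_iff]
  intro o ho hpo
  have hne : (o ∩ K).Nonempty := _root_.mem_closure_iff.1 hp o ho hpo
  have hpos := (ho.inter hK).measure_pos volume hne
  by_contra hcon
  refine hpos.ne' (measure_mono_null (fun y hy => ?_) (volume_hyperplane_eq_zero hθ z))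
  by_contra h
  rcases lt_or_gt_of_ne (h : ⟪θ, y - z⟫ ≠ 0) with h | h
  · exact hcon ⟨y, hy.1, Or.inr ⟨hy.2, h⟩⟩
  · exact hcon ⟨y, hy.1, Or.inl ⟨hy.2, h⟩⟩

namespace IsNeedleSeq

variable {n : ℕ} {S : Set (EuclideanSpace ℝ (Fin n))} {K : ℕ → Set (EuclideanSpace ℝ (Fin n))}
  {a b : EuclideanSpace ℝ (Fin n)}

theorem eq_zero_of_setIntegral_le (h : IsNeedleSeq S K a b) (hS : Bornology.IsBounded S)
    {g : EuclideanSpace ℝ (Fin n) → ℝ} (hg : ContinuousOn g (closure S))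
    (hg0 : ∀ y ∈ closure S, 0 ≤ g y)
    (hsmall : ∀ ε > 0, ∀ᶠ k in Filter.atTop, ∫ y in K k, g y ≤ ε * volume.real (K k))
    {p : EuclideanSpace ℝ (Fin n)} (hp : p ∈ segment ℝ a b) : g p = 0 := by
  by_contra hne
  have hpS := h.segment_subset_closure hp
  have hgp : 0 < g p := lt_of_le_of_ne (hg0 p hpS) (Ne.symm hne)
  obtain ⟨r, hr, hball⟩ : ∃ r > 0, ∀ y ∈ closure S, dist y p < r → g p / 2 < g y := by
    have := (hg p hpS).eventually (lt_mem_nhds (half_lt_self hgp))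
    rw [Metric.nhdsWithin_basis_ball.eventually_iff] at this
    obtain ⟨r, hr, h1⟩ := this
    exact ⟨r, hr, fun y hy hd => h1 ⟨hd, hy⟩⟩
  obtain ⟨R, hR⟩ := hS.closure.subset_ball p
  set τ := min 1 (r / (|R| + 1)) with hτ
  have hR1 : 0 < |R| + 1 := by positivity
  have hτ0 : 0 < τ := lt_min one_pos (div_pos hr hR1)
  have hτ1 : τ ≤ 1 := min_le_left _ _
  have hτr : τ * (|R| + 1) ≤ r := (le_div_iff₀ hR1).1 (min_le_right _ _)
  obtain ⟨k, hk⟩ := (hsmall (g p / 4 * τ ^ n) (by positivity)).exists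
  have hm := h.volume_pos hS k
  have hpk := h.segment_subset k hp
  have hfin : volume (K k) ≠ ⊤ := (hS.subset (h.subset k)).measure_lt_top.ne
  set T := AffineMap.homothety p τ '' K k with hT
  have hTK : ∀ y ∈ T, y ∈ K k ∧ dist y p < r := by
    rintro _ ⟨y, hy, rfl⟩
    have hy2 : dist y p < |R| + 1 :=
      (hR (subset_closure (h.subset k hy))).trans_le (by linarith [le_abs_self R])
    constructor
    · rw [AffineMap.homothety_apply]
      have hi := (h.convex k).add_smul_sub_mem_interior' hpk
        (by rwa [(h.isOpen k).interior_eq] : y ∈ interior (K k)) (t := τ) ⟨hτ0, hτ1⟩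
      rw [(h.isOpen k).interior_eq] at hi
      simpa [vsub_eq_sub, add_comm] using hi
    · rw [AffineMap.homothety_apply, dist_eq_norm]
      simp only [vsub_eq_sub, vadd_eq_add, add_sub_cancel_right, norm_smul, Real.norm_eq_abs,
        abs_of_pos hτ0]
      rw [dist_eq_norm] at hy2
      exact (mul_lt_mul_of_pos_left hy2 hτ0).trans_le hτr
  have hTm : MeasurableSet T := by
    have : IsOpen T := AffineMap.homothety_isOpenMap p τ hτ0.ne' _ (h.isOpen k)
    exact this.measurableSet
  have hTvol : volume.real T = τ ^ n * volume.real (K k) := by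
    rw [hT, measureReal_def, Measure.addHaar_image_homothety]
    simp [ENNReal.toReal_mul, abs_of_pos hτ0, measureReal_def, (pow_pos hτ0 n).le]
  have hTsub : T ⊆ K k := fun y hy => (hTK y hy).1
  have hgi := h.integrableOn hS hg k
  have h1 : ∫ y in T, g y ≤ ∫ y in K k, g y := by
    refine setIntegral_mono_set hgi ?_ (Filter.Eventually.of_forall hTsub)
    exact (ae_restrict_iff' (h.isOpen k).measurableSet).2
      (ae_of_all _ fun y hy => hg0 y (subset_closure (h.subset k hy)))
  have h2 : g p / 2 * volume.real T ≤ ∫ y in T, g y := by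
    have hc : IntegrableOn (fun _ : EuclideanSpace ℝ (Fin n) => g p / 2) T :=
      integrableOn_const (ne_top_of_le_ne_top hfin (measure_mono hTsub))
    have := setIntegral_mono_on hc (hgi.mono_set hTsub) hTm fun y hy =>
      (hball y (subset_closure (h.subset k (hTsub hy))) (hTK y hy).2).le
    rwa [setIntegral_const, smul_eq_mul, mul_comm] at this
  rw [hTvol] at h2
  have : 0 < g p * (τ ^ n * volume.real (K k)) := by positivity
  nlinarith

end IsNeedleSeq

/-- The data of an extremal function for the Poincaré inequality on a convex set. -/
structure IsExtremal {n : ℕ} (S : Set (EuclideanSpace ℝ (Fin n)))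
    (F : EuclideanSpace ℝ (Fin n) → ℝ) (u : EuclideanSpace ℝ (Fin n) → ℝ)
    (G : EuclideanSpace ℝ (Fin n) → EuclideanSpace ℝ (Fin n)) (d : ℝ) : Prop where
  isOpen : IsOpen S
  convex : Convex ℝ S
  bounded : Bornology.IsBounded S
  nonempty : S.Nonempty
  norm : IsMinkowskiNorm F
  grad_cont : ContinuousOn G (closure S)
  hasGradientAt : ∀ y ∈ closure S, HasGradientAt u (G y) y
  mean_zero : ∫ y in S, u y = 0
  diam_pos : 0 < d
  diam : ∀ x ∈ closure S, ∀ y ∈ closure S, ∀ ξ, ⟪ξ, y - x⟫ ≤ d * F ξ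
  energy_le : ∫ y in S, F (G y) ^ 2 ≤ π ^ 2 / d ^ 2 * ∫ y in S, u y ^ 2

namespace IsExtremal

variable {n : ℕ} {S : Set (EuclideanSpace ℝ (Fin n))} {F : EuclideanSpace ℝ (Fin n) → ℝ}
  {u : EuclideanSpace ℝ (Fin n) → ℝ} {G : EuclideanSpace ℝ (Fin n) → EuclideanSpace ℝ (Fin n)}
  {d : ℝ}

theorem continuousOn (h : IsExtremal S F u G d) : ContinuousOn u (closure S) := fun y hy =>
  (h.hasGradientAt y hy).continuousAt.continuousWithinAt

theorem integrableOn (h : IsExtremal S F u G d) {f : EuclideanSpace ℝ (Fin n) → ℝ}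
    (hf : ContinuousOn f (closure S)) {K : Set (EuclideanSpace ℝ (Fin n))} (hK : K ⊆ S) :
    IntegrableOn f K :=
  (hf.integrableOn_compact h.bounded.isCompact_closure).mono_set (hK.trans subset_closure)

theorem continuousOn_F (h : IsExtremal S F u G d) :
    ContinuousOn (fun y => F (G y) ^ 2) (closure S) :=
  (h.norm.continuous.comp_continuousOn h.grad_cont).pow 2

/-- A needle sequence through `p` along which `u` is extremal. -/
structure IsNeedle (S : Set (EuclideanSpace ℝ (Fin n))) (F : EuclideanSpace ℝ (Fin n) → ℝ)
    (u : EuclideanSpace ℝ (Fin n) → ℝ) (G : EuclideanSpace ℝ (Fin n) → EuclideanSpace ℝ (Fin n))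
    (d : ℝ) (K : ℕ → Set (EuclideanSpace ℝ (Fin n)))
    (a b : EuclideanSpace ℝ (Fin n)) : Prop extends IsNeedleSeq S K a b where
  mean_zero : ∀ k, ∫ y in K k, u y = 0
  energy_eq : ∀ k, ∫ y in K k, F (G y) ^ 2 = π ^ 2 / d ^ 2 * ∫ y in K k, u y ^ 2

theorem exists_isNeedle (h : IsExtremal S F u G d) {p : EuclideanSpace ℝ (Fin n)}
    (hp : p ∈ closure S) : ∃ K a b, IsNeedle S F u G d K a b ∧ p ∈ segment ℝ a b := by
  set c := π ^ 2 / d ^ 2 with hc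
  set q : EuclideanSpace ℝ (Fin n) → ℝ := fun y => F (G y) ^ 2 - c * u y ^ 2 with hq
  have hcu : ContinuousOn (fun y => c * u y ^ 2) (closure S) :=
    continuousOn_const.mul (h.continuousOn.pow 2)
  have hqc : ContinuousOn q (closure S) := h.continuousOn_F.sub hcu
  have hqint : ∀ K ⊆ S, ∫ y in K, q y =
      (∫ y in K, F (G y) ^ 2) - c * (∫ y in K, u y ^ 2) := by
    intro K hK
    simp only [hq]
    rw [integral_sub (h.integrableOn h.continuousOn_F hK) (h.integrableOn hcu hK),
      integral_const_mul]
  have hnn : ∀ K ⊆ S, IsOpen K → Convex ℝ K → ∫ y in K, u y = 0 → 0 ≤ ∫ y in K, q y := by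
    intro K hK hKo hKc hK0
    rcases K.eq_empty_or_nonempty with rfl | hne
    · simp
    have hcl := closure_mono hK
    rw [hqint K hK, sub_nonneg]
    exact anisotropic_poincare_le hKo hKc (h.bounded.subset hK) hne h.norm
      (h.grad_cont.mono hcl) (fun y hy => h.hasGradientAt y (hcl hy)) hK0 h.diam_pos
      fun x hx y hy => h.diam x (hcl hx) y (hcl hy)
  have hS0 : ∫ y in S, q y = 0 := by
    refine le_antisymm ?_ (hnn S subset_rfl h.isOpen h.convex h.mean_zero)
    rw [hqint S subset_rfl]
    linarith [h.energy_le]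
  obtain ⟨K, a, b, hK, hK0, hP⟩ := exists_isNeedleSeq h.isOpen h.convex h.bounded h.nonempty
    (h.integrableOn h.continuousOn subset_rfl) h.mean_zero
    (fun K => p ∈ closure K ∧ ∫ y in K, q y = 0) ⟨hp, hS0⟩ (by
      rintro K hKS hKo hKc _ _ ⟨hpK, hqK⟩ θ hθ z h1 h2
      have hadd := setIntegral_halfspace_add hθ z hKo.measurableSet (h.integrableOn hqc hKS)
      have hlin : IsLinearMap ℝ fun y => ⟪θ, y⟫ :=
        { map_add := fun x y => inner_add_right _ _ _, map_smul := fun c x => inner_smul_right _ _ _ }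
      have hcont : Continuous fun y => ⟪θ, y - z⟫ := by fun_prop
      have n1 := hnn (K ∩ {y | 0 < ⟪θ, y - z⟫}) (Set.inter_subset_left.trans hKS)
        (hKo.inter (isOpen_lt continuous_const hcont)) (hKc.inter (by
          have := convex_halfSpace_gt hlin ⟪θ, z⟫
          simpa only [inner_sub_right, sub_pos] using this)) h1
      have n2 := hnn (K ∩ {y | ⟪θ, y - z⟫ < 0}) (Set.inter_subset_left.trans hKS)
        (hKo.inter (isOpen_lt hcont continuous_const)) (hKc.inter (by
          have := convex_halfSpace_lt hlin ⟪θ, z⟫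
          simpa only [inner_sub_right, sub_neg] using this)) h2
      rcases mem_closure_halfspace_or hθ z hKo hpK with h3 | h3
      · exact Or.inl ⟨closure_nonempty_iff.1 ⟨p, h3⟩, h3, by linarith⟩
      · exact Or.inr ⟨closure_nonempty_iff.1 ⟨p, h3⟩, h3, by linarith⟩)
  refine ⟨K, a, b, { hK with mean_zero := hK0, energy_eq := fun k => ?_ }, ?_⟩
  · have := (hP k).2
    rw [hqint _ (hK.subset k)] at this
    linarith
  · rw [← hK.iInter_closure, Set.mem_iInter]
    exact fun k => (hP k).1

theorem abs_inner_le (h : IsExtremal S F u G d) {x y : EuclideanSpace ℝ (Fin n)}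
    (hx : x ∈ closure S) (hy : y ∈ closure S) (ξ : EuclideanSpace ℝ (Fin n)) :
    |⟪ξ, y - x⟫| ≤ d * F ξ := by
  rw [abs_le]
  refine ⟨?_, h.diam x hx y hy ξ⟩
  have := h.diam y hy x hx ξ
  rw [← neg_sub y x, inner_neg_right] at this
  linarith

namespace IsNeedle

variable {K : ℕ → Set (EuclideanSpace ℝ (Fin n))} {a b p : EuclideanSpace ℝ (Fin n)}

theorem symm (hK : IsNeedle S F u G d K a b) : IsNeedle S F u G d K b a :=
  { hK.toIsNeedleSeq.symm with mean_zero := hK.mean_zero, energy_eq := hK.energy_eq }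

theorem left_mem (hK : IsNeedle S F u G d K a b) : a ∈ closure S :=
  hK.segment_subset_closure (left_mem_segment ℝ a b)

theorem right_mem (hK : IsNeedle S F u G d K a b) : b ∈ closure S :=
  hK.segment_subset_closure (right_mem_segment ℝ a b)

theorem eventually_energy_le (hK : IsNeedle S F u G d K a b) (h : IsExtremal S F u G d) {ε : ℝ}
    (hε : 0 < ε) : ∀ᶠ k in Filter.atTop,
      d ^ 2 * (∫ y in K k, F (G y) ^ 2) - (∫ y in K k, ⟪G y, b - a⟫ ^ 2)
        ≤ ε * volume.real (K k) := by
  filter_upwards [hK.poincare_estimate h.bounded h.grad_cont h.hasGradientAt hK.mean_zero hε]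
    with k hk
  have hd := h.diam_pos
  have : d ^ 2 * (∫ y in K k, F (G y) ^ 2) = π ^ 2 * ∫ y in K k, u y ^ 2 := by
    rw [hK.energy_eq k]
    field_simp
  linarith

theorem mul_F_eq (hK : IsNeedle S F u G d K a b) (h : IsExtremal S F u G d)
    (hp : p ∈ segment ℝ a b) : d * F (G p) = |⟪G p, b - a⟫| := by
  have hc1 : ContinuousOn (fun y => d ^ 2 * F (G y) ^ 2) (closure S) :=
    continuousOn_const.mul h.continuousOn_F
  have hc2 : ContinuousOn (fun y => ⟪G y, b - a⟫ ^ 2) (closure S) :=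
    (h.grad_cont.inner continuousOn_const).pow 2
  have := hK.eq_zero_of_setIntegral_le h.bounded (hc1.sub hc2) (fun y _ => by
    simp only [Pi.sub_apply]
    rw [← mul_pow, sub_nonneg, ← sq_abs]
    have := h.abs_inner_le hK.left_mem hK.right_mem (G y)
    gcongr) (fun ε hε => by
      filter_upwards [hK.eventually_energy_le h hε] with k hk
      simp only [Pi.sub_apply]
      rwa [integral_sub (h.integrableOn hc1 (hK.subset k)) (h.integrableOn hc2 (hK.subset k)),
        integral_const_mul]) hp
  simp only [Pi.sub_apply] at this
  rw [sub_eq_zero, ← mul_pow, ← sq_abs ⟪G p, b - a⟫] at this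
  exact (pow_left_inj₀ (mul_nonneg h.diam_pos.le (h.norm.nonneg _)) (abs_nonneg _) two_ne_zero).1
    this

theorem exists_inner_eq (hK : IsNeedle S F u G d K a b) (h : IsExtremal S F u G d)
    (hp : p ∈ segment ℝ a b) (hup : u p ≠ 0) : ∃ ξ, ξ ≠ 0 ∧ ⟪ξ, b - a⟫ = d * F ξ := by
  by_contra! hcon
  have hlt : ∀ ξ, ξ ≠ 0 → ⟪ξ, b - a⟫ < d * F ξ := fun ξ hξ =>
    lt_of_le_of_ne (h.diam a hK.left_mem b hK.right_mem ξ) (hcon ξ hξ)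
  obtain ⟨D, hD0, hDd, hD⟩ : ∃ D, 0 ≤ D ∧ D < d ∧ ∀ ξ, ⟪ξ, b - a⟫ ≤ D * F ξ := by
    rcases (Metric.sphere (0 : EuclideanSpace ℝ (Fin n)) 1).eq_empty_or_nonempty with he | hne
    · refine ⟨0, le_rfl, h.diam_pos, fun ξ => ?_⟩
      have : ξ = 0 := by
        by_contra h
        have : (‖ξ‖⁻¹ • ξ) ∈ Metric.sphere (0 : EuclideanSpace ℝ (Fin n)) 1 := by
          simp [norm_smul, h]
        rw [he] at this
        exact this
      simp [this]
    · have hFpos : ∀ x ∈ Metric.sphere (0 : EuclideanSpace ℝ (Fin n)) 1, x ≠ 0 := by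
        rintro x hx rfl
        simp at hx
      have hcq : ContinuousOn (fun ξ => ⟪ξ, b - a⟫ / F ξ)
          (Metric.sphere (0 : EuclideanSpace ℝ (Fin n)) 1) := by
        refine ContinuousOn.div (by fun_prop) h.norm.continuous.continuousOn fun x hx => ?_
        exact (h.norm.pos x (hFpos x hx)).ne'
      obtain ⟨x, hx, hmax⟩ := (isCompact_sphere (0 : EuclideanSpace ℝ (Fin n)) 1).exists_isMaxOn
        hne hcq
      have hxF := h.norm.pos x (hFpos x hx)
      refine ⟨max 0 (⟪x, b - a⟫ / F x), le_max_left _ _, max_lt h.diam_pos ?_, fun ξ => ?_⟩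
      · rw [div_lt_iff₀ hxF]
        exact hlt x (hFpos x hx)
      · rcases eq_or_ne ξ 0 with rfl | hξ
        · simp [h.norm.map_zero]
        have h1 : (‖ξ‖⁻¹ • ξ) ∈ Metric.sphere (0 : EuclideanSpace ℝ (Fin n)) 1 := by
          simp [norm_smul, hξ]
        have h2 : ⟪‖ξ‖⁻¹ • ξ, b - a⟫ / F (‖ξ‖⁻¹ • ξ) ≤ ⟪x, b - a⟫ / F x := hmax h1
        have hpos := inv_pos.2 (norm_pos_iff.2 hξ)
        rw [h.norm.homog, abs_of_pos hpos, real_inner_smul_left,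
          mul_div_mul_left _ _ hpos.ne'] at h2
        rw [← div_le_iff₀ (h.norm.pos ξ hξ)]
        exact h2.trans (le_max_right _ _)
  refine hup (pow_eq_zero_iff two_ne_zero |>.1
    (hK.eq_zero_of_setIntegral_le h.bounded (h.continuousOn.pow 2) (fun y _ => sq_nonneg _)
    (fun ε hε => ?_) hp))
  have hd := h.diam_pos
  have hc : 0 < (d ^ 2 - D ^ 2) * (π ^ 2 / d ^ 2) := by
    have : 0 < d ^ 2 - D ^ 2 := by nlinarith
    positivity
  filter_upwards [hK.eventually_energy_le h (mul_pos hc hε)] with k hk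
  have h1 : ∫ y in K k, ⟪G y, b - a⟫ ^ 2 ≤ D ^ 2 * ∫ y in K k, F (G y) ^ 2 := by
    rw [← integral_const_mul]
    refine setIntegral_mono (h.integrableOn ((h.grad_cont.inner continuousOn_const).pow 2)
      (hK.subset k)) ((h.integrableOn h.continuousOn_F (hK.subset k)).const_mul _) fun y => ?_
    simp only
    rw [← mul_pow]
    refine sq_le_sq' ?_ (hD (G y))
    have := hD (-G y)
    rw [inner_neg_left, h.norm.even] at this
    linarith
  rw [hK.energy_eq k] at h1 hk
  simp only [Pi.pow_apply]
  have h2 : (d ^ 2 - D ^ 2) * (π ^ 2 / d ^ 2) * (∫ y in K k, u y ^ 2) ≤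
      (d ^ 2 - D ^ 2) * (π ^ 2 / d ^ 2) * (ε * volume.real (K k)) := by linarith
  exact le_of_mul_le_mul_left h2 hc

end IsNeedle

end IsExtremal

theorem hasDerivAt_max_zero_sq (x : ℝ) :
    HasDerivAt (fun y : ℝ => max y 0 ^ 2) (2 * max x 0) x := by
  rcases lt_trichotomy x 0 with hx | rfl | hx
  · have : (fun y : ℝ => max y 0 ^ 2) =ᶠ[nhds x] fun _ => 0 := by
      filter_upwards [gt_mem_nhds hx] with y hy
      simp [max_eq_right hy.le]
    rw [max_eq_right hx.le, mul_zero]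
    exact (hasDerivAt_const x (0 : ℝ)).congr_of_eventuallyEq this
  · rw [hasDerivAt_iff_isLittleO_nhds_zero]
    simp only [zero_add, max_self, mul_zero, smul_zero, sub_zero, ne_eq, OfNat.ofNat_ne_zero,
      not_false_eq_true, zero_pow]
    have h : (fun y : ℝ => max y 0 ^ 2) =O[nhds 0] fun y => y ^ 2 :=
      Asymptotics.isBigO_of_le _ fun y => by
        rw [norm_pow, norm_pow]
        gcongr
        simp only [Real.norm_eq_abs]
        rw [abs_of_nonneg (le_max_right y 0)]
        exact max_le (le_abs_self y) (abs_nonneg y)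
    refine h.trans_isLittleO ?_
    simpa using Asymptotics.isLittleO_pow_pow (𝕜 := ℝ) (one_lt_two)
  · have : (fun y : ℝ => max y 0 ^ 2) =ᶠ[nhds x] fun y => y ^ 2 := by
      filter_upwards [lt_mem_nhds hx] with y hy
      simp [max_eq_left hy.le]
    rw [max_eq_left hx.le]
    exact ((hasDerivAt_pow 2 x).congr_of_eventuallyEq this).congr_deriv (by simp)

theorem HasSmoothBoundary.exists_normal {n : ℕ} {S : Set (EuclideanSpace ℝ (Fin n))}
    (hS : HasSmoothBoundary S) (hSo : IsOpen S) {b : EuclideanSpace ℝ (Fin n)}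
    (hb : b ∈ frontier S) :
    ∃ g : EuclideanSpace ℝ (Fin n), ∀ ν, (∀ y ∈ S, ⟪ν, y - b⟫ ≤ 0) → ∃ c : ℝ, ν = c • g := by
  obtain ⟨U, hU, f, hf, hUS, hfd⟩ := hS b hb
  have hbU := mem_of_mem_nhds hU
  have hbS : b ∉ S := by
    rw [hSo.frontier_eq] at hb
    exact hb.2
  have hdiff : DifferentiableAt ℝ f b := (hf.differentiable (by simp)) b
  set g := gradient f b with hg
  have hgrad : HasGradientAt f g b := hdiff.hasGradientAt
  have hg0 : g ≠ 0 := by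
    intro h0
    refine hfd b hbU hb ?_
    have := hgrad.hasFDerivAt.fderiv
    rw [this, h0, map_zero]
  have hfb : f b = 0 := by
    refine le_antisymm ?_ (not_lt.1 fun h => hbS ((hUS b hbU).2 h))
    by_contra! hpos
    have hev := (hf.continuous.continuousAt.eventually (lt_mem_nhds hpos)).and hU
    obtain ⟨y, ⟨hy1, hy2⟩, hy3⟩ := mem_closure_iff_nhds.1 (frontier_subset_closure hb) _ hev
    exact lt_asymm hy1 ((hUS y hy2).1 hy3)
  have hdir : ∀ v, ⟪g, v⟫ < 0 → ∀ ν, (∀ y ∈ S, ⟪ν, y - b⟫ ≤ 0) → ⟪ν, v⟫ ≤ 0 := by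
    intro v hv ν hν
    have hline : HasDerivAt (fun t : ℝ => b + t • v) v 0 := by
      simpa using ((hasDerivAt_id (0 : ℝ)).smul_const v).const_add b
    have hd : HasDerivAt (fun t : ℝ => f (b + t • v)) ⟪g, v⟫ 0 := by
      have h1 : HasFDerivAt f (InnerProductSpace.toDual ℝ _ g) (b + (0 : ℝ) • v) := by
        simpa using hgrad.hasFDerivAt
      simpa [Function.comp_def] using h1.comp_hasDerivAt (0 : ℝ) hline
    have hlt : ∀ᶠ t in nhdsWithin (0 : ℝ) (Set.Ioi 0), f (b + t • v) < 0 := by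
      have h2 := (hasDerivAt_iff_tendsto_slope_zero.1 hd).eventually (gt_mem_nhds hv)
      have h3 := h2.filter_mono (nhdsWithin_mono (0 : ℝ)
        (fun x (hx : 0 < x) => (hx.ne' : x ∈ ({0}ᶜ : Set ℝ))))
      filter_upwards [h3, self_mem_nhdsWithin] with t ht ht0
      have ht0 : 0 < t := ht0
      simp only [zero_add, zero_smul, add_zero, hfb, sub_zero, smul_eq_mul] at ht
      by_contra! hcon
      exact absurd ht (not_lt.2 (mul_nonneg (inv_pos.2 ht0).le hcon))
    have hmem : ∀ᶠ t in nhdsWithin (0 : ℝ) (Set.Ioi 0), b + t • v ∈ U := by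
      have := hline.continuousAt.tendsto
      simp only [zero_smul, add_zero] at this
      exact (this.eventually hU).filter_mono nhdsWithin_le_nhds
    obtain ⟨t, ⟨ht1, ht2⟩, ht0⟩ := ((hlt.and hmem).and self_mem_nhdsWithin).exists
    have := hν _ ((hUS _ ht2).2 ht1)
    rw [add_sub_cancel_left, real_inner_smul_right] at this
    exact nonpos_of_mul_nonpos_right this ht0
  refine ⟨g, fun ν hν => ⟨⟪g, ν⟫ / ⟪g, g⟫, ?_⟩⟩
  have hgg : 0 < ⟪g, g⟫ := real_inner_self_pos.2 hg0
  set w := ν - (⟪g, ν⟫ / ⟪g, g⟫) • g with hw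
  have hgw : ⟪g, w⟫ = 0 := by
    rw [hw, inner_sub_right, real_inner_smul_right, div_mul_cancel₀ _ hgg.ne', sub_self]
  have hνw : ⟪ν, w⟫ = ⟪w, w⟫ := by
    have : ν = w + (⟪g, ν⟫ / ⟪g, g⟫) • g := by rw [hw]; abel
    conv_lhs => rw [this]
    rw [inner_add_left, real_inner_smul_left, hgw, mul_zero, add_zero]
  have hle : ∀ ε > 0, ⟪ν, w⟫ ≤ ε * ⟪ν, g⟫ := by
    intro ε hε
    have := hdir (w - ε • g) (by
      rw [inner_sub_right, hgw, real_inner_smul_right]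
      nlinarith) ν hν
    rw [inner_sub_right, real_inner_smul_right] at this
    linarith
  have h0 : ⟪w, w⟫ ≤ 0 := by
    rw [← hνw]
    refine le_of_forall_pos_le_add fun ε hε => ?_
    have := hle (ε / (|⟪ν, g⟫| + 1)) (by positivity)
    refine this.trans ?_
    rw [zero_add, div_mul_eq_mul_div, div_le_iff₀ (by positivity)]
    have := le_abs_self ⟪ν, g⟫
    nlinarith
  have : w = 0 := real_inner_self_nonpos.1 h0
  rwa [hw, sub_eq_zero] at this

namespace IsExtremal.IsNeedle

variable {n : ℕ} {S : Set (EuclideanSpace ℝ (Fin n))} {F : EuclideanSpace ℝ (Fin n) → ℝ}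
  {u : EuclideanSpace ℝ (Fin n) → ℝ} {G : EuclideanSpace ℝ (Fin n) → EuclideanSpace ℝ (Fin n)}
  {d : ℝ} {K : ℕ → Set (EuclideanSpace ℝ (Fin n))} {a b p q : EuclideanSpace ℝ (Fin n)}

theorem eq_left_or_eq_right (hK : IsNeedle S F u G d K a b) (h : IsExtremal S F u G d)
    (hS : HasSmoothBoundary S) (hp : p ∈ segment ℝ a b) (hpS : p ∈ frontier S) (hup : u p ≠ 0) :
    p = a ∨ p = b := by
  by_contra! hcon
  have hpo : p ∈ openSegment ℝ a b := mem_openSegment_of_ne_left_right hcon.1.symm hcon.2.symm hp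
  have hpn : p ∉ S := by
    rw [h.isOpen.frontier_eq] at hpS
    exact hpS.2
  obtain ⟨f, hf⟩ := geometric_hahn_banach_open_point h.convex h.isOpen hpn
  set ν := (InnerProductSpace.toDual ℝ (EuclideanSpace ℝ (Fin n))).symm f with hν
  have hfν : ∀ y, f y = ⟪ν, y⟫ := fun y => by
    rw [hν, InnerProductSpace.toDual_symm_apply]
  have hcl : ∀ y ∈ closure S, ⟪ν, y - p⟫ ≤ 0 := by
    intro y hy
    have : closure S ⊆ {y | ⟪ν, y - p⟫ ≤ 0} := by
      refine closure_minimal (fun y hy => ?_) (isClosed_le (by fun_prop) continuous_const)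
      have := hf y hy
      rw [hfν, hfν] at this
      show ⟪ν, y - p⟫ ≤ 0
      rw [inner_sub_right]
      linarith
    exact this hy
  obtain ⟨s, t, hs, ht, hst, hpe⟩ := hpo
  have ha := hcl a hK.left_mem
  have hb := hcl b hK.right_mem
  have hsum : s * ⟪ν, a - p⟫ + t * ⟪ν, b - p⟫ = 0 := by
    rw [← real_inner_smul_right, ← real_inner_smul_right, ← inner_add_right]
    have : s • (a - p) + t • (b - p) = 0 := by
      rw [smul_sub, smul_sub, sub_add_sub_comm, hpe, ← add_smul, hst, one_smul, sub_self]
    rw [this, inner_zero_right]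
  have hb0 : ⟪ν, b - p⟫ = 0 := by nlinarith
  have ha0 : ⟪ν, a - p⟫ = 0 := by nlinarith
  have hba : ⟪ν, b - a⟫ = 0 := by
    rw [← sub_sub_sub_cancel_right b a p, inner_sub_right, hb0, ha0, sub_self]
  have hbn : b ∉ S := by
    intro hbS
    have := hf b hbS
    rw [hfν, hfν] at this
    rw [inner_sub_right] at hb0
    linarith
  have hbf : b ∈ frontier S := by
    rw [h.isOpen.frontier_eq]
    exact ⟨hK.right_mem, hbn⟩
  obtain ⟨g, hg⟩ := hS.exists_normal h.isOpen hbf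
  obtain ⟨ξ, hξ0, hξ⟩ := hK.exists_inner_eq h hp hup
  obtain ⟨c, hc⟩ := hg ν fun y hy => by
    have := hcl y (subset_closure hy)
    rw [← sub_sub_sub_cancel_right y b p, inner_sub_right, hb0]
    linarith
  obtain ⟨c', hc'⟩ := hg ξ fun y hy => by
    have := h.diam a hK.left_mem y (subset_closure hy) ξ
    rw [← sub_sub_sub_cancel_right y b a, inner_sub_right, hξ]
    linarith
  have hν0 : c ≠ 0 := by
    rintro rfl
    obtain ⟨y, hy⟩ := h.nonempty
    have := hf y hy
    rw [hfν, hfν, hc] at this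
    simp at this
  rw [hc, real_inner_smul_left, mul_eq_zero] at hba
  have hF := h.norm.pos ξ hξ0
  rw [hc', real_inner_smul_left, hba.resolve_left hν0, mul_zero, ← hc'] at hξ
  exact (mul_pos h.diam_pos hF).ne hξ

end IsExtremal.IsNeedle

theorem IsMinkowskiNorm.sub_smul_sq_le {n : ℕ} {F : EuclideanSpace ℝ (Fin n) → ℝ}
    (hF : IsMinkowskiNorm F) (x w : EuclideanSpace ℝ (Fin n)) {τ : ℝ} (h0 : 0 ≤ τ) (h1 : τ ≤ 1) :
    F (x - τ • w) ^ 2 ≤ F x ^ 2 + τ * (F (x - w) ^ 2 - F x ^ 2) := by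
  have h : F (x - τ • w) ≤ (1 - τ) * F x + τ * F (x - w) := by
    have := hF.convexOn.2 (Set.mem_univ x) (Set.mem_univ (x - w)) (sub_nonneg.2 h1) h0 (by ring)
    have he : (1 - τ) • x + τ • (x - w) = x - τ • w := by
      rw [sub_smul, one_smul, smul_sub]
      abel
    rwa [he] at this
  have hsq : F (x - τ • w) ^ 2 ≤ ((1 - τ) * F x + τ * F (x - w)) ^ 2 :=
    pow_le_pow_left₀ (hF.nonneg _) h 2
  nlinarith [mul_nonneg (mul_nonneg h0 (sub_nonneg.2 h1)) (sq_nonneg (F x - F (x - w)))]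

namespace IsExtremal.IsNeedle

variable {n : ℕ} {S : Set (EuclideanSpace ℝ (Fin n))} {F : EuclideanSpace ℝ (Fin n) → ℝ}
  {u : EuclideanSpace ℝ (Fin n) → ℝ} {G : EuclideanSpace ℝ (Fin n) → EuclideanSpace ℝ (Fin n)}
  {d : ℝ} {K : ℕ → Set (EuclideanSpace ℝ (Fin n))} {a b p q : EuclideanSpace ℝ (Fin n)}

/-- Minimality of `u` along a needle against perturbations `u + ψ`. -/
theorem perturbation_nonneg (hK : IsNeedle S F u G d K a b) (h : IsExtremal S F u G d)
    {ψ : EuclideanSpace ℝ (Fin n) → ℝ} {H : EuclideanSpace ℝ (Fin n) → EuclideanSpace ℝ (Fin n)}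
    (hH : ContinuousOn H (closure S)) (hψ : ∀ y ∈ closure S, HasGradientAt ψ (H y) y) (k : ℕ) :
    0 ≤ ∫ y in K k, (F (G y + H y) ^ 2 - F (G y) ^ 2 - 2 * (π ^ 2 / d ^ 2) * (u y * ψ y)) := by
  have hcl := closure_mono (hK.subset k)
  have hψc : ContinuousOn ψ (closure S) := fun y hy =>
    (hψ y hy).continuousAt.continuousWithinAt
  have huc := h.continuousOn
  have hint : ∀ {f : EuclideanSpace ℝ (Fin n) → ℝ}, ContinuousOn f (closure S) →
      IntegrableOn f (K k) := fun hf => h.integrableOn hf (hK.subset k)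
  have hvol := hK.volume_pos h.bounded k
  set m := (∫ y in K k, ψ y) / volume.real (K k) with hm
  have hconst : IntegrableOn (fun _ : EuclideanSpace ℝ (Fin n) => m) (K k) :=
    hint continuousOn_const
  have hfin : IsFiniteMeasure (volume.restrict (K k)) :=
    ⟨by simpa using (h.bounded.subset (hK.subset k)).measure_lt_top⟩
  have hv0 : ∫ y in K k, (u y + ψ y - m) = 0 := by
    have i12 : IntegrableOn (fun y => u y + ψ y) (K k) := (hint huc).add (hint hψc)
    rw [integral_sub i12 hconst, integral_add (hint huc) (hint hψc), hK.mean_zero k,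
      setIntegral_const, smul_eq_mul, hm]
    field_simp
    ring
  have hpoin := anisotropic_poincare_le (hK.isOpen k) (hK.convex k)
    (h.bounded.subset (hK.subset k)) (hK.nonempty k) h.norm
    (u := fun y => u y + ψ y - m) (G := fun y => G y + H y)
    ((h.grad_cont.add hH).mono hcl) (fun y hy => by
      have h1 := (h.hasGradientAt y (hcl hy)).hasFDerivAt
      have h2 := (hψ y (hcl hy)).hasFDerivAt
      rw [hasGradientAt_iff_hasFDerivAt, map_add]
      exact (h1.add h2).sub_const m) hv0 h.diam_pos
    fun x hx y hy => h.diam x (hcl hx) y (hcl hy)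
  have c1 : ContinuousOn (fun y => F (G y + H y) ^ 2) (closure S) :=
    (h.norm.continuous.comp_continuousOn (h.grad_cont.add hH)).pow 2
  have c2 : ContinuousOn (fun y => u y ^ 2) (closure S) := huc.pow 2
  have c3 : ContinuousOn (fun y => u y * ψ y) (closure S) := huc.mul hψc
  have c4 : ContinuousOn (fun y => (u y + ψ y - m) ^ 2) (closure S) :=
    ((huc.add hψc).sub continuousOn_const).pow 2
  have hle : (∫ y in K k, u y ^ 2) + 2 * (∫ y in K k, u y * ψ y) ≤
      ∫ y in K k, (u y + ψ y - m) ^ 2 := by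
    have i1 : IntegrableOn (fun y => u y ^ 2) (K k) := hint c2
    have i2 : IntegrableOn (fun y => 2 * (u y * ψ y)) (K k) := (hint c3).const_mul 2
    have i3 : IntegrableOn (fun y => 2 * m * u y) (K k) := (hint huc).const_mul _
    have i4 : IntegrableOn (fun y => u y ^ 2 + 2 * (u y * ψ y)) (K k) := i1.add i2
    calc _ = ∫ y in K k, (u y ^ 2 + 2 * (u y * ψ y) - 2 * m * u y) := by
          rw [integral_sub i4 i3, integral_add i1 i2, integral_const_mul, integral_const_mul,
            hK.mean_zero k]
          ring
      _ ≤ _ := by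
          refine setIntegral_mono (i4.sub i3) (hint c4) fun y => ?_
          simp only
          nlinarith [sq_nonneg (ψ y - m)]
  have i5 : IntegrableOn (fun y => F (G y + H y) ^ 2 - F (G y) ^ 2) (K k) :=
    (hint c1).sub (hint h.continuousOn_F)
  rw [integral_sub i5 ((hint c3).const_mul _), integral_sub (hint c1) (hint h.continuousOn_F),
    integral_const_mul, hK.energy_eq k]
  have hc : 0 ≤ π ^ 2 / d ^ 2 := by positivity
  have := mul_le_mul_of_nonneg_left hle hc
  linarith

/-- The gradient of `u` vanishes at the endpoints of a needle. -/
theorem grad_left_eq_zero (hK : IsNeedle S F u G d K p q) (h : IsExtremal S F u G d) :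
    G p = 0 := by
  by_contra hw0
  set w := G p with hw
  have hpS := hK.left_mem
  have hA : 0 < F w ^ 2 := pow_pos (h.norm.pos w hw0) 2
  obtain ⟨σ, hσ, hσw⟩ : ∃ σ : ℝ, σ ^ 2 = 1 ∧ 0 < ⟪σ • w, q - p⟫ := by
    have h1 := hK.mul_F_eq h (left_mem_segment ℝ p q)
    have h2 : 0 < |⟪w, q - p⟫| := by
      rw [← h1]
      exact mul_pos h.diam_pos (h.norm.pos w hw0)
    rcases lt_or_gt_of_ne (abs_pos.1 h2) with h3 | h3
    · exact ⟨-1, by norm_num, by simpa using h3⟩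
    · exact ⟨1, by norm_num, by simpa using h3⟩
  set ω := ⟪σ • w, q - p⟫ with hω
  obtain ⟨ρ, hρ, hnear⟩ : ∃ ρ > 0, ∀ y ∈ closure S, dist y p < ρ →
      F (G y - w) ^ 2 < F w ^ 2 / 8 ∧ F w ^ 2 / 2 < F (G y) ^ 2 := by
    have c1 : ContinuousWithinAt (fun y => F (G y - w) ^ 2) (closure S) p :=
      ((h.norm.continuous.comp_continuousOn (h.grad_cont.sub continuousOn_const)).pow 2) p hpS
    have c2 := h.continuousOn_F p hpS
    have e1 := c1.eventually (gt_mem_nhds (show F (G p - w) ^ 2 < F w ^ 2 / 8 by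
      simp [← hw, h.norm.map_zero, h.norm.pos w hw0]))
    have e2 := c2.eventually (lt_mem_nhds (half_lt_self hA))
    have := e1.and e2
    rw [Metric.nhdsWithin_basis_ball.eventually_iff] at this
    obtain ⟨r, hr, h1⟩ := this
    exact ⟨r, hr, fun y hy hd => h1 ⟨hd, hy⟩⟩
  obtain ⟨M, hM⟩ := h.bounded.isCompact_closure.exists_bound_of_continuousOn h.continuousOn
  have hM0 : 0 ≤ M := (norm_nonneg _).trans (hM p hpS)
  set c := π ^ 2 / d ^ 2 with hc
  have hc0 : 0 < c := by
    have := h.diam_pos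
    positivity
  obtain ⟨r, hr, hr1, hr2⟩ : ∃ r > 0, r * (‖q - p‖ + 1) ≤ ρ * ω ∧
      r * (16 * c * (M + 1)) ≤ F w ^ 2 := by
    have h1 : 0 < ‖q - p‖ + 1 := by positivity
    have h2 : 0 < 16 * c * (M + 1) := by positivity
    exact ⟨min (ρ * ω / (‖q - p‖ + 1)) (F w ^ 2 / (16 * c * (M + 1))), by positivity,
      (le_div_iff₀ h1).1 (min_le_left _ _), (le_div_iff₀ h2).1 (min_le_right _ _)⟩
  set s : EuclideanSpace ℝ (Fin n) → ℝ := fun y => ⟪σ • w, y - p⟫ with hs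
  have hsc : Continuous s := by fun_prop
  have hseg : ∀ y ∈ segment ℝ p q, -s y < r ∧ min (dist y p - ρ) (r - s y) < 0 := by
    intro y hy
    rw [segment_eq_image'] at hy
    obtain ⟨θ, ⟨hθ0, hθ1⟩, rfl⟩ := hy
    have hsy : s (p + θ • (q - p)) = θ * ω := by
      simp only [hs]
      rw [add_sub_cancel_left, real_inner_smul_right]
    have hdy : dist (p + θ • (q - p)) p = θ * ‖q - p‖ := by
      rw [dist_eq_norm, add_sub_cancel_left, norm_smul, Real.norm_eq_abs, abs_of_nonneg hθ0]
    rw [hsy, hdy]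
    refine ⟨by nlinarith [mul_nonneg hθ0 hσw.le], ?_⟩
    rw [min_lt_iff]
    rcases le_or_gt (θ * ω) r with h1 | h1
    · left
      have h2 : θ * ‖q - p‖ * ω ≤ r * ‖q - p‖ := by nlinarith [norm_nonneg (q - p)]
      have h3 : θ * ‖q - p‖ * ω < ρ * ω := by linarith
      linarith [lt_of_mul_lt_mul_right h3 hσw.le]
    · right
      linarith
  obtain ⟨k, hk1, hk2⟩ := ((hK.eventually_lt h.bounded hsc.neg.continuousOn
    fun y hy => (hseg y hy).1).and (hK.eventually_lt h.bounded
      (f := fun y => min (dist y p - ρ) (r - s y)) (by fun_prop)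
      fun y hy => (hseg y hy).2)).exists
  set P : EuclideanSpace ℝ (Fin n) → ℝ := fun y => max (r - s y) 0 with hP
  have hPc : Continuous P := by fun_prop
  have hP0 : ∀ y, 0 ≤ P y := fun y => le_max_right _ _
  have hKcl : ∀ y ∈ K k, y ∈ closure S := fun y hy => subset_closure (hK.subset k hy)
  have hnn := hK.perturbation_nonneg h (ψ := fun y => σ / (4 * r) * P y ^ 2)
    (H := fun y => -((P y / (2 * r)) • w)) (by fun_prop) (fun y _ => by
      rw [hasGradientAt_iff_hasFDerivAt]
      have h1 : HasFDerivAt (fun y => r - s y)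
          (-(InnerProductSpace.toDual ℝ _ (σ • w))) y := by
        have h2 : HasFDerivAt (fun y => ⟪σ • w, y - p⟫)
            (InnerProductSpace.toDual ℝ _ (σ • w)) y :=
          (InnerProductSpace.toDual ℝ _ (σ • w)).hasFDerivAt.comp y
            ((hasFDerivAt_id y).sub_const p)
        exact h2.const_sub r
      have h3 := ((hasDerivAt_max_zero_sq (r - s y)).comp_hasFDerivAt y h1).const_mul
        (σ / (4 * r))
      refine h3.congr_fderiv ?_
      ext v
      simp only [_root_.smul_apply, _root_.neg_apply,
        InnerProductSpace.toDual_apply_apply, inner_neg_left, real_inner_smul_left, smul_eq_mul]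
      change σ / (4 * r) * (2 * P y * -(σ * ⟪w, v⟫)) = _
      field_simp
      linear_combination (-4 * P y * ⟪w, v⟫) * hσ) k
  have hcP : ContinuousOn (fun y => F w ^ 2 / 8 * (P y / r)) (closure S) := by fun_prop
  have hmono : ∫ y in K k, (F (G y + -((P y / (2 * r)) • w)) ^ 2 - F (G y) ^ 2 -
      2 * c * (u y * (σ / (4 * r) * P y ^ 2))) ≤ ∫ y in K k, -(F w ^ 2 / 8 * (P y / r)) := by
    have hHc : ContinuousOn (fun y => F (G y + -((P y / (2 * r)) • w)) ^ 2) (closure S) :=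
      (h.norm.continuous.comp_continuousOn (h.grad_cont.add (by fun_prop))).pow 2
    have huc := h.continuousOn
    refine setIntegral_mono_on (h.integrableOn ((hHc.sub h.continuousOn_F).sub (by fun_prop))
      (hK.subset k)) (h.integrableOn hcP.neg (hK.subset k)) (hK.isOpen k).measurableSet
      fun y hy => ?_
    have h1 := hk1 y (subset_closure hy)
    have h2 := hk2 y (subset_closure hy)
    have hPr : P y ≤ 2 * r := max_le (by simp only [Pi.neg_apply] at h1; linarith) (by linarith)
    have hτ0 : 0 ≤ P y / (2 * r) := div_nonneg (hP0 y) (by linarith)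
    have hτ1 : P y / (2 * r) ≤ 1 := (div_le_one (by linarith)).2 hPr
    have h3 := h.norm.sub_smul_sq_le (G y) w hτ0 hτ1
    rw [← sub_eq_add_neg]
    rcases (hP0 y).eq_or_lt with h4 | h4
    · rw [← h4]
      simp
    have h5 : dist y p < ρ := by
      have h6 : 0 < r - s y := by
        by_contra! h7
        exact h4.ne' (max_eq_right h7)
      rcases min_lt_iff.1 h2 with h7 | h7
      · linarith
      · linarith
    obtain ⟨h6, h7⟩ := hnear y (hKcl y hy) h5
    have h8 : -(c * (σ * u y) * P y) ≤ F w ^ 2 / 8 := by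
      have hσ1 : |σ| = 1 := by
        rw [← abs_one, ← sq_eq_sq_iff_abs_eq_abs, hσ, one_pow]
      have h9 : -(σ * u y) ≤ M := by
        refine (neg_le_abs _).trans ?_
        rw [abs_mul, hσ1, one_mul]
        exact hM y (hKcl y hy)
      have h10 : -(σ * u y) * P y ≤ M * (2 * r) :=
        (mul_le_mul_of_nonneg_right h9 (hP0 y)).trans (mul_le_mul_of_nonneg_left hPr hM0)
      have h11 := mul_le_mul_of_nonneg_left h10 hc0.le
      have h12 : 0 ≤ r * c := by positivity
      nlinarith
    have h13 : P y / (2 * r) * (F (G y - w) ^ 2 - F (G y) ^ 2 - c * (σ * u y) * P y) ≤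
        P y / (2 * r) * (-(F w ^ 2 / 4)) := mul_le_mul_of_nonneg_left (by linarith) hτ0
    have h14 : P y / (2 * r) * (c * (σ * u y) * P y) =
        2 * c * (u y * (σ / (4 * r) * P y ^ 2)) := by
      field_simp
      ring
    have h15 : P y / (2 * r) * (-(F w ^ 2 / 4)) = -(F w ^ 2 / 8 * (P y / r)) := by
      field_simp
      ring
    rw [mul_sub, h14, h15] at h13
    linarith
  rw [integral_neg] at hmono
  have hpos : 0 < ∫ y in K k, F w ^ 2 / 8 * (P y / r) := by
    rw [setIntegral_pos_iff_support_of_nonneg_ae (Filter.Eventually.of_forall fun y => by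
      have := hP0 y
      simp only [Pi.zero_apply]
      positivity) (h.integrableOn hcP (hK.subset k))]
    have hpk : p ∈ closure (K k) := hK.segment_subset k (left_mem_segment ℝ p q)
    have hPp : 0 < P p := by
      simp [hP, hs, hr]
    have ho : IsOpen {y | 0 < P y} := isOpen_lt continuous_const hPc
    refine ((ho.inter (hK.isOpen k)).measure_pos volume
      (_root_.mem_closure_iff.1 hpk _ ho hPp)).trans_le (measure_mono ?_)
    rintro y ⟨hy1, hy2⟩
    have hy1 : 0 < P y := hy1
    exact ⟨by rw [Function.mem_support]; positivity, hy2⟩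
  linarith

end IsExtremal.IsNeedle

/-- At boundary points where `u` does not vanish, its gradient vanishes. -/
theorem IsExtremal.grad_eq_zero_of_mem_frontier {n : ℕ} {S : Set (EuclideanSpace ℝ (Fin n))}
    {F : EuclideanSpace ℝ (Fin n) → ℝ} {u : EuclideanSpace ℝ (Fin n) → ℝ}
    {G : EuclideanSpace ℝ (Fin n) → EuclideanSpace ℝ (Fin n)} {d : ℝ}
    (h : IsExtremal S F u G d) (hS : HasSmoothBoundary S) {p : EuclideanSpace ℝ (Fin n)}
    (hp : p ∈ frontier S) (hup : u p ≠ 0) : G p = 0 := by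
  obtain ⟨K, a, b, hK, hpab⟩ := h.exists_isNeedle (frontier_subset_closure hp)
  rcases hK.eq_left_or_eq_right h hS hpab hp hup with rfl | rfl
  · exact hK.grad_left_eq_zero h
  · exact hK.symm.grad_left_eq_zero h

/-- The radial projection onto the boundary of a convex neighbourhood of the origin is locally
Lipschitz. -/
theorem isBigO_inv_gauge_smul_sub {E : Type*} [NormedAddCommGroup E] [NormedSpace ℝ E] {T : Set E}
    (hT : Convex ℝ T) (hT0 : T ∈ nhds 0) {v : E} (hv : gauge T v ≠ 0) :
    (fun y => (gauge T y)⁻¹ • y - (gauge T v)⁻¹ • v) =O[nhds v] fun y => y - v := by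
  obtain ⟨L, hL⟩ := hT.lipschitz_gauge hT0
  have hcont : ContinuousAt (fun y => (gauge T y)⁻¹) v := hL.continuous.continuousAt.inv₀ hv
  have h1 : (fun y => (gauge T y)⁻¹ • (y - v)) =O[nhds v] fun y => y - v := by
    simpa using (hcont.tendsto.isBigO_one ℝ).smul (Asymptotics.isBigO_refl (fun y => y - v) (nhds v))
  have h2 : (fun y => ((gauge T y)⁻¹ - (gauge T v)⁻¹) • v) =O[nhds v] fun y => y - v := by
    have h3 : (fun y => gauge T v - gauge T y) =O[nhds v] fun y => y - v := by
      refine Asymptotics.IsBigO.of_bound L (Filter.Eventually.of_forall fun y => ?_)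
      have := hL.dist_le_mul v y
      rwa [Real.dist_eq, dist_eq_norm, norm_sub_rev v y] at this
    have h4 : (fun y => (gauge T y)⁻¹ - (gauge T v)⁻¹) =O[nhds v] fun y => y - v := by
      have h5 : (fun y => (gauge T y)⁻¹ * (gauge T v)⁻¹ * (gauge T v - gauge T y)) =O[nhds v]
          fun y => ‖y - v‖ := by
        simpa using ((hcont.mul_const _).tendsto.isBigO_one ℝ).mul h3.norm_right
      refine (h5.congr' ?_ Filter.EventuallyEq.rfl).of_norm_right
      filter_upwards [hL.continuous.continuousAt.eventually_ne hv] with y hy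
      field_simp
    have h6 : (fun y => ((gauge T y)⁻¹ - (gauge T v)⁻¹) • v) =O[nhds v]
        fun y => ‖y - v‖ • (1 : ℝ) :=
      h4.norm_right.smul (Asymptotics.isBigO_const_const v one_ne_zero _)
    simpa using h6
  refine (h1.add h2).congr_left fun y => ?_
  rw [smul_sub, sub_smul]
  abel

/-- A function whose derivative vanishes at all boundary points of a bounded convex set of
dimension at least two is constant on the boundary. -/
theorem Convex.eq_of_hasFDerivAt_zero_frontier {n : ℕ} (hn : 2 ≤ n)
    {S : Set (EuclideanSpace ℝ (Fin n))} (hSc : Convex ℝ S) (hSo : IsOpen S)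
    (hSb : Bornology.IsBounded S) (hSn : S.Nonempty) {f : EuclideanSpace ℝ (Fin n) → ℝ}
    (hf : ∀ p ∈ frontier S, HasFDerivAt f (0 : EuclideanSpace ℝ (Fin n) →L[ℝ] ℝ) p)
    {p q : EuclideanSpace ℝ (Fin n)} (hp : p ∈ frontier S) (hq : q ∈ frontier S) : f p = f q := by
  obtain ⟨o, ho⟩ := hSn
  set e := Homeomorph.addLeft o with he
  set T := e ⁻¹' S with hT
  have hTc : Convex ℝ T := hSc.translate_preimage_right o
  have hTo : T ∈ nhds 0 := (hSo.preimage e.continuous).mem_nhds (by simpa [he] using ho)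
  have hTb : Bornology.IsVonNBounded ℝ T := by
    rw [NormedSpace.isVonNBounded_iff]
    have := hSb.vadd (-o)
    refine this.subset fun y hy => ?_
    rw [Set.mem_vadd_set]
    exact ⟨o + y, hy, by simp⟩
  have hfr : ∀ y, o + y ∈ frontier S ↔ gauge T y = 1 := by
    intro y
    rw [gauge_eq_one_iff_mem_frontier hTc hTo, hT, ← e.preimage_frontier]
    rfl
  have hpos : ∀ v : EuclideanSpace ℝ (Fin n), v ≠ 0 → 0 < gauge T v := fun v hv =>
    (gauge_pos (absorbent_nhds_zero hTo) hTb).2 hv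
  set R : EuclideanSpace ℝ (Fin n) → EuclideanSpace ℝ (Fin n) :=
    fun v => o + (gauge T v)⁻¹ • v with hR
  have hRf : ∀ v ≠ 0, R v ∈ frontier S := by
    intro v hv
    have := hpos v hv
    rw [hR, hfr, gauge_smul_of_nonneg (inv_pos.2 this).le, smul_eq_mul, inv_mul_cancel₀ this.ne']
  have hRd : ∀ v ≠ 0, HasFDerivAt (f ∘ R) (0 : EuclideanSpace ℝ (Fin n) →L[ℝ] ℝ) v := by
    intro v hv
    have hO : (fun y => R y - R v) =O[nhds v] fun y => y - v := by
      simpa [hR] using isBigO_inv_gauge_smul_sub hTc hTo (hpos v hv).ne'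
    have hcont : Filter.Tendsto R (nhds v) (nhds (R v)) := by
      refine tendsto_sub_nhds_zero_iff.1 (hO.trans_tendsto ?_)
      exact tendsto_sub_nhds_zero_iff.2 Filter.tendsto_id
    have h1 := (hasFDerivAt_iff_isLittleO.1 (hf _ (hRf v hv))).comp_tendsto hcont
    rw [hasFDerivAt_iff_isLittleO]
    exact h1.trans_isBigO hO
  have hconn : IsPreconnected ({0}ᶜ : Set (EuclideanSpace ℝ (Fin n))) := by
    refine (isConnected_compl_singleton_of_one_lt_rank ?_ 0).isPreconnected
    rw [← Module.finrank_eq_rank, finrank_euclideanSpace_fin]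
    exact_mod_cast hn
  have hkey : ∀ y ∈ frontier S, y - o ≠ 0 ∧ R (y - o) = y := by
    intro y hy
    have h1 : gauge T (y - o) = 1 := (hfr _).1 (by simpa using hy)
    refine ⟨fun h0 => ?_, by simp [hR, h1]⟩
    rw [h0, gauge_zero] at h1
    exact zero_ne_one h1
  have := isOpen_compl_singleton.is_const_of_fderiv_eq_zero (𝕜 := ℝ) hconn
    (fun v hv => (hRd v hv).differentiableAt.differentiableWithinAt)
    (fun v hv => (hRd v hv).fderiv) (hkey p hp).1 (hkey q hq).1
  simpa only [Function.comp_apply, (hkey p hp).2, (hkey q hq).2] using this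

theorem IsExtremal.exists_const_on_frontier {n : ℕ} (hn : 2 ≤ n)
    {S : Set (EuclideanSpace ℝ (Fin n))} {F : EuclideanSpace ℝ (Fin n) → ℝ}
    {u : EuclideanSpace ℝ (Fin n) → ℝ} {G : EuclideanSpace ℝ (Fin n) → EuclideanSpace ℝ (Fin n)}
    {d : ℝ} (h : IsExtremal S F u G d) (hS : HasSmoothBoundary S) :
    ∃ c, ∀ p ∈ frontier S, u p = c := by
  rcases (frontier S).eq_empty_or_nonempty with he | ⟨q, hq⟩
  · exact ⟨0, by simp [he]⟩
  refine ⟨u q, fun p hp => Odd.strictMono_pow (by decide : Odd 3) |>.injective ?_⟩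
  refine h.convex.eq_of_hasFDerivAt_zero_frontier hn h.isOpen h.bounded h.nonempty
    (f := fun y => u y ^ 3) (fun y hy => ?_) hp hq
  refine ((h.hasGradientAt y (frontier_subset_closure hy)).hasFDerivAt.pow 3).congr_fderiv ?_
  rcases eq_or_ne (u y) 0 with h0 | h0
  · simp [h0]
  · simp [h.grad_eq_zero_of_mem_frontier hS hy h0]

/-- The integral over a bounded open set of a directional derivative of `T * g ^ 2` vanishes when
`g` vanishes on the boundary. -/
theorem setIntegral_hasFDerivAt_mul_sq_eq_zero {n : ℕ} {S : Set (EuclideanSpace ℝ (Fin n))}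
    (hSo : IsOpen S) (hSb : Bornology.IsBounded S) {T g : EuclideanSpace ℝ (Fin n) → ℝ}
    {T' g' : EuclideanSpace ℝ (Fin n) → EuclideanSpace ℝ (Fin n) →L[ℝ] ℝ}
    (hT : ∀ y ∈ closure S, HasFDerivAt T (T' y) y) (hT' : ContinuousOn T' (closure S))
    (hg : ∀ y ∈ closure S, HasFDerivAt g (g' y) y) (hg' : ContinuousOn g' (closure S))
    (hg0 : ∀ y ∈ frontier S, g y = 0) (e : EuclideanSpace ℝ (Fin n)) :
    ∫ y in S, (T' y e * g y ^ 2 + T y * (2 * g y * g' y e)) = 0 := by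
  have hTc : ContinuousOn T (closure S) := fun y hy => (hT y hy).continuousAt.continuousWithinAt
  have hgc : ContinuousOn g (closure S) := fun y hy => (hg y hy).continuousAt.continuousWithinAt
  set ψ : EuclideanSpace ℝ (Fin n) → ℝ := S.indicator fun y => T y * g y ^ 2 with hψ
  set ψ' : EuclideanSpace ℝ (Fin n) → ℝ :=
    S.indicator fun y => T' y e * g y ^ 2 + T y * (2 * g y * g' y e) with hψ'
  have hint : ∀ {f : EuclideanSpace ℝ (Fin n) → ℝ}, ContinuousOn f (closure S) →
      Integrable (S.indicator f) := fun hf =>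
    ((hf.integrableOn_compact hSb.isCompact_closure).mono_set subset_closure).integrable_indicator
      hSo.measurableSet
  have hi : Integrable ψ := hint (hTc.mul (hgc.pow 2))
  have hi' : Integrable ψ' := hint (by fun_prop)
  have hd : ∀ y, HasLineDerivAt ℝ ψ (ψ' y) y e := by
    intro y
    by_cases hyS : y ∈ S
    · have hyc := subset_closure hyS
      have h2 : ψ =ᶠ[nhds y] fun y => T y * g y ^ 2 := by
        filter_upwards [hSo.mem_nhds hyS] with z hz
        rw [hψ, Set.indicator_of_mem hz]
      have h3 : ψ' y = T' y e * g y ^ 2 + T y * (2 * g y * g' y e) := by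
        rw [hψ', Set.indicator_of_mem hyS]
      rw [h3]
      have h4 := HasFDerivAt.congr_of_eventuallyEq ((hT y hyc).mul ((hg y hyc).pow 2)) h2
      have h5 : T' y e * g y ^ 2 + T y * (2 * g y * g' y e) =
          (T y • (2 • g y ^ (2 - 1)) • g' y + g y ^ 2 • T' y) e := by
        simp
        ring
      rw [h5]
      exact h4.hasLineDerivAt e
    · have h3 : ψ' y = (0 : EuclideanSpace ℝ (Fin n) →L[ℝ] ℝ) e := by
        rw [hψ', Set.indicator_of_notMem hyS]
        simp
      rw [h3]
      refine HasFDerivAt.hasLineDerivAt ?_ e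
      by_cases hyc : y ∈ closure S
      · have hyf : y ∈ frontier S := by
          rw [hSo.frontier_eq]
          exact ⟨hyc, hyS⟩
        rw [hasFDerivAt_iff_isLittleO]
        have h1 : (fun z => g z) =O[nhds y] fun z => z - y := by
          simpa [hg0 y hyf] using (hg y hyc).isBigO_sub
        have h2 : (fun z => g z) =o[nhds y] fun _ => (1 : ℝ) := by
          rw [Asymptotics.isLittleO_one_iff]
          simpa [hg0 y hyf] using (hg y hyc).continuousAt.tendsto
        have h4 : (fun z => T z * (g z * g z)) =o[nhds y] fun z => ‖z - y‖ := by
          simpa using ((hT y hyc).continuousAt.tendsto.isBigO_one ℝ).mul_isLittleO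
            (h2.mul_isBigO h1.norm_right)
        refine (Asymptotics.IsBigO.trans_isLittleO ?_ h4).of_norm_right
        refine Asymptotics.isBigO_of_le _ fun z => ?_
        simp only [_root_.zero_apply, sub_zero]
        rw [hψ, Set.indicator_of_notMem hyS, sub_zero, ← sq]
        exact norm_indicator_le_norm_self _ z
      · have h2 : ψ =ᶠ[nhds y] fun _ => 0 := by
          filter_upwards [isClosed_closure.isOpen_compl.mem_nhds hyc] with z hz
          rw [hψ, Set.indicator_of_notMem fun hzS => hz (subset_closure hzS)]
        exact (hasFDerivAt_const (0 : ℝ) y).congr_of_eventuallyEq h2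
  have := integral_bilinear_hasLineDerivAt_right_eq_neg_left_of_integrable (μ := volume)
    (f := fun _ => (1 : ℝ)) (f' := fun _ => (0 : ℝ)) (g := ψ) (g' := ψ') (v := e)
    (B := ContinuousLinearMap.mul ℝ ℝ) (by simp) (by simpa using hi') (by simpa using hi)
    (fun y _ => (hasFDerivAt_const (1 : ℝ) y).hasLineDerivAt e) (fun y _ => hd y)
  simp only [ContinuousLinearMap.mul_apply', one_mul, zero_mul, integral_zero, neg_zero] at this
  rwa [hψ', integral_indicator hSo.measurableSet] at this

/-- The Dirichlet Poincaré inequality for a directional derivative on a set of width at most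
`d`. -/
theorem dirichlet_poincare_direction {n : ℕ} {S : Set (EuclideanSpace ℝ (Fin n))}
    (hSo : IsOpen S) (hSb : Bornology.IsBounded S) (hSn : S.Nonempty)
    {g : EuclideanSpace ℝ (Fin n) → ℝ}
    {G : EuclideanSpace ℝ (Fin n) → EuclideanSpace ℝ (Fin n)}
    (hG : ContinuousOn G (closure S)) (hg : ∀ y ∈ closure S, HasGradientAt g (G y) y)
    (hg0 : ∀ y ∈ frontier S, g y = 0) {ν e : EuclideanSpace ℝ (Fin n)} (hνe : ⟪ν, e⟫ = 1)
    {d : ℝ} (hd : 0 < d) (hwidth : ∀ x ∈ closure S, ∀ y ∈ closure S, ⟪ν, y - x⟫ ≤ d) :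
    π ^ 2 / d ^ 2 * ∫ y in S, g y ^ 2 ≤ ∫ y in S, ⟪G y, e⟫ ^ 2 := by
  have hgc : ContinuousOn g (closure S) := fun y hy => (hg y hy).continuousAt.continuousWithinAt
  have hint : ∀ {f : EuclideanSpace ℝ (Fin n) → ℝ}, ContinuousOn f (closure S) →
      IntegrableOn f S := fun hf =>
    (hf.integrableOn_compact hSb.isCompact_closure).mono_set subset_closure
  have hνc : Continuous fun y : EuclideanSpace ℝ (Fin n) => ⟪ν, y⟫ := by fun_prop
  obtain ⟨x₁, hx₁, hmin⟩ := hSb.isCompact_closure.exists_isMinOn hSn.closure hνc.continuousOn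
  obtain ⟨x₂, hx₂, hmax⟩ := hSb.isCompact_closure.exists_isMaxOn hSn.closure hνc.continuousOn
  set m := (⟪ν, x₁⟫ + ⟪ν, x₂⟫) / 2 with hm
  have hmid : ∀ y ∈ closure S, |⟪ν, y⟫ - m| ≤ d / 2 := by
    intro y hy
    have h1 : ⟪ν, x₁⟫ ≤ ⟪ν, y⟫ := hmin hy
    have h2 : ⟪ν, y⟫ ≤ ⟪ν, x₂⟫ := hmax hy
    have h3 := hwidth x₁ hx₁ x₂ hx₂
    rw [inner_sub_right] at h3
    rw [abs_le]
    constructor <;> linarith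
  have hkey : ∀ κ, 0 < κ → κ < π / d →
      κ ^ 2 * ∫ y in S, g y ^ 2 ≤ ∫ y in S, ⟪G y, e⟫ ^ 2 := by
    intro κ hκ0 hκ
    rw [lt_div_iff₀ hd] at hκ
    set θ : EuclideanSpace ℝ (Fin n) → ℝ := fun y => κ * (⟪ν, y⟫ - m) with hθ
    have hcos : ∀ y ∈ closure S, cos (θ y) ≠ 0 := by
      intro y hy
      have h1 : |θ y| ≤ κ * (d / 2) := by
        rw [hθ, abs_mul, abs_of_pos hκ0]
        exact mul_le_mul_of_nonneg_left (hmid y hy) hκ0.le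
      rw [abs_le] at h1
      exact (cos_pos_of_mem_Ioo ⟨by linarith, by linarith⟩).ne'
    set T : EuclideanSpace ℝ (Fin n) → ℝ := fun y => κ * tan (θ y) with hT
    have hθd : ∀ y, HasFDerivAt θ (κ • InnerProductSpace.toDual ℝ _ ν) y := fun y =>
      (((InnerProductSpace.toDual ℝ _ ν).hasFDerivAt).sub_const m).const_mul κ
    have hTd : ∀ y ∈ closure S, HasFDerivAt T
        (κ • (1 / cos (θ y) ^ 2) • κ • InnerProductSpace.toDual ℝ _ ν) y := fun y hy =>
      ((hasDerivAt_tan (hcos y hy)).comp_hasFDerivAt y (hθd y)).const_mul κ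
    have hTc : ContinuousOn T (closure S) := fun y hy =>
      (hTd y hy).continuousAt.continuousWithinAt
    have hθc : Continuous θ := by fun_prop
    have hz := setIntegral_hasFDerivAt_mul_sq_eq_zero hSo hSb hTd (by
        have : ContinuousOn (fun y => 1 / cos (θ y) ^ 2) (closure S) :=
          continuousOn_const.div ((continuous_cos.comp hθc).pow 2).continuousOn
            fun y hy => pow_ne_zero 2 (hcos y hy)
        exact (this.smul continuousOn_const).const_smul κ)
      (fun y hy => (hg y hy).hasFDerivAt)
      ((InnerProductSpace.toDual ℝ _).continuous.comp_continuousOn hG) hg0 e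
    have hGe : ContinuousOn (fun y => ⟪G y, e⟫) (closure S) := hG.inner continuousOn_const
    have hrw : ∀ y ∈ S, ((κ • (1 / cos (θ y) ^ 2) • κ •
          InnerProductSpace.toDual ℝ _ ν : EuclideanSpace ℝ (Fin n) →L[ℝ] ℝ) e * g y ^ 2 +
          T y * (2 * g y * (InnerProductSpace.toDual ℝ _ (G y)) e)) =
        κ ^ 2 * g y ^ 2 - ⟪G y, e⟫ ^ 2 + (T y * g y + ⟪G y, e⟫) ^ 2 := by
      intro y hy
      have h1 : 1 / cos (θ y) ^ 2 = 1 + tan (θ y) ^ 2 := by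
        rw [tan_eq_sin_div_cos]
        have := hcos y (subset_closure hy)
        field_simp
        rw [cos_sq_add_sin_sq]
      rw [h1]
      simp only [_root_.smul_apply, InnerProductSpace.toDual_apply_apply, hνe, smul_eq_mul, hT]
      ring
    rw [setIntegral_congr_fun hSo.measurableSet hrw] at hz
    have i1 : IntegrableOn (fun y => κ ^ 2 * g y ^ 2) S := (hint (hgc.pow 2)).const_mul _
    have i2 : IntegrableOn (fun y => ⟪G y, e⟫ ^ 2) S := hint (hGe.pow 2)
    have i3 : IntegrableOn (fun y => (T y * g y + ⟪G y, e⟫) ^ 2) S :=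
      hint (((hTc.mul hgc).add hGe).pow 2)
    have i4 : IntegrableOn (fun y => κ ^ 2 * g y ^ 2 - ⟪G y, e⟫ ^ 2) S := i1.sub i2
    rw [integral_add i4 i3, integral_sub i1 i2, integral_const_mul] at hz
    have : 0 ≤ ∫ y in S, (T y * g y + ⟪G y, e⟫) ^ 2 := integral_nonneg fun y => sq_nonneg _
    linarith
  have hlim : Filter.Tendsto (fun κ : ℝ => κ ^ 2 * ∫ y in S, g y ^ 2)
      (nhdsWithin (π / d) (Set.Iio (π / d))) (nhds ((π / d) ^ 2 * ∫ y in S, g y ^ 2)) :=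
    ((by fun_prop : Continuous fun κ : ℝ => κ ^ 2 * ∫ y in S, g y ^ 2).tendsto _).mono_left
      nhdsWithin_le_nhds
  rw [← div_pow]
  refine le_of_tendsto hlim ?_
  filter_upwards [self_mem_nhdsWithin,
    (lt_mem_nhds (div_pos pi_pos hd)).filter_mono nhdsWithin_le_nhds] with κ h1 h2
  exact hkey κ h2 h1

namespace IsMinkowskiNorm

variable {n : ℕ} {F : EuclideanSpace ℝ (Fin n) → ℝ} {ξ : EuclideanSpace ℝ (Fin n)}

theorem hasGradientAt (hF : IsMinkowskiNorm F) (hξ : ξ ≠ 0) : HasGradientAt F (gradient F ξ) ξ :=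
  ((hF.contDiffOn.differentiableOn one_ne_zero).differentiableAt
    (isOpen_compl_singleton.mem_nhds hξ)).hasGradientAt

theorem hasDerivAt_add_smul (hF : IsMinkowskiNorm F) (hξ : ξ ≠ 0)
    (η : EuclideanSpace ℝ (Fin n)) :
    HasDerivAt (fun t : ℝ => F (ξ + t • η)) ⟪gradient F ξ, η⟫ 0 := by
  have := ((hF.hasGradientAt hξ).hasFDerivAt).hasLineDerivAt η
  rwa [InnerProductSpace.toDual_apply_apply] at this

/-- Euler's identity. -/
theorem inner_gradient_self (hF : IsMinkowskiNorm F) (hξ : ξ ≠ 0) : ⟪gradient F ξ, ξ⟫ = F ξ := by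
  have h1 : HasDerivAt (fun t : ℝ => (1 + t) * F ξ) (F ξ) 0 := by
    simpa using ((hasDerivAt_id (0 : ℝ)).const_add 1).mul_const (F ξ)
  refine (hF.hasDerivAt_add_smul hξ ξ).unique (h1.congr_of_eventuallyEq ?_)
  filter_upwards [lt_mem_nhds (show (-1 : ℝ) < 0 by norm_num)] with t ht
  have : ξ + t • ξ = (1 + t) • ξ := by rw [add_smul, one_smul]
  rw [this, hF.homog, abs_of_pos (by linarith)]

theorem abs_inner_gradient_le (hF : IsMinkowskiNorm F) (hξ : ξ ≠ 0)
    (η : EuclideanSpace ℝ (Fin n)) : |⟪gradient F ξ, η⟫| ≤ F η := by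
  have hle : ∀ η, ⟪gradient F ξ, η⟫ ≤ F η := by
    intro η
    have h1 := (hasDerivAt_iff_tendsto_slope_zero.1 (hF.hasDerivAt_add_smul hξ η)).mono_left
      (nhdsWithin_mono (s := Set.Ioi 0) (0 : ℝ) fun x hx => ne_of_gt hx)
    refine le_of_tendsto h1 ?_
    filter_upwards [self_mem_nhdsWithin] with t (ht : 0 < t)
    have h2 := hF.add_le ξ (t • η)
    rw [hF.homog, abs_of_pos ht] at h2
    rw [smul_eq_mul, inv_mul_le_iff₀ ht]
    simp only [zero_add, zero_smul, add_zero]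
    linarith
  rw [abs_le]
  refine ⟨?_, hle η⟩
  have := hle (-η)
  rw [inner_neg_right, hF.even] at this
  linarith

/-- In dimension at least two no direction norms every covector. -/
theorem exists_norming_lt (hF : IsMinkowskiNorm F) (hn : 2 ≤ n) {w : EuclideanSpace ℝ (Fin n)}
    (hw : w ≠ 0) : ∃ ν e : EuclideanSpace ℝ (Fin n), F ν = 1 ∧ ⟪ν, e⟫ = 1 ∧
      (∀ η, |⟪η, e⟫| ≤ F η) ∧ |⟪w, e⟫| < F w := by
  have hker : LinearMap.ker (InnerProductSpace.toDual ℝ _ (gradient F w)).toLinearMap ≠ ⊥ :=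
    LinearMap.ker_ne_bot_of_finrank_lt (by
      rw [Module.finrank_self, finrank_euclideanSpace_fin]
      omega)
  obtain ⟨ξ, hξ, hξ0⟩ := Submodule.exists_mem_ne_zero_of_ne_bot hker
  have hξ : ⟪gradient F w, ξ⟫ = 0 := hξ
  have hFξ := hF.pos ξ hξ0
  have habs : ∀ η, |⟪η, gradient F ξ⟫| ≤ F η := fun η => by
    rw [real_inner_comm]
    exact hF.abs_inner_gradient_le hξ0 η
  have hself : ⟪ξ, gradient F ξ⟫ = F ξ := by
    rw [real_inner_comm]
    exact hF.inner_gradient_self hξ0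
  refine ⟨(F ξ)⁻¹ • ξ, gradient F ξ, ?_, ?_, habs, ?_⟩
  · rw [hF.homog, abs_of_pos (inv_pos.2 hFξ), inv_mul_cancel₀ hFξ.ne']
  · rw [real_inner_smul_left, hself, inv_mul_cancel₀ hFξ.ne']
  · refine lt_of_le_of_ne (habs w) fun heq => ?_
    obtain ⟨σ, hσ, hσw⟩ : ∃ σ : ℝ, |σ| = 1 ∧ |⟪w, gradient F ξ⟫| = σ * ⟪w, gradient F ξ⟫ := by
      rcases abs_choice ⟪w, gradient F ξ⟫ with h | h
      · exact ⟨1, by simp, by rw [one_mul, h]⟩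
      · exact ⟨-1, by simp, by rw [neg_one_mul, h]⟩
    have hmin : IsLocalMin (fun t : ℝ => F (w + t • ξ) - σ * ⟪w + t • ξ, gradient F ξ⟫) 0 := by
      refine Filter.Eventually.of_forall fun t => ?_
      simp only [zero_smul, add_zero]
      rw [← hσw, heq, sub_self, sub_nonneg]
      calc _ ≤ |σ * ⟪w + t • ξ, gradient F ξ⟫| := le_abs_self _
        _ = |⟪w + t • ξ, gradient F ξ⟫| := by rw [abs_mul, hσ, one_mul]
        _ ≤ _ := habs _
    have hder : HasDerivAt (fun t : ℝ => F (w + t • ξ) - σ * ⟪w + t • ξ, gradient F ξ⟫)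
        (0 - σ * F ξ) 0 := by
      have h1 := hF.hasDerivAt_add_smul hw ξ
      rw [hξ] at h1
      refine h1.sub (HasDerivAt.const_mul σ ?_)
      have h2 : HasDerivAt (fun t : ℝ => ⟪w, gradient F ξ⟫ + t * F ξ) (F ξ) 0 := by
        simpa using ((hasDerivAt_id (0 : ℝ)).mul_const (F ξ)).const_add ⟪w, gradient F ξ⟫
      refine h2.congr_of_eventuallyEq (Filter.Eventually.of_forall fun t => ?_)
      simp only [inner_add_left, real_inner_smul_left, hself]
    have h0 := hmin.hasDerivAt_eq_zero hder
    rw [zero_sub, neg_eq_zero, mul_eq_zero] at h0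
    rcases h0 with h0 | h0
    · simp [h0] at hσ
    · exact hFξ.ne' h0

theorem dualNorm_set_bddAbove (hF : IsMinkowskiNorm F) (x : EuclideanSpace ℝ (Fin n)) {c : ℝ}
    (hc : 0 < c) (hcF : ∀ ξ, c * ‖ξ‖ ≤ F ξ) :
    ∀ r ∈ {r : ℝ | ∃ ξ : EuclideanSpace ℝ (Fin n), ξ ≠ 0 ∧ r = ⟪x, ξ⟫ / F ξ}, r ≤ ‖x‖ / c := by
  rintro _ ⟨ξ, hξ, rfl⟩
  rw [div_le_div_iff₀ (hF.pos ξ hξ) hc]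
  have h1 := real_inner_le_norm x ξ
  have h2 := hcF ξ
  have h3 := norm_nonneg x
  nlinarith

theorem inner_le_dualNorm_mul (hF : IsMinkowskiNorm F) (x ξ : EuclideanSpace ℝ (Fin n)) :
    ⟪ξ, x⟫ ≤ dualNorm F x * F ξ := by
  rcases eq_or_ne ξ 0 with rfl | hξ
  · simp [hF.map_zero]
  obtain ⟨c, hc, hcF⟩ := hF.exists_pos_mul_norm_le
  rw [← div_le_iff₀ (hF.pos ξ hξ), real_inner_comm]
  exact le_csSup ⟨_, hF.dualNorm_set_bddAbove x hc hcF⟩ ⟨ξ, hξ, rfl⟩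

theorem exists_dualNorm_le (hF : IsMinkowskiNorm F) : ∃ C, 0 ≤ C ∧ ∀ x, dualNorm F x ≤ C * ‖x‖ := by
  obtain ⟨c, hc, hcF⟩ := hF.exists_pos_mul_norm_le
  refine ⟨c⁻¹, (inv_pos.2 hc).le, fun x => ?_⟩
  rw [inv_mul_eq_div]
  exact Real.sSup_le (hF.dualNorm_set_bddAbove x hc hcF) (by positivity)

theorem dualNorm_le_diam (hF : IsMinkowskiNorm F) {Ω : Set (EuclideanSpace ℝ (Fin n))}
    (hbd : Bornology.IsBounded Ω) {x y : EuclideanSpace ℝ (Fin n)} (hx : x ∈ closure Ω)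
    (hy : y ∈ closure Ω) :
    dualNorm F (y - x) ≤ sSup {d : ℝ | ∃ x₁ ∈ closure Ω, ∃ x₂ ∈ closure Ω,
      d = dualNorm F (x₂ - x₁)} := by
  obtain ⟨C, hC, hle⟩ := hF.exists_dualNorm_le
  refine le_csSup ⟨C * Metric.diam (closure Ω), ?_⟩ ⟨x, hx, y, hy, rfl⟩
  rintro _ ⟨x₁, h₁, x₂, h₂, rfl⟩
  refine (hle _).trans (mul_le_mul_of_nonneg_left ?_ hC)
  rw [← dist_eq_norm]
  exact Metric.dist_le_diam_of_mem hbd.closure h₂ h₁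

end IsMinkowskiNorm

/-- An extremal function on a smooth domain of dimension at least two has zero gradient. -/
theorem IsExtremal.grad_eq_zero {n : ℕ} (hn : 2 ≤ n)
    {S : Set (EuclideanSpace ℝ (Fin n))} {F : EuclideanSpace ℝ (Fin n) → ℝ}
    {u : EuclideanSpace ℝ (Fin n) → ℝ} {G : EuclideanSpace ℝ (Fin n) → EuclideanSpace ℝ (Fin n)}
    {d : ℝ} (h : IsExtremal S F u G d) (hS : HasSmoothBoundary S) {p : EuclideanSpace ℝ (Fin n)}
    (hp : p ∈ S) : G p = 0 := by
  by_contra hw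
  obtain ⟨c, hc⟩ := h.exists_const_on_frontier hn hS
  obtain ⟨ν, e, hν, hνe, he, hlt⟩ := h.norm.exists_norming_lt hn hw
  have hdir := dirichlet_poincare_direction h.isOpen h.bounded h.nonempty h.grad_cont
    (g := fun y => u y - c) (fun y hy => ((h.hasGradientAt y hy).hasFDerivAt.sub_const c))
    (fun y hy => sub_eq_zero.2 (hc y hy)) hνe h.diam_pos
    (fun x hx y hy => by simpa [hν] using h.diam x hx y hy ν)
  have huc := h.continuousOn
  have i1 : IntegrableOn (fun y => u y ^ 2) S := h.integrableOn (huc.pow 2) subset_rfl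
  have i2 : IntegrableOn (fun y => 2 * c * u y) S :=
    (h.integrableOn huc subset_rfl).const_mul _
  have i3 : IntegrableOn (fun y => u y ^ 2 - 2 * c * u y) S := i1.sub i2
  have i4 : IntegrableOn (fun y => (u y - c) ^ 2) S :=
    h.integrableOn ((huc.sub continuousOn_const).pow 2) subset_rfl
  have hsq : ∫ y in S, u y ^ 2 ≤ ∫ y in S, (u y - c) ^ 2 := by
    calc _ = ∫ y in S, (u y ^ 2 - 2 * c * u y) := by
          rw [integral_sub i1 i2, integral_const_mul, h.mean_zero, mul_zero, sub_zero]
      _ ≤ _ := setIntegral_mono i3 i4 fun y => by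
            simp only
            nlinarith [sq_nonneg c]
  have hGe : ContinuousOn (fun y => ⟪G y, e⟫ ^ 2) (closure S) :=
    (h.grad_cont.inner continuousOn_const).pow 2
  have hq : ContinuousOn (fun y => F (G y) ^ 2 - ⟪G y, e⟫ ^ 2) (closure S) :=
    h.continuousOn_F.sub hGe
  have hpos : 0 < ∫ y in S, (F (G y) ^ 2 - ⟪G y, e⟫ ^ 2) := by
    rw [setIntegral_pos_iff_support_of_nonneg_ae (Filter.Eventually.of_forall fun y => by
      simp only [Pi.zero_apply]
      rw [sub_nonneg, ← sq_abs ⟪G y, e⟫]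
      exact pow_le_pow_left₀ (abs_nonneg _) (he _) 2) (h.integrableOn hq subset_rfl)]
    have ho := (hq.mono subset_closure).isOpen_inter_preimage h.isOpen (isOpen_compl_singleton
      (x := (0 : ℝ)))
    rw [Set.inter_comm]
    refine ho.measure_pos volume ⟨p, hp, ?_⟩
    have : ⟪G p, e⟫ ^ 2 < F (G p) ^ 2 := by
      rw [← sq_abs ⟪G p, e⟫]
      exact pow_lt_pow_left₀ hlt (abs_nonneg _) two_ne_zero
    exact (sub_pos.2 this).ne'
  rw [integral_sub (h.integrableOn h.continuousOn_F subset_rfl)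
    (h.integrableOn hGe subset_rfl)] at hpos
  have hmul := mul_le_mul_of_nonneg_left hsq (show 0 ≤ π ^ 2 / d ^ 2 by positivity)
  linarith [h.energy_le]

/-- In dimension `n ≥ 2` the sharp anisotropic Poincaré inequality is strict for
nonconstant zero-mean functions: equality `λ₁ᴺ = π²/d_F²` holds only for a segment in ℝ. -/
theorem anisotropic_poincare_strict {n : ℕ} (hn : 2 ≤ n)
    (Ω : Set (EuclideanSpace ℝ (Fin n))) (hne : Ω.Nonempty)
    (hbd : Bornology.IsBounded Ω) (hop : IsOpen Ω) (hconv : Convex ℝ Ω)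
    (hsb : HasSmoothBoundary Ω)
    (F : EuclideanSpace ℝ (Fin n) → ℝ) (hF : IsMinkowskiNorm F)
    (dF : ℝ)
    (hdF : dF = sSup {d : ℝ | ∃ x₁ ∈ closure Ω, ∃ x₂ ∈ closure Ω,
      d = dualNorm F (x₂ - x₁)})
    (u : EuclideanSpace ℝ (Fin n) → ℝ) (V : Set (EuclideanSpace ℝ (Fin n)))
    (hV : IsOpen V) (hΩV : closure Ω ⊆ V) (hu : ContDiffOn ℝ 1 u V)
    (hnc : ¬ ∃ c : ℝ, ∀ x ∈ closure Ω, u x = c)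
    (hmean : ∫ x in Ω, u x = 0) :
    (π ^ 2 / dF ^ 2) * ∫ x in Ω, (u x) ^ 2 < ∫ x in Ω, F (gradient u x) ^ 2 := by
  by_contra! hcon
  have hgrad : ∀ y ∈ V, HasGradientAt u (gradient u y) y := fun y hy =>
    ((hu.differentiableOn one_ne_zero).differentiableAt (hV.mem_nhds hy)).hasGradientAt
  have hcont : ContinuousOn (gradient u) V :=
    (InnerProductSpace.toDual ℝ _).symm.continuous.comp_continuousOn
      (hu.continuousOn_fderiv_of_isOpen hV le_rfl)
  have hdiam : ∀ x ∈ closure Ω, ∀ y ∈ closure Ω, ∀ ξ, ⟪ξ, y - x⟫ ≤ dF * F ξ := by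
    intro x hx y hy ξ
    refine (hF.inner_le_dualNorm_mul _ _).trans (mul_le_mul_of_nonneg_right ?_ (hF.nonneg ξ))
    rw [hdF]
    exact hF.dualNorm_le_diam hbd hx hy
  have hpos : 0 < dF := by
    obtain ⟨x, hx⟩ := hne
    have : Nontrivial (EuclideanSpace ℝ (Fin n)) := by
      refine Module.nontrivial_of_finrank_pos (R := ℝ) ?_
      rw [finrank_euclideanSpace_fin]
      omega
    have hneb : (nhdsWithin x {x}ᶜ).NeBot := Module.punctured_nhds_neBot ℝ _ x
    have hev : ∀ᶠ y in nhdsWithin x {x}ᶜ, y ∈ Ω := mem_nhdsWithin_of_mem_nhds (hop.mem_nhds hx)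
    obtain ⟨y, hy, hyx⟩ := (hev.and self_mem_nhdsWithin).exists
    have hyx : y - x ≠ 0 := sub_ne_zero.2 hyx
    have h1 := hdiam x (subset_closure hx) y (subset_closure hy) (y - x)
    have h2 := real_inner_self_pos.2 hyx
    exact pos_of_mul_pos_left (h2.trans_le h1) (hF.nonneg _)
  have hext : IsExtremal Ω F u (gradient u) dF :=
    { isOpen := hop
      convex := hconv
      bounded := hbd
      nonempty := hne
      norm := hF
      grad_cont := hcont.mono hΩV
      hasGradientAt := fun y hy => hgrad y (hΩV hy)
      mean_zero := hmean
      diam_pos := hpos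
      diam := hdiam
      energy_le := hcon }
  obtain ⟨o, ho⟩ := hne
  have hΩ : Ω ⊆ closure Ω := subset_closure
  have hconst : ∀ y ∈ Ω, u y = u o := fun y hy =>
    hop.is_const_of_fderiv_eq_zero (𝕜 := ℝ) hconv.isPreconnected
      (fun z hz => (hgrad z (hΩV (hΩ hz))).differentiableAt.differentiableWithinAt)
      (fun z hz => by
        rw [(hgrad z (hΩV (hΩ hz))).hasFDerivAt.fderiv, hext.grad_eq_zero hn hsb hz, map_zero]
        rfl) hy ho
  refine hnc ⟨u o, fun y hy => ?_⟩
  have hEq : Set.EqOn u (fun _ => u o) (closure Ω) :=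
    Set.EqOn.of_subset_closure hconst hext.continuousOn continuousOn_const hΩ subset_rfl
  exact hEq hy
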